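/- arXiv:2404.09306 — 2 statements merged into one kernel-verified Lean document; each statement's English description precedes it below -/
import Mathlib

section
/- Let (σ_n) be a bounded sequence of positive real numbers. Consider the shuffled regression model with standard Gaussian errors δ_i ~ N(0,1) and a continuous (atomless) covariate distribution μ_X on [0,1], where Y_i = m(X_i) + σ_n·δ_i and one observes Y₁,…,Y_n together with the order statistics X_(1) ≤ … ≤ X_(n). Then for every a > 0 and all sufficiently large M > 0 there exist positive constants c, C such that for all n ≥ 16, if σ_n ≥ C·n^{−1/2}·(log n)·(log log n)^{−1/2}, then the population shuffled minimax risk satisfies R_S(M,a,n,μ_X) ≥ c·σ_n·(log log n)^{1/2}/(log n). -/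
open MeasureTheory ProbabilityTheory Filter Set
open scoped ENNReal NNReal Classical

noncomputable section

/-- The class of nondecreasing functions on `[0,1]` that are left-continuous with
right-hand limits at every point (LCRR). -/
def LCRR : Set (ℝ → ℝ) :=
  {m | MonotoneOn m (Icc 0 1) ∧
    (∀ x ∈ Ioc (0 : ℝ) 1, Tendsto m (nhdsWithin x (Iio x)) (nhds (m x))) ∧
    (∀ x ∈ Ico (0 : ℝ) 1, ∃ L : ℝ, Tendsto m (nhdsWithin x (Ioi x)) (nhds L))}

/-- The class `M(M, a)` of LCRR nondecreasing functions with `∫ |m|^(a+2) dμ_X ≤ M`. -/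
def MM (μX : Measure ℝ) (M a : ℝ) : Set (ℝ → ℝ) :=
  {m | m ∈ LCRR ∧
    ∫⁻ x, ENNReal.ofReal (|m x| ^ (a + 2)) ∂μX ≤ ENNReal.ofReal M}

/-- The law of the observations in the shuffled regression model: from i.i.d. pairs
`(Xᵢ, δᵢ)`, one observes the vector `(Y₁,…,Yₙ)` with `Yᵢ = m(Xᵢ) + σ δᵢ` together with
the order statistics `X₍₁₎ ≤ … ≤ X₍ₙ₎` of the `Xᵢ`'s. -/
def shuffledLaw (μX μδ : Measure ℝ) (σ : ℝ) (m : ℝ → ℝ) (n : ℕ) :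
    Measure ((Fin n → ℝ) × (Fin n → ℝ)) :=
  (Measure.pi fun _ : Fin n => μX.prod μδ).map fun ω =>
    (fun i => m (ω i).1 + σ * (ω i).2,
     fun j => (ω (Tuple.sort (fun i => (ω i).1) j)).1)

/-- The population risk `E_m ∫ |m̂ - m| dμ_X` of an estimator `m̂` of the link function
in the shuffled regression model. -/
def popRisk (μX : Measure ℝ) {n : ℕ}
    (P : Measure ((Fin n → ℝ) × (Fin n → ℝ)))
    (mhat : ((Fin n → ℝ) × (Fin n → ℝ)) → ℝ → ℝ) (m : ℝ → ℝ) : ℝ≥0∞ :=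
  ∫⁻ d, ∫⁻ x, ENNReal.ofReal |mhat d x - m x| ∂μX ∂P

/-- The empirical risk `E_m ∫ |m̂ - m| dμ̂_X` in the shuffled regression model, where
`μ̂_X` is the empirical distribution of the `Xᵢ`'s (recovered from the order
statistics, the second observed component). -/
def empRisk {n : ℕ}
    (P : Measure ((Fin n → ℝ) × (Fin n → ℝ)))
    (mhat : ((Fin n → ℝ) × (Fin n → ℝ)) → ℝ → ℝ) (m : ℝ → ℝ) : ℝ≥0∞ :=
  ∫⁻ d, (n : ℝ≥0∞)⁻¹ *
    ∑ i : Fin n, ENNReal.ofReal |mhat d (d.2 i) - m (d.2 i)| ∂P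

/-- Resampling one coordinate of a product of probability measures. -/
theorem mp_update {n : ℕ} {Y : Type*} [MeasurableSpace Y] (ρ : Fin n → Measure Y)
    [∀ i, IsProbabilityMeasure (ρ i)] (i : Fin n) :
    MeasurePreserving (fun p : (Fin n → Y) × Y => Function.update p.1 i p.2)
      ((Measure.pi ρ).prod (ρ i)) (Measure.pi ρ) := by
  have hm : Measurable (fun p : (Fin n → Y) × Y => Function.update p.1 i p.2) := by
    rw [measurable_pi_iff]
    intro j
    by_cases h : j = i
    · subst h; simpa using measurable_snd
    · simp only [Function.update_of_ne h]
      exact (measurable_pi_apply j).comp measurable_fst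
  refine ⟨hm, ?_⟩
  symm
  apply Measure.pi_eq
  intro s hs
  rw [Measure.map_apply hm (MeasurableSet.univ_pi hs)]
  have : (fun p : (Fin n → Y) × Y => Function.update p.1 i p.2) ⁻¹' (univ.pi s)
      = (univ.pi (Function.update s i univ)) ×ˢ (s i) := by
    ext p
    simp only [mem_preimage, mem_univ_pi, mem_prod]
    constructor
    · intro h
      refine ⟨fun j => ?_, by simpa using h i⟩
      by_cases hj : j = i
      · subst hj; simp
      · simpa [hj] using h j
    · rintro ⟨h1, h2⟩ j
      by_cases hj : j = i
      · subst hj; simpa using h2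
      · simpa [hj] using h1 j
  rw [this, Measure.prod_prod, Measure.pi_pi, ← Finset.prod_erase_mul _ _ (Finset.mem_univ i),
    ← Finset.prod_erase_mul Finset.univ (fun j => ρ j (s j)) (Finset.mem_univ i)]
  simp only [Function.update_self, measure_univ, mul_one]
  congr 1
  apply Finset.prod_congr rfl
  intro j hj
  rw [Function.update_of_ne (Finset.ne_of_mem_erase hj)]

theorem lintegral_pi_prod {n : ℕ} {Y : Type*} [MeasurableSpace Y] (ρ : Fin n → Measure Y)
    [∀ i, IsProbabilityMeasure (ρ i)] (f : Fin n → Y → ℝ≥0∞) (hf : ∀ i, Measurable (f i)) :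
    ∫⁻ y, ∏ i, f i (y i) ∂(Measure.pi ρ) = ∏ i, ∫⁻ z, f i z ∂(ρ i) := by
  have h := iIndepFun_pi (μ := ρ) (X := f) (fun i => (hf i).aemeasurable)
  rw [lintegral_prod_eq_prod_lintegral_of_indepFun Finset.univ _ h
    (fun i => (hf i).comp (measurable_pi_apply i))]
  apply Finset.prod_congr rfl
  intro i _
  exact (measurePreserving_eval ρ i).lintegral_comp (hf i)

theorem pi_withDensity' {n : ℕ} {Y : Type*} [MeasurableSpace Y] (ρ : Fin n → Measure Y)
    [∀ i, IsProbabilityMeasure (ρ i)] (f : Fin n → Y → ℝ≥0∞) (hf : ∀ i, Measurable (f i))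
    [∀ i, SigmaFinite ((ρ i).withDensity (f i))] :
    Measure.pi (fun i => (ρ i).withDensity (f i))
      = (Measure.pi ρ).withDensity (fun y => ∏ i, f i (y i)) := by
  apply Measure.pi_eq
  intro s hs
  rw [withDensity_apply _ (MeasurableSet.univ_pi hs), ← lintegral_indicator (MeasurableSet.univ_pi hs)]
  have : (univ.pi s).indicator (fun y : Fin n → Y => ∏ i, f i (y i))
      = fun y => ∏ i, (s i).indicator (f i) (y i) := by
    ext y
    by_cases h : y ∈ univ.pi s
    · rw [indicator_of_mem h]
      exact Finset.prod_congr rfl fun i _ => (indicator_of_mem (h i (mem_univ i)) _).symm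
    · rw [indicator_of_notMem h]
      simp only [mem_univ_pi, not_forall] at h
      obtain ⟨i, hi⟩ := h
      exact (Finset.prod_eq_zero (Finset.mem_univ i) (indicator_of_notMem hi _)).symm
  rw [this, lintegral_pi_prod ρ _ (fun i => (hf i).indicator (hs i))]
  apply Finset.prod_congr rfl
  intro i _
  rw [lintegral_indicator (hs i), withDensity_apply _ (hs i)]

theorem mp_perm {n : ℕ} {X : Type*} [MeasurableSpace X] (μ : Measure X)
    [IsProbabilityMeasure μ] (π : Equiv.Perm (Fin n)) :
    MeasurePreserving (fun x : Fin n → X => x ∘ π)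
      (Measure.pi fun _ => μ) (Measure.pi fun _ => μ) := by
  have h := measurePreserving_piCongrLeft (α := fun _ : Fin n => X) (fun _ : Fin n => μ) π.symm
  convert h using 1
  ext x i
  have := MeasurableEquiv.piCongrLeft_apply_apply (π.symm) (β := fun _ : Fin n => X) x (π i)
  simpa using this.symm

theorem measurable_sort {n : ℕ} :
    Measurable (fun x : Fin n → ℝ => (fun j => x (Tuple.sort x j))) := by
  have h1 : ∀ π : Equiv.Perm (Fin n), MeasurableSet {x : Fin n → ℝ | Tuple.sort x = π} := by
    intro π
    have : {x : Fin n → ℝ | Tuple.sort x = π} =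
        (⋂ i, ⋂ j, ⋂ (_ : i ≤ j), {x | x (π i) ≤ x (π j)}) ∩
        (⋂ i, ⋂ j, ⋂ (_ : i < j), {x | x (π i) = x (π j) → π i < π j}) := by
      ext x
      simp only [mem_inter_iff, mem_iInter, mem_ofPred_eq]
      rw [eq_comm, Tuple.eq_sort_iff]
      rfl
    rw [this]
    refine MeasurableSet.inter ?_ ?_
    · refine MeasurableSet.iInter fun i => MeasurableSet.iInter fun j => MeasurableSet.iInter fun _ => ?_
      exact measurableSet_le (measurable_pi_apply _) (measurable_pi_apply _)
    · refine MeasurableSet.iInter fun i => MeasurableSet.iInter fun j => MeasurableSet.iInter fun _ => ?_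
      by_cases h : π i < π j
      · simp [h]
      · simp only [h, imp_false]
        have h3 : MeasurableSet {x : Fin n → ℝ | x (π i) = x (π j)} :=
          measurableSet_eq_fun (measurable_pi_apply _) (measurable_pi_apply _)
        exact h3.compl
  rw [measurable_pi_iff]
  intro j
  have h2 : (fun x : Fin n → ℝ => x (Tuple.sort x j))
      = fun x => ∑ π : Equiv.Perm (Fin n), {x : Fin n → ℝ | Tuple.sort x = π}.indicator
        (fun x => x (π j)) x := by
    ext x
    rw [Finset.sum_eq_single (Tuple.sort x)]
    · rw [indicator_of_mem]; rfl
    · intro b _ hb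
      apply indicator_of_notMem
      intro h
      exact hb (Eq.symm h)
    · simp
  rw [h2]
  exact Finset.measurable_sum _ fun π _ => (measurable_pi_apply _).indicator (h1 π)

theorem mp_integral {α β : Type*} [MeasurableSpace α] [MeasurableSpace β] {μ : Measure α}
    {ν : Measure β} {f : α → β} (hf : MeasurePreserving f μ ν) {g : β → ℝ}
    (hg : AEStronglyMeasurable g ν) : ∫ a, g (f a) ∂μ = ∫ b, g b ∂ν := by
  have h := hf.map_eq
  rw [← h] at hg
  rw [← h, integral_map hf.measurable.aemeasurable hg]

/-- Symmetrised likelihood ratio over the coordinates in `S`. -/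
def Lsym {n : ℕ} {X Y : Type*} (ψ : X → Y → ℝ) (S : Finset (Fin n))
    (p : (Fin n → X) × (Fin n → Y)) : ℝ :=
  (n.factorial : ℝ)⁻¹ * ∑ π : Equiv.Perm (Fin n), ∏ i ∈ S, ψ (p.1 (π i)) (p.2 i)

structure CoreHyp {X Y : Type*} [MeasurableSpace X] [MeasurableSpace Y] (μ : Measure X)
    (ρ : Measure Y) (ψ : X → Y → ℝ) (b : Y → ℝ) (V W : ℝ) : Prop where
  meas : Measurable (fun p : X × Y => ψ p.1 p.2)
  bmeas : Measurable b
  b0 : ∀ y, 0 ≤ b y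
  lo : ∀ x y, Real.exp (-b y) ≤ ψ x y
  hi : ∀ x y, ψ x y ≤ Real.exp (b y)
  int : Integrable (fun y => Real.exp (3 * b y)) ρ
  mean : ∀ x, ∫ y, ψ x y ∂ρ = 1
  V0 : 0 ≤ V
  W0 : 0 ≤ W
  hV : ∫ x, ∫ y, ψ x y * ψ x y ∂ρ ∂μ ≤ 1 + V
  hW : ∫ x, ∫ x', ∫ y, ψ x y * ψ x' y ∂ρ ∂μ ∂μ ≤ 1 + W

section core
variable {n : ℕ} {X Y : Type*} [MeasurableSpace X] [MeasurableSpace Y] {μ : Measure X}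
    [IsProbabilityMeasure μ] {ρ : Fin n → Measure Y} [∀ i, IsProbabilityMeasure (ρ i)]
    {ρ₀ : Measure Y} [IsProbabilityMeasure ρ₀] {ψ : X → Y → ℝ} {b : Y → ℝ} {V W : ℝ}

theorem fact_avg_const (c : ℝ) :
    (n.factorial : ℝ)⁻¹ * ∑ _π : Equiv.Perm (Fin n), c = c := by
  have h : (n.factorial : ℝ) ≠ 0 := by exact_mod_cast n.factorial_ne_zero
  rw [Finset.sum_const, Finset.card_univ, Fintype.card_perm, Fintype.card_fin, nsmul_eq_mul,
    ← mul_assoc, inv_mul_cancel₀ h, one_mul]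

theorem CoreHyp.pos (h : CoreHyp μ ρ₀ ψ b V W) (x : X) (y : Y) : 0 < ψ x y :=
  lt_of_lt_of_le (Real.exp_pos _) (h.lo x y)

theorem CoreHyp.w_le (h : CoreHyp μ ρ₀ ψ b V W) (S : Finset (Fin n))
    (x : Fin n → X) (y : Fin n → Y) (π : Equiv.Perm (Fin n)) :
    ∏ i ∈ S, ψ (x (π i)) (y i) ≤ Real.exp (∑ i ∈ S, b (y i)) := by
  rw [Real.exp_sum]
  exact Finset.prod_le_prod (fun i _ => (h.pos _ _).le) (fun i _ => h.hi _ _)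

theorem CoreHyp.le_w (h : CoreHyp μ ρ₀ ψ b V W) (S : Finset (Fin n))
    (x : Fin n → X) (y : Fin n → Y) (π : Equiv.Perm (Fin n)) :
    Real.exp (-∑ i ∈ S, b (y i)) ≤ ∏ i ∈ S, ψ (x (π i)) (y i) := by
  rw [← Finset.sum_neg_distrib, Real.exp_sum]
  exact Finset.prod_le_prod (fun i _ => (Real.exp_pos _).le) (fun i _ => h.lo _ _)

theorem CoreHyp.w_pos (h : CoreHyp μ ρ₀ ψ b V W) (S : Finset (Fin n))
    (x : Fin n → X) (y : Fin n → Y) (π : Equiv.Perm (Fin n)) :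
    0 < ∏ i ∈ S, ψ (x (π i)) (y i) := Finset.prod_pos fun i _ => h.pos _ _

theorem CoreHyp.w_meas (h : CoreHyp μ ρ₀ ψ b V W) (S : Finset (Fin n)) (π : Equiv.Perm (Fin n)) :
    Measurable (fun p : (Fin n → X) × (Fin n → Y) => ∏ i ∈ S, ψ (p.1 (π i)) (p.2 i)) := by
  refine Finset.measurable_prod _ fun i _ => ?_
  have h1 : Measurable (fun p : (Fin n → X) × (Fin n → Y) => (p.1 (π i), p.2 i)) := by
    fun_prop
  exact h.meas.comp h1

theorem CoreHyp.L_meas (h : CoreHyp μ ρ₀ ψ b V W) (S : Finset (Fin n)) :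
    Measurable (Lsym (n := n) ψ S) := by
  unfold Lsym
  exact (Finset.measurable_sum _ fun π _ => h.w_meas S π).const_mul _

theorem CoreHyp.L_le (h : CoreHyp μ ρ₀ ψ b V W) (S : Finset (Fin n))
    (p : (Fin n → X) × (Fin n → Y)) :
    Lsym ψ S p ≤ Real.exp (∑ i ∈ S, b (p.2 i)) := by
  rw [← fact_avg_const (n := n) (Real.exp _)]
  unfold Lsym
  gcongr
  exact h.w_le S _ _ _

theorem CoreHyp.le_L (h : CoreHyp μ ρ₀ ψ b V W) (S : Finset (Fin n))
    (p : (Fin n → X) × (Fin n → Y)) :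
    Real.exp (-∑ i ∈ S, b (p.2 i)) ≤ Lsym ψ S p := by
  rw [← fact_avg_const (n := n) (Real.exp _)]
  unfold Lsym
  gcongr
  exact h.le_w S _ _ _

theorem CoreHyp.L_pos (h : CoreHyp μ ρ₀ ψ b V W) (S : Finset (Fin n))
    (p : (Fin n → X) × (Fin n → Y)) : 0 < Lsym ψ S p :=
  lt_of_lt_of_le (Real.exp_pos _) (h.le_L S p)

theorem CoreHyp.abs_log_L (h : CoreHyp μ ρ₀ ψ b V W) (S : Finset (Fin n))
    (p : (Fin n → X) × (Fin n → Y)) : |Real.log (Lsym ψ S p)| ≤ ∑ i ∈ S, b (p.2 i) := by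
  rw [abs_le]
  constructor
  · rw [Real.le_log_iff_exp_le (h.L_pos S p)]; exact h.le_L S p
  · rw [Real.log_le_iff_le_exp (h.L_pos S p)]; exact h.L_le S p

theorem CoreHyp.dom_pi (h : CoreHyp μ ρ₀ ψ b V W) (S : Finset (Fin n)) (hS : ∀ i ∈ S, ρ i = ρ₀) :
    Integrable (fun y : Fin n → Y => Real.exp (3 * ∑ i ∈ S, b (y i))) (Measure.pi ρ) := by
  have h1 : (fun y : Fin n → Y => Real.exp (3 * ∑ i ∈ S, b (y i)))
      = fun y => ∏ i, (if i ∈ S then fun z => Real.exp (3 * b z) else fun _ => 1) (y i) := by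
    ext y
    rw [Finset.mul_sum, Real.exp_sum, ← Finset.prod_subset (Finset.subset_univ S)]
    · exact Finset.prod_congr rfl fun i hi => by simp [hi]
    · intro i _ hi; simp [hi]
  rw [h1]
  apply Integrable.fintype_prod
  intro i
  by_cases hi : i ∈ S
  · simp only [hi, if_true]; rw [hS i hi]; exact h.int
  · simp only [hi, if_false]; exact integrable_const _

theorem CoreHyp.dom (h : CoreHyp μ ρ₀ ψ b V W) (S : Finset (Fin n)) (hS : ∀ i ∈ S, ρ i = ρ₀) :
    Integrable (fun p : (Fin n → X) × (Fin n → Y) => Real.exp (3 * ∑ i ∈ S, b (p.2 i)))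
      ((Measure.pi fun _ => μ).prod (Measure.pi ρ)) :=
  (h.dom_pi S hS).comp_snd _

theorem CoreHyp.int_w (h : CoreHyp μ ρ₀ ψ b V W) (S : Finset (Fin n)) (hS : ∀ i ∈ S, ρ i = ρ₀)
    (x : Fin n → X) (π : Equiv.Perm (Fin n)) :
    ∫ y, ∏ i ∈ S, ψ (x (π i)) (y i) ∂(Measure.pi ρ) = 1 := by
  have h1 : (fun y : Fin n → Y => ∏ i ∈ S, ψ (x (π i)) (y i))
      = fun y => ∏ i, (if i ∈ S then fun z => ψ (x (π i)) z else fun _ => 1) (y i) := by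
    ext y
    rw [← Finset.prod_subset (Finset.subset_univ S)]
    · exact Finset.prod_congr rfl fun i hi => by simp [hi]
    · intro i _ hi; simp [hi]
  rw [h1, integral_fintype_prod_eq_prod]
  apply Finset.prod_eq_one
  intro i _
  by_cases hi : i ∈ S
  · simp only [hi, if_true]; rw [hS i hi]; exact h.mean _
  · simp [hi]

theorem CoreHyp.sum_b_nonneg (h : CoreHyp μ ρ₀ ψ b V W) (S : Finset (Fin n)) (y : Fin n → Y) :
    0 ≤ ∑ i ∈ S, b (y i) := Finset.sum_nonneg fun i _ => h.b0 _

theorem CoreHyp.integrable_of_le (h : CoreHyp μ ρ₀ ψ b V W) (S : Finset (Fin n))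
    (hS : ∀ i ∈ S, ρ i = ρ₀) {F : (Fin n → X) × (Fin n → Y) → ℝ} (hF : Measurable F)
    (C : ℝ) (hle : ∀ p, |F p| ≤ C * Real.exp (3 * ∑ i ∈ S, b (p.2 i))) :
    Integrable F ((Measure.pi fun _ => μ).prod (Measure.pi ρ)) := by
  refine Integrable.mono' ((h.dom S hS).const_mul C) hF.aestronglyMeasurable ?_
  exact Eventually.of_forall fun p => by simpa using hle p

theorem CoreHyp.L_int (h : CoreHyp μ ρ₀ ψ b V W) (S : Finset (Fin n))
    (hS : ∀ i ∈ S, ρ i = ρ₀) :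
    Integrable (Lsym ψ S) ((Measure.pi fun _ => μ).prod (Measure.pi ρ)) := by
  refine h.integrable_of_le S hS (h.L_meas S) 1 fun p => ?_
  rw [abs_of_pos (h.L_pos S p), one_mul]
  refine (h.L_le S p).trans (Real.exp_le_exp.2 ?_)
  have := h.sum_b_nonneg S p.2
  linarith

theorem CoreHyp.w_int (h : CoreHyp μ ρ₀ ψ b V W) (S : Finset (Fin n))
    (hS : ∀ i ∈ S, ρ i = ρ₀) (π : Equiv.Perm (Fin n)) :
    Integrable (fun p : (Fin n → X) × (Fin n → Y) => ∏ i ∈ S, ψ (p.1 (π i)) (p.2 i))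
      ((Measure.pi fun _ => μ).prod (Measure.pi ρ)) := by
  refine h.integrable_of_le S hS (h.w_meas S π) 1 fun p => ?_
  rw [abs_of_pos (h.w_pos S _ _ _), one_mul]
  refine (h.w_le S _ _ _).trans (Real.exp_le_exp.2 ?_)
  have := h.sum_b_nonneg S p.2
  linarith

theorem CoreHyp.integral_L (h : CoreHyp μ ρ₀ ψ b V W) (S : Finset (Fin n))
    (hS : ∀ i ∈ S, ρ i = ρ₀) :
    ∫ p, Lsym ψ S p ∂((Measure.pi fun _ => μ).prod (Measure.pi ρ)) = 1 := by
  unfold Lsym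
  rw [integral_const_mul, integral_finsetSum _ fun π _ => h.w_int S hS π]
  rw [← fact_avg_const (n := n) 1]
  congr 1
  apply Finset.sum_congr rfl
  intro π _
  rw [integral_prod _ (h.w_int S hS π)]
  simp only
  simp_rw [h.int_w S hS _ π]
  simp

/-- mixed kernel -/
def kk (ρ : Measure Y) (ψ : X → Y → ℝ) (x x' : X) : ℝ := ∫ y, ψ x y * ψ x' y ∂ρ

theorem CoreHyp.psi2_int (h : CoreHyp μ ρ₀ ψ b V W) (x x' : X) :
    Integrable (fun y => ψ x y * ψ x' y) ρ₀ := by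
  refine Integrable.mono' h.int ?_ (Eventually.of_forall fun y => ?_)
  · exact ((h.meas.comp measurable_prodMk_left).mul
      (h.meas.comp measurable_prodMk_left)).aestronglyMeasurable
  · rw [Real.norm_eq_abs, abs_of_pos (mul_pos (h.pos _ _) (h.pos _ _))]
    calc ψ x y * ψ x' y ≤ Real.exp (b y) * Real.exp (b y) :=
          mul_le_mul (h.hi _ _) (h.hi _ _) (h.pos _ _).le (Real.exp_pos _).le
      _ = Real.exp (2 * b y) := by rw [← Real.exp_add]; ring_nf
      _ ≤ _ := Real.exp_le_exp.2 (by have := h.b0 y; linarith)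

theorem CoreHyp.psi_int (h : CoreHyp μ ρ₀ ψ b V W) (x : X) :
    Integrable (fun y => ψ x y) ρ₀ := by
  refine Integrable.mono' h.int ?_ (Eventually.of_forall fun y => ?_)
  · exact (h.meas.comp measurable_prodMk_left).aestronglyMeasurable
  · rw [Real.norm_eq_abs, abs_of_pos (h.pos _ _)]
    exact (h.hi _ _).trans (Real.exp_le_exp.2 (by have := h.b0 y; linarith))

theorem CoreHyp.kk_nonneg (h : CoreHyp μ ρ₀ ψ b V W) (x x' : X) : 0 ≤ kk ρ₀ ψ x x' :=
  integral_nonneg fun y => (mul_pos (h.pos _ _) (h.pos _ _)).le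

theorem CoreHyp.kk_le (h : CoreHyp μ ρ₀ ψ b V W) (x x' : X) :
    kk ρ₀ ψ x x' ≤ ∫ y, Real.exp (3 * b y) ∂ρ₀ := by
  refine integral_mono (h.psi2_int x x') h.int fun y => ?_
  calc ψ x y * ψ x' y ≤ Real.exp (b y) * Real.exp (b y) :=
        mul_le_mul (h.hi _ _) (h.hi _ _) (h.pos _ _).le (Real.exp_pos _).le
    _ = Real.exp (2 * b y) := by rw [← Real.exp_add]; ring_nf
    _ ≤ _ := Real.exp_le_exp.2 (by have := h.b0 y; linarith)

theorem CoreHyp.kk_meas (h : CoreHyp μ ρ₀ ψ b V W) :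
    Measurable (fun p : X × X => kk ρ₀ ψ p.1 p.2) := by
  have : StronglyMeasurable (fun q : (X × X) × Y => ψ q.1.1 q.2 * ψ q.1.2 q.2) := by
    apply Measurable.stronglyMeasurable
    exact (h.meas.comp ((measurable_fst.comp measurable_fst).prodMk measurable_snd)).mul
      (h.meas.comp ((measurable_snd.comp measurable_fst).prodMk measurable_snd))
  exact (this.integral_prod_right (ν := ρ₀)).measurable

/-- chi-square functional of the remaining covariates -/
def al (ρ : Measure Y) (ψ : X → Y → ℝ) (S : Finset (Fin n)) (x : Fin n → X) : ℝ :=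
  (((Sᶜ.card : ℝ))⁻¹) ^ 2 * ∑ l ∈ Sᶜ, ∑ l' ∈ Sᶜ, kk ρ ψ (x l) (x l')

theorem CoreHyp.kk_pi_int (h : CoreHyp μ ρ₀ ψ b V W) (l l' : Fin n) :
    Integrable (fun x : Fin n → X => kk ρ₀ ψ (x l) (x l')) (Measure.pi fun _ => μ) := by
  refine Integrable.mono' (integrable_const (∫ y, Real.exp (3 * b y) ∂ρ₀)) ?_
    (Eventually.of_forall fun x => ?_)
  · have h1 : Measurable (fun x : Fin n → X => (x l, x l')) := by fun_prop
    exact (h.kk_meas.comp h1).aestronglyMeasurable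
  · rw [Real.norm_eq_abs, abs_of_nonneg (h.kk_nonneg _ _)]
    exact h.kk_le _ _

theorem CoreHyp.kk_diag (h : CoreHyp μ ρ₀ ψ b V W) (l : Fin n) :
    ∫ x : Fin n → X, kk ρ₀ ψ (x l) (x l) ∂(Measure.pi fun _ => μ) ≤ 1 + V := by
  have h1 := mp_integral (measurePreserving_eval (fun _ : Fin n => μ) l)
    (g := fun x => kk ρ₀ ψ x x)
    (h.kk_meas.comp (measurable_id.prodMk measurable_id)).aestronglyMeasurable
  exact (le_of_eq h1).trans h.hV

theorem CoreHyp.kk_off (h : CoreHyp μ ρ₀ ψ b V W) (l l' : Fin n) (hl : l ≠ l') :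
    ∫ x : Fin n → X, kk ρ₀ ψ (x l) (x l') ∂(Measure.pi fun _ => μ) ≤ 1 + W := by
  have h0 : Integrable (fun p : (Fin n → X) × X => kk ρ₀ ψ p.2 (p.1 l'))
      ((Measure.pi fun _ => μ).prod μ) := by
    refine Integrable.mono' (integrable_const (∫ y, Real.exp (3 * b y) ∂ρ₀)) ?_
      (Eventually.of_forall fun x => ?_)
    · exact (h.kk_meas.comp (measurable_snd.prodMk ((measurable_pi_apply l').comp
        measurable_fst))).aestronglyMeasurable
    · rw [Real.norm_eq_abs, abs_of_nonneg (h.kk_nonneg _ _)]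
      exact h.kk_le _ _
  have h1 := mp_integral (mp_update (fun _ : Fin n => μ) l)
    (g := fun x => kk ρ₀ ψ (x l) (x l')) (h.kk_pi_int l l').aestronglyMeasurable
  rw [← h1]
  simp only [Function.update_self, Function.update_of_ne hl.symm]
  rw [integral_prod_symm _ h0]
  refine le_trans (le_of_eq ?_) h.hW
  congr 1
  ext x
  exact mp_integral (measurePreserving_eval (fun _ : Fin n => μ) l')
    (g := fun x' => kk ρ₀ ψ x x')
    (h.kk_meas.comp measurable_prodMk_left).aestronglyMeasurable

theorem CoreHyp.al_int_le (h : CoreHyp μ ρ₀ ψ b V W) (S : Finset (Fin n)) (hS : 0 < Sᶜ.card) :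
    ∫ x : Fin n → X, al ρ₀ ψ S x ∂(Measure.pi fun _ => μ) ≤ 1 + V / Sᶜ.card + W := by
  unfold al
  rw [integral_const_mul, integral_finsetSum _ fun l _ =>
    integrable_finsetSum _ fun l' _ => h.kk_pi_int l l']
  have h1 : ∀ l ∈ Sᶜ, ∫ x : Fin n → X, ∑ l' ∈ Sᶜ, kk ρ₀ ψ (x l) (x l') ∂(Measure.pi fun _ => μ)
      ≤ V + Sᶜ.card * (1 + W) := by
    intro l hl
    rw [integral_finsetSum _ fun l' _ => h.kk_pi_int l l', ← Finset.sum_erase_add _ _ hl]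
    have h2 : ∑ l' ∈ (Sᶜ).erase l, ∫ x : Fin n → X, kk ρ₀ ψ (x l) (x l') ∂(Measure.pi fun _ => μ)
        ≤ ∑ l' ∈ (Sᶜ).erase l, (1 + W) :=
      Finset.sum_le_sum fun l' hl' => h.kk_off l l' (Finset.ne_of_mem_erase hl').symm
    rw [Finset.sum_const, Finset.card_erase_of_mem hl, nsmul_eq_mul, Nat.cast_sub hS] at h2
    have h3 := h.kk_diag (n := n) l
    have h4 := h.W0
    push_cast at h2
    nlinarith
  have h5 := Finset.sum_le_sum h1
  rw [Finset.sum_const, nsmul_eq_mul] at h5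
  have hc : (0 : ℝ) < Sᶜ.card := by exact_mod_cast hS
  calc _ ≤ ((Sᶜ.card : ℝ)⁻¹) ^ 2 * (Sᶜ.card * (V + Sᶜ.card * (1 + W))) := by gcongr
    _ = 1 + V / Sᶜ.card + W := by field_simp; ring

end core

section core2
variable {n : ℕ} {X Y : Type*} [MeasurableSpace X] [MeasurableSpace Y] {μ : Measure X}
    [IsProbabilityMeasure μ] {ρ : Fin n → Measure Y} [∀ i, IsProbabilityMeasure (ρ i)]
    {ρ₀ : Measure Y} [IsProbabilityMeasure ρ₀] {ψ : X → Y → ℝ} {b : Y → ℝ} {V W : ℝ}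

/-- resampling map -/
def UU {n : ℕ} {X Y : Type*} (i : Fin n) (q : ((Fin n → X) × (Fin n → Y)) × Y) :
    (Fin n → X) × (Fin n → Y) := (q.1.1, Function.update q.1.2 i q.2)

theorem mp_UU (i : Fin n) : MeasurePreserving (UU (X := X) i)
    (((Measure.pi fun _ => μ).prod (Measure.pi ρ)).prod (ρ i))
    ((Measure.pi fun _ : Fin n => μ).prod (Measure.pi ρ)) := by
  have h1 := measurePreserving_prodAssoc (Measure.pi fun _ : Fin n => μ) (Measure.pi ρ) (ρ i)
  have h2 := (MeasurePreserving.id (Measure.pi fun _ : Fin n => μ)).prod (mp_update ρ i)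
  exact h2.comp h1

theorem Lsym_UU {S : Finset (Fin n)} {i : Fin n} (hi : i ∉ S)
    (q : (Fin n → X) × (Fin n → Y)) (z : Y) : Lsym ψ S (UU i (q, z)) = Lsym ψ S q := by
  unfold Lsym UU
  congr 1
  refine Finset.sum_congr rfl fun π _ => Finset.prod_congr rfl fun j hj => ?_
  have : j ≠ i := fun h => hi (h ▸ hj)
  simp [Function.update_of_ne this]

theorem Lsym_insert_UU {S : Finset (Fin n)} {i : Fin n} (hi : i ∉ S)
    (q : (Fin n → X) × (Fin n → Y)) (z : Y) : Lsym ψ (insert i S) (UU i (q, z))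
      = (n.factorial : ℝ)⁻¹ * ∑ π : Equiv.Perm (Fin n),
        (∏ j ∈ S, ψ (q.1 (π j)) (q.2 j)) * ψ (q.1 (π i)) z := by
  unfold Lsym UU
  congr 1
  refine Finset.sum_congr rfl fun π _ => ?_
  rw [Finset.prod_insert hi, mul_comm]
  congr 1
  · refine Finset.prod_congr rfl fun j hj => ?_
    have : j ≠ i := fun h => hi (h ▸ hj)
    simp [Function.update_of_ne this]
  · simp

theorem reindex_swap {S : Finset (Fin n)} {i l : Fin n} (hi : i ∉ S) (hl : l ∉ S)
    (q : (Fin n → X) × (Fin n → Y)) (z : Y) :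
    ∑ π : Equiv.Perm (Fin n), (∏ j ∈ S, ψ (q.1 (π j)) (q.2 j)) * ψ (q.1 (π i)) z
    = ∑ π : Equiv.Perm (Fin n), (∏ j ∈ S, ψ (q.1 (π j)) (q.2 j)) * ψ (q.1 (π l)) z := by
  refine Fintype.sum_equiv (Equiv.mulRight (Equiv.swap i l)) _ _ fun π => ?_
  simp only [Equiv.coe_mulRight, Equiv.Perm.mul_apply, Equiv.swap_apply_right]
  congr 1
  refine Finset.prod_congr rfl fun j hj => ?_
  rw [Equiv.swap_apply_of_ne_of_ne]
  · rintro rfl; exact hi hj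
  · rintro rfl; exact hl hj

theorem avg_swap {S : Finset (Fin n)} {i : Fin n} (hi : i ∉ S)
    (q : (Fin n → X) × (Fin n → Y)) (z : Y) :
    ∑ π : Equiv.Perm (Fin n), (∏ j ∈ S, ψ (q.1 (π j)) (q.2 j)) * ψ (q.1 (π i)) z
    = ∑ π : Equiv.Perm (Fin n), (∏ j ∈ S, ψ (q.1 (π j)) (q.2 j)) *
        ((Sᶜ.card : ℝ)⁻¹ * ∑ l ∈ Sᶜ, ψ (q.1 (π l)) z) := by
  have hc : (Sᶜ.card : ℝ) ≠ 0 := by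
    have : 0 < Sᶜ.card := Finset.card_pos.2 ⟨i, by simpa using hi⟩
    positivity
  have h1 : ∑ l ∈ Sᶜ, ∑ π : Equiv.Perm (Fin n),
      (∏ j ∈ S, ψ (q.1 (π j)) (q.2 j)) * ψ (q.1 (π i)) z
      = ∑ l ∈ Sᶜ, ∑ π : Equiv.Perm (Fin n),
      (∏ j ∈ S, ψ (q.1 (π j)) (q.2 j)) * ψ (q.1 (π l)) z :=
    Finset.sum_congr rfl fun l hl => reindex_swap hi (by simpa using hl) q z
  rw [Finset.sum_const, nsmul_eq_mul, Finset.sum_comm] at h1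
  have h2 : ∀ π : Equiv.Perm (Fin n), (∏ j ∈ S, ψ (q.1 (π j)) (q.2 j)) *
        ((Sᶜ.card : ℝ)⁻¹ * ∑ l ∈ Sᶜ, ψ (q.1 (π l)) z) = (Sᶜ.card : ℝ)⁻¹ *
        ∑ l ∈ Sᶜ, (∏ j ∈ S, ψ (q.1 (π j)) (q.2 j)) * ψ (q.1 (π l)) z := by
    intro π; rw [← Finset.mul_sum]; ring
  simp_rw [h2]
  rw [← Finset.mul_sum, ← h1, ← mul_assoc, inv_mul_cancel₀ hc, one_mul]

/-- Cauchy--Schwarz majorant. -/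
def GG (ψ : X → Y → ℝ) (S : Finset (Fin n)) (r : ((Fin n → X) × (Fin n → Y)) × Y) : ℝ :=
  (n.factorial : ℝ)⁻¹ * ∑ π : Equiv.Perm (Fin n), (∏ j ∈ S, ψ (r.1.1 (π j)) (r.1.2 j)) *
        ((Sᶜ.card : ℝ)⁻¹ ^ 2 * ∑ l ∈ Sᶜ, ∑ l' ∈ Sᶜ, ψ (r.1.1 (π l)) r.2 * ψ (r.1.1 (π l')) r.2)

theorem CoreHyp.cs_bound (h : CoreHyp μ ρ₀ ψ b V W) {S : Finset (Fin n)} {i : Fin n} (hi : i ∉ S)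
    (q : (Fin n → X) × (Fin n → Y)) (z : Y) :
    Lsym ψ (insert i S) (UU i (q, z)) ^ 2 / Lsym ψ S q ≤ GG ψ S (q, z) := by
  rw [div_le_iff₀ (h.L_pos S q), Lsym_insert_UU hi, avg_swap hi]
  have hcs := Finset.sum_sq_le_sum_mul_sum_of_sq_le_mul (Finset.univ : Finset (Equiv.Perm (Fin n)))
    (r := fun π => (∏ j ∈ S, ψ (q.1 (π j)) (q.2 j)) *
        ((Sᶜ.card : ℝ)⁻¹ * ∑ l ∈ Sᶜ, ψ (q.1 (π l)) z))
    (f := fun π => (∏ j ∈ S, ψ (q.1 (π j)) (q.2 j)))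
    (g := fun π => (∏ j ∈ S, ψ (q.1 (π j)) (q.2 j)) *
        ((Sᶜ.card : ℝ)⁻¹ * ∑ l ∈ Sᶜ, ψ (q.1 (π l)) z) ^ 2)
    (fun π _ => (h.w_pos S _ _ _).le)
    (fun π _ => mul_nonneg (h.w_pos S _ _ _).le (sq_nonneg _))
    (fun π _ => le_of_eq (by ring))
  have hG : GG ψ S (q, z) = (n.factorial : ℝ)⁻¹ * ∑ π : Equiv.Perm (Fin n),
      (∏ j ∈ S, ψ (q.1 (π j)) (q.2 j)) *
        ((Sᶜ.card : ℝ)⁻¹ * ∑ l ∈ Sᶜ, ψ (q.1 (π l)) z) ^ 2 := by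
    unfold GG
    congr 1
    refine Finset.sum_congr rfl fun π _ => ?_
    rw [mul_pow, pow_two (∑ l ∈ Sᶜ, ψ (q.1 (π l)) z), Finset.sum_mul_sum]
  rw [hG]
  unfold Lsym
  rw [mul_pow]
  have hf : (0 : ℝ) ≤ (n.factorial : ℝ)⁻¹ := by positivity
  nlinarith [mul_le_mul_of_nonneg_left hcs (sq_nonneg (n.factorial : ℝ)⁻¹)]

theorem CoreHyp.GG_term_meas (h : CoreHyp μ ρ₀ ψ b V W) (S : Finset (Fin n))
    (π : Equiv.Perm (Fin n)) (l l' : Fin n) :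
    Measurable (fun r : ((Fin n → X) × (Fin n → Y)) × Y => (∏ j ∈ S, ψ (r.1.1 (π j)) (r.1.2 j)) *
      (ψ (r.1.1 (π l)) r.2 * ψ (r.1.1 (π l')) r.2)) := by
  have h1 : ∀ l, Measurable (fun r : ((Fin n → X) × (Fin n → Y)) × Y => (r.1.1 (π l), r.2)) := by
    intro l; fun_prop
  exact ((h.w_meas S π).comp measurable_fst).mul
    ((h.meas.comp (h1 l)).mul (h.meas.comp (h1 l')))

theorem CoreHyp.GG_term_int (h : CoreHyp μ ρ₀ ψ b V W) (S : Finset (Fin n))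
    (hS : ∀ j ∈ S, ρ j = ρ₀)
    (π : Equiv.Perm (Fin n)) (l l' : Fin n) :
    Integrable (fun r : ((Fin n → X) × (Fin n → Y)) × Y => (∏ j ∈ S, ψ (r.1.1 (π j)) (r.1.2 j)) *
      (ψ (r.1.1 (π l)) r.2 * ψ (r.1.1 (π l')) r.2))
      (((Measure.pi fun _ => μ).prod (Measure.pi ρ)).prod ρ₀) := by
  refine Integrable.mono' ((h.dom (μ := μ) S hS).mul_prod h.int)
    (h.GG_term_meas S π l l').aestronglyMeasurable (Eventually.of_forall fun r => ?_)
  have hp := mul_pos (h.w_pos S r.1.1 r.1.2 π)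
    (mul_pos (h.pos (r.1.1 (π l)) r.2) (h.pos (r.1.1 (π l')) r.2))
  rw [Real.norm_eq_abs, abs_of_pos hp]
  refine mul_le_mul ?_ ?_ (mul_pos (h.pos (r.1.1 (π l)) r.2) (h.pos (r.1.1 (π l')) r.2)).le
    (Real.exp_pos _).le
  · refine (h.w_le S _ _ _).trans (Real.exp_le_exp.2 ?_)
    have := h.sum_b_nonneg S r.1.2
    linarith
  · calc ψ (r.1.1 (π l)) r.2 * ψ (r.1.1 (π l')) r.2 ≤ Real.exp (b r.2) * Real.exp (b r.2) :=
          mul_le_mul (h.hi _ _) (h.hi _ _) (h.pos _ _).le (Real.exp_pos _).le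
      _ = Real.exp (2 * b r.2) := by rw [← Real.exp_add]; ring_nf
      _ ≤ _ := Real.exp_le_exp.2 (by have := h.b0 r.2; linarith)

theorem GG_eq (S : Finset (Fin n)) : GG (n := n) ψ S = fun r => (n.factorial : ℝ)⁻¹ *
    ∑ π : Equiv.Perm (Fin n), (Sᶜ.card : ℝ)⁻¹ ^ 2 * ∑ l ∈ Sᶜ, ∑ l' ∈ Sᶜ,
      (∏ j ∈ S, ψ (r.1.1 (π j)) (r.1.2 j)) * (ψ (r.1.1 (π l)) r.2 * ψ (r.1.1 (π l')) r.2) := by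
  ext r
  unfold GG
  congr 1
  refine Finset.sum_congr rfl fun π _ => ?_
  simp_rw [← Finset.mul_sum]
  ring

theorem CoreHyp.GG_int (h : CoreHyp μ ρ₀ ψ b V W) (S : Finset (Fin n))
    (hS : ∀ j ∈ S, ρ j = ρ₀) :
    Integrable (GG ψ S) (((Measure.pi fun _ => μ).prod (Measure.pi ρ)).prod ρ₀) := by
  rw [GG_eq]
  refine Integrable.const_mul (integrable_finsetSum _ fun π _ => Integrable.const_mul
    (integrable_finsetSum _ fun l _ => integrable_finsetSum _ fun l' _ => ?_) _) _
  exact h.GG_term_int S hS π l l'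

theorem CoreHyp.GG_term_eq (h : CoreHyp μ ρ₀ ψ b V W) (S : Finset (Fin n))
    (hS : ∀ j ∈ S, ρ j = ρ₀)
    (π : Equiv.Perm (Fin n)) (l l' : Fin n) :
    ∫ r : ((Fin n → X) × (Fin n → Y)) × Y, (∏ j ∈ S, ψ (r.1.1 (π j)) (r.1.2 j)) *
      (ψ (r.1.1 (π l)) r.2 * ψ (r.1.1 (π l')) r.2)
      ∂(((Measure.pi fun _ => μ).prod (Measure.pi ρ)).prod ρ₀)
    = ∫ x : Fin n → X, kk ρ₀ ψ (x l) (x l') ∂(Measure.pi fun _ => μ) := by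
  have hi := h.GG_term_int (μ := μ) S hS π l l'
  rw [integral_prod _ hi]
  have hi2 := hi.integral_prod_left
  simp only [integral_const_mul] at hi2 ⊢
  rw [integral_prod _ hi2]
  simp only [integral_mul_const, h.int_w S hS, one_mul]
  exact mp_integral (mp_perm μ π) (g := fun x => kk ρ₀ ψ (x l) (x l'))
    (h.kk_pi_int l l').aestronglyMeasurable

theorem CoreHyp.GG_le (h : CoreHyp μ ρ₀ ψ b V W) (S : Finset (Fin n))
    (hS : ∀ j ∈ S, ρ j = ρ₀) (hc : 0 < Sᶜ.card) :
    ∫ r, GG ψ S r ∂(((Measure.pi fun _ => μ).prod (Measure.pi ρ)).prod ρ₀)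
      ≤ 1 + V / Sᶜ.card + W := by
  refine le_trans (le_of_eq ?_) (h.al_int_le S hc)
  unfold al
  rw [GG_eq, integral_const_mul, integral_finsetSum _ fun π _ => Integrable.const_mul
    (integrable_finsetSum _ fun l _ => integrable_finsetSum _ fun l' _ =>
      h.GG_term_int S hS π l l') _]
  simp_rw [integral_const_mul]
  rw [← fact_avg_const (n := n) ((Sᶜ.card : ℝ)⁻¹ ^ 2 * _)]
  congr 1
  refine Finset.sum_congr rfl fun π _ => ?_
  congr 1
  rw [integral_finsetSum _ fun l _ => integrable_finsetSum _ fun l' _ =>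
      h.GG_term_int S hS π l l', integral_finsetSum _ fun l _ =>
    integrable_finsetSum _ fun l' _ => h.kk_pi_int l l']
  refine Finset.sum_congr rfl fun l _ => ?_
  rw [integral_finsetSum _ fun l' _ =>
      h.GG_term_int S hS π l l', integral_finsetSum _ fun l' _ => h.kk_pi_int l l']
  exact Finset.sum_congr rfl fun l' _ => h.GG_term_eq S hS π l l'

theorem le_exp_self (s : ℝ) : s ≤ Real.exp s := by linarith [Real.add_one_le_exp s]

theorem CoreHyp.LlogL_int (h : CoreHyp μ ρ₀ ψ b V W) (S T : Finset (Fin n)) (hST : S ⊆ T)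
    (hS : ∀ j ∈ T, ρ j = ρ₀) : Integrable (fun p => Lsym ψ T p * Real.log (Lsym ψ S p))
      ((Measure.pi fun _ => μ).prod (Measure.pi ρ)) := by
  refine h.integrable_of_le T hS ((h.L_meas T).mul (Real.measurable_log.comp (h.L_meas S))) 1
    fun p => ?_
  rw [abs_mul, abs_of_pos (h.L_pos T p), one_mul]
  have h1 : ∑ i ∈ S, b (p.2 i) ≤ ∑ i ∈ T, b (p.2 i) :=
    Finset.sum_le_sum_of_subset_of_nonneg hST fun i _ _ => h.b0 _
  calc _ ≤ Real.exp (∑ i ∈ T, b (p.2 i)) * Real.exp (∑ i ∈ T, b (p.2 i)) :=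
        mul_le_mul (h.L_le T p) (((h.abs_log_L S p).trans h1).trans (le_exp_self _))
          (abs_nonneg _) (Real.exp_pos _).le
    _ = Real.exp (2 * ∑ i ∈ T, b (p.2 i)) := by rw [← Real.exp_add]; ring_nf
    _ ≤ _ := Real.exp_le_exp.2 (by have := h.sum_b_nonneg T p.2; linarith)

theorem CoreHyp.LsqL_int (h : CoreHyp μ ρ₀ ψ b V W) (S T : Finset (Fin n)) (hST : S ⊆ T)
    (hS : ∀ j ∈ T, ρ j = ρ₀) : Integrable (fun p => Lsym ψ T p ^ 2 / Lsym ψ S p)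
      ((Measure.pi fun _ => μ).prod (Measure.pi ρ)) := by
  refine h.integrable_of_le T hS (((h.L_meas T).pow_const 2).div (h.L_meas S)) 1
    fun p => ?_
  have hpos : 0 < Lsym ψ T p ^ 2 / Lsym ψ S p := div_pos (pow_pos (h.L_pos T p) 2) (h.L_pos S p)
  rw [abs_of_pos hpos, one_mul, div_le_iff₀ (h.L_pos S p)]
  have h1 : ∑ i ∈ S, b (p.2 i) ≤ ∑ i ∈ T, b (p.2 i) :=
    Finset.sum_le_sum_of_subset_of_nonneg hST fun i _ _ => h.b0 _
  calc Lsym ψ T p ^ 2 ≤ Real.exp (∑ i ∈ T, b (p.2 i)) ^ 2 := by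
        have := h.L_pos T p
        gcongr
        exact h.L_le T p
    _ = Real.exp (3 * ∑ i ∈ T, b (p.2 i)) * Real.exp (-∑ i ∈ T, b (p.2 i)) := by
        rw [← Real.exp_add, ← Real.exp_nat_mul]; congr 1; push_cast; ring
    _ ≤ Real.exp (3 * ∑ i ∈ T, b (p.2 i)) * Real.exp (-∑ i ∈ S, b (p.2 i)) := by
        gcongr
    _ ≤ _ := by gcongr; exact h.le_L S p

theorem log_ineq {u v : ℝ} (hu : 0 < u) (hv : 0 < v) :
    u * Real.log u ≤ u * Real.log v + u ^ 2 / v - u := by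
  have h1 : Real.log (u / v) ≤ u / v - 1 := Real.log_le_sub_one_of_pos (div_pos hu hv)
  rw [Real.log_div hu.ne' hv.ne'] at h1
  have h2 : u ^ 2 / v = u * (u / v) := by ring
  rw [h2]
  nlinarith

theorem CoreHyp.cross (h : CoreHyp μ ρ₀ ψ b V W) (S : Finset (Fin n)) (i : Fin n) (hi : i ∉ S)
    (hS : ∀ j ∈ insert i S, ρ j = ρ₀) :
    ∫ p, Lsym ψ (insert i S) p * Real.log (Lsym ψ S p)
      ∂((Measure.pi fun _ => μ).prod (Measure.pi ρ)) =
    ∫ p, Lsym ψ S p * Real.log (Lsym ψ S p) ∂((Measure.pi fun _ => μ).prod (Measure.pi ρ)) := by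
  have hint := h.LlogL_int (μ := μ) (ρ := ρ) S (insert i S) (Finset.subset_insert _ _) hS
  have hU := mp_UU (μ := μ) (ρ := ρ) (X := X) i
  rw [← mp_integral hU hint.aestronglyMeasurable]
  have hint2 : Integrable (fun a => Lsym ψ (insert i S) (UU i a) * Real.log (Lsym ψ S (UU i a)))
      (((Measure.pi fun _ => μ).prod (Measure.pi ρ)).prod (ρ i)) :=
    hU.integrable_comp_of_integrable hint
  rw [integral_prod _ hint2]
  congr 1
  ext q
  simp only [Lsym_UU hi]
  rw [integral_mul_const]
  congr 1
  simp only [Lsym_insert_UU hi]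
  rw [integral_const_mul, hS i (Finset.mem_insert_self _ _),
    integral_finsetSum _ fun π _ => (h.psi_int _).const_mul _]
  simp only [integral_const_mul, h.mean, mul_one]
  rfl

theorem CoreHyp.step (h : CoreHyp μ ρ₀ ψ b V W) (S : Finset (Fin n)) (i : Fin n) (hi : i ∉ S)
    (hS : ∀ j ∈ insert i S, ρ j = ρ₀) :
    ∫ p, Lsym ψ (insert i S) p * Real.log (Lsym ψ (insert i S) p)
      ∂((Measure.pi fun _ => μ).prod (Measure.pi ρ)) ≤
    ∫ p, Lsym ψ S p * Real.log (Lsym ψ S p) ∂((Measure.pi fun _ => μ).prod (Measure.pi ρ))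
      + V / Sᶜ.card + W := by
  have hS' : ∀ j ∈ S, ρ j = ρ₀ := fun j hj => hS j (Finset.mem_insert_of_mem hj)
  have hsub := Finset.subset_insert i S
  have hi1 := h.LlogL_int (μ := μ) (ρ := ρ) S (insert i S) hsub hS
  have hi2 := h.LsqL_int (μ := μ) (ρ := ρ) S (insert i S) hsub hS
  have hi3 := h.L_int (μ := μ) (ρ := ρ) (insert i S) hS
  have h1 : ∫ p, Lsym ψ (insert i S) p * Real.log (Lsym ψ (insert i S) p)
      ∂((Measure.pi fun _ => μ).prod (Measure.pi ρ)) ≤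
      ∫ p, (Lsym ψ (insert i S) p * Real.log (Lsym ψ S p)
        + Lsym ψ (insert i S) p ^ 2 / Lsym ψ S p - Lsym ψ (insert i S) p)
      ∂((Measure.pi fun _ => μ).prod (Measure.pi ρ)) := by
    refine integral_mono (h.LlogL_int (insert i S) (insert i S) le_rfl hS)
      ((hi1.add hi2).sub hi3) fun p => ?_
    exact log_ineq (h.L_pos _ p) (h.L_pos _ p)
  have hi12 : Integrable (fun p => Lsym ψ (insert i S) p * Real.log (Lsym ψ S p)
        + Lsym ψ (insert i S) p ^ 2 / Lsym ψ S p)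
      ((Measure.pi fun _ => μ).prod (Measure.pi ρ)) := hi1.add hi2
  rw [integral_sub hi12 hi3, integral_add hi1 hi2, h.cross S i hi hS,
    h.integral_L _ hS] at h1
  have hU := mp_UU (μ := μ) (ρ := ρ) (X := X) i
  have h2 : ∫ p, Lsym ψ (insert i S) p ^ 2 / Lsym ψ S p
      ∂((Measure.pi fun _ => μ).prod (Measure.pi ρ)) ≤ 1 + V / Sᶜ.card + W := by
    rw [← mp_integral hU hi2.aestronglyMeasurable]
    have hint2 := hU.integrable_comp_of_integrable hi2
    rw [hS i (Finset.mem_insert_self _ _)] at hint2 ⊢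
    refine le_trans (integral_mono hint2 (h.GG_int S hS') fun r => ?_)
      (h.GG_le S hS' (Finset.card_pos.2 ⟨i, by simpa using hi⟩))
    have := h.cs_bound hi r.1 r.2
    simpa [Lsym_UU hi] using this
  linarith

theorem CoreHyp.kl_bound (h : CoreHyp μ ρ₀ ψ b V W) (S : Finset (Fin n))
    (hS : ∀ j ∈ S, ρ j = ρ₀) (hc : 2 * S.card ≤ n) :
    ∫ p, Lsym ψ S p * Real.log (Lsym ψ S p) ∂((Measure.pi fun _ => μ).prod (Measure.pi ρ))
      ≤ S.card * (2 * V / n + W) := by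
  induction S using Finset.induction_on with
  | empty =>
    have : ∀ p : (Fin n → X) × (Fin n → Y), Lsym ψ ∅ p = 1 := by
      intro p
      unfold Lsym
      simp only [Finset.prod_empty]
      exact fact_avg_const 1
    simp [this]
  | insert i S hi ih =>
    rw [Finset.card_insert_of_notMem hi] at hc ⊢
    have h1 := h.step S i hi hS
    have h2 := ih (fun j hj => hS j (Finset.mem_insert_of_mem hj)) (by omega)
    have h3 : V / Sᶜ.card ≤ 2 * V / n := by
      rw [Finset.card_compl, Fintype.card_fin]
      have hn : (0 : ℝ) < n := by exact_mod_cast (show 0 < n by omega)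
      have h5 : (n : ℝ) / 2 ≤ ((n - S.card : ℕ) : ℝ) := by
        rw [div_le_iff₀ (by norm_num)]
        exact_mod_cast (show n ≤ (n - S.card) * 2 by omega)
      have h6 := h.V0
      calc V / ((n - S.card : ℕ) : ℝ) ≤ V / ((n : ℝ) / 2) := by gcongr
        _ = 2 * V / n := by field_simp
    push_cast
    linarith

theorem CoreHyp.kl_bound' (h : CoreHyp μ ρ₀ ψ b V W) (S : Finset (Fin n))
    (hS : ∀ j ∈ S, ρ j = ρ₀) (hc : 2 * S.card ≤ n) (hn : 0 < n) :
    ∫ p, Lsym ψ S p * Real.log (Lsym ψ S p) ∂((Measure.pi fun _ => μ).prod (Measure.pi ρ))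
      ≤ V + n * W / 2 := by
  refine (h.kl_bound S hS hc).trans ?_
  have hn' : (0 : ℝ) < n := by exact_mod_cast hn
  have h5 : (S.card : ℝ) ≤ n / 2 := by
    rw [le_div_iff₀ (by norm_num)]
    exact_mod_cast (show S.card * 2 ≤ n by omega)
  have := h.V0
  have := h.W0
  calc (S.card : ℝ) * (2 * V / n + W) ≤ n / 2 * (2 * V / n + W) := by gcongr
    _ = _ := by field_simp

theorem kl_point {L : ℝ} (hL : 0 < L) : 1 - 1/4 - 4 * (L * Real.log L + 1 - L) ≤ L := by
  -- `log u ≥ 1 - 1/u` at `u = sqrt L`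
  set s := Real.sqrt L with hs
  have hsp : 0 < s := Real.sqrt_pos.2 hL
  have hsq : L = s ^ 2 := (Real.sq_sqrt hL.le).symm
  have h1 : 1 - s⁻¹ ≤ Real.log s := Real.one_sub_inv_le_log_of_pos hsp
  rw [hsq, Real.log_pow]
  push_cast
  have h2 : s ^ 2 * (1 - s⁻¹) ≤ s ^ 2 * Real.log s := by gcongr
  have h3 : s ^ 2 * (1 - s⁻¹) = s ^ 2 - s := by field_simp
  nlinarith [sq_nonneg (s - 1), sq_nonneg (5 * s - 4)]

theorem min_bound {Ω : Type*} [MeasurableSpace Ω] {Q : Measure Ω} [IsProbabilityMeasure Q]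
    {L0 L1 : Ω → ℝ} (p0 : ∀ p, 0 < L0 p) (p1 : ∀ p, 0 < L1 p) (i0 : Integrable L0 Q)
    (i1 : Integrable L1 Q) (l0 : Integrable (fun p => L0 p * Real.log (L0 p)) Q)
    (l1 : Integrable (fun p => L1 p * Real.log (L1 p)) Q)
    (e0 : ∫ p, L0 p ∂Q = 1) (e1 : ∫ p, L1 p ∂Q = 1)
    (k0 : ∫ p, L0 p * Real.log (L0 p) ∂Q ≤ 1/32) (k1 : ∫ p, L1 p * Real.log (L1 p) ∂Q ≤ 1/32) :
    1/2 ≤ ∫ p, min (L0 p) (L1 p) ∂Q := by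
  have hk : ∀ {L : ℝ}, 0 < L → 0 ≤ L * Real.log L + 1 - L := by
    intro L hL
    have := Real.one_sub_inv_le_log_of_pos hL
    have h2 : L * (1 - L⁻¹) ≤ L * Real.log L := by gcongr
    have h3 : L * (1 - L⁻¹) = L - 1 := by field_simp
    linarith
  have hc : Integrable (fun _ : Ω => (1 : ℝ)) Q := integrable_const _
  have h1 : ∫ p, ((1 - 1/4) - 4 * (L0 p * Real.log (L0 p) + 1 - L0 p)
      - 4 * (L1 p * Real.log (L1 p) + 1 - L1 p)) ∂Q ≤ ∫ p, min (L0 p) (L1 p) ∂Q := by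
    refine integral_mono (((integrable_const _).sub (((l0.add hc).sub i0).const_mul 4)).sub
      (((l1.add hc).sub i1).const_mul 4)) (i0.inf i1) fun p => ?_
    refine le_min ?_ ?_
    · have := kl_point (p0 p); have := hk (p1 p); simp only; linarith
    · have := kl_point (p1 p); have := hk (p0 p); simp only; linarith
  have key : ∀ p, ((1 - 1/4) - 4 * (L0 p * Real.log (L0 p) + 1 - L0 p)
      - 4 * (L1 p * Real.log (L1 p) + 1 - L1 p)) =
      (1 - 1/4 - 8) + (4 * L0 p + (4 * L1 p + ((-4) * (L0 p * Real.log (L0 p)) +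
        (-4) * (L1 p * Real.log (L1 p))))) := fun p => by ring
  simp_rw [key] at h1
  have j1 : Integrable (fun p => (-4) * (L0 p * Real.log (L0 p)) +
        (-4) * (L1 p * Real.log (L1 p))) Q := (l0.const_mul _).add (l1.const_mul _)
  have j2 : Integrable (fun p => 4 * L1 p + ((-4) * (L0 p * Real.log (L0 p)) +
        (-4) * (L1 p * Real.log (L1 p)))) Q := (i1.const_mul _).add j1
  have j3 : Integrable (fun p => 4 * L0 p + (4 * L1 p + ((-4) * (L0 p * Real.log (L0 p)) +
        (-4) * (L1 p * Real.log (L1 p))))) Q := (i0.const_mul _).add j2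
  rw [integral_add (integrable_const _) j3, integral_add (i0.const_mul _) j2,
    integral_add (i1.const_mul _) j1, integral_add (l0.const_mul _) (l1.const_mul _),
    integral_const_mul, integral_const_mul, integral_const_mul, integral_const_mul, e0, e1] at h1
  simp only [integral_const, probReal_univ, smul_eq_mul, mul_one] at h1
  linarith

end core2

/-- density of `N(a,1)` with respect to `N(0,1)` -/
def fg (a y : ℝ) : ℝ := Real.exp (a * y - a ^ 2 / 2)

/-- common component -/
def gg (y : ℝ) : ℝ := Real.sqrt 2 / 2 * Real.exp (-y ^ 2 / 2)

theorem fg_pos (a y : ℝ) : 0 < fg a y := Real.exp_pos _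

theorem gg_pos (y : ℝ) : 0 < gg y := by unfold gg; positivity

theorem fg_meas : Measurable (fun p : ℝ × ℝ => fg p.1 p.2) := by unfold fg; fun_prop

theorem gg_meas : Measurable gg := by unfold gg; fun_prop

theorem int_exp_lin (c : ℝ) : Integrable (fun y => Real.exp (c * y)) (gaussianReal 0 1) :=
  integrable_exp_mul_gaussianReal c

theorem integral_exp_lin (c : ℝ) : ∫ y, Real.exp (c * y) ∂(gaussianReal 0 1)
    = Real.exp (c ^ 2 / 2) := by
  have h := congrFun (mgf_fun_id_gaussianReal (μ := 0) (v := 1)) c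
  simp only [mgf] at h
  rw [h]; simp

theorem int_exp_abs (c : ℝ) : Integrable (fun y => Real.exp (c * |y|)) (gaussianReal 0 1) := by
  refine Integrable.mono' ((int_exp_lin c).add (int_exp_lin (-c))) (by fun_prop)
    (Eventually.of_forall fun y => ?_)
  rw [Real.norm_eq_abs, abs_of_pos (Real.exp_pos _)]
  simp only [Pi.add_apply]
  rcases abs_cases y with ⟨h, _⟩ | ⟨h, _⟩ <;> rw [h]
  · linarith [Real.exp_pos (-c * y)]
  · have : c * -y = -c * y := by ring
    rw [this]
    linarith [Real.exp_pos (c * y)]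

theorem fg_mul_eq (a b y : ℝ) : fg a y * fg b y
    = Real.exp (-(a ^ 2 + b ^ 2) / 2) * Real.exp ((a + b) * y) := by
  unfold fg; rw [← Real.exp_add, ← Real.exp_add]; ring_nf

theorem fg_mul_int (a b : ℝ) : Integrable (fun y => fg a y * fg b y) (gaussianReal 0 1) := by
  simp_rw [fg_mul_eq]
  exact (int_exp_lin _).const_mul _

theorem fg_mul_integral (a b : ℝ) : ∫ y, fg a y * fg b y ∂(gaussianReal 0 1)
    = Real.exp (a * b) := by
  simp_rw [fg_mul_eq]
  rw [integral_const_mul, integral_exp_lin, ← Real.exp_add]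
  ring_nf

theorem fg_zero (y : ℝ) : fg 0 y = 1 := by simp [fg]

theorem fg_int (a : ℝ) : Integrable (fun y => fg a y) (gaussianReal 0 1) := by
  simpa [fg_zero] using fg_mul_int a 0

theorem fg_integral (a : ℝ) : ∫ y, fg a y ∂(gaussianReal 0 1) = 1 := by
  simpa [fg_zero] using fg_mul_integral a 0

theorem gg_integral : ∫ y, gg y ∂(gaussianReal 0 1) = 1 / 2 := by
  rw [integral_gaussianReal_eq_integral_smul one_ne_zero]
  have h1 : ∀ x, gaussianPDFReal 0 1 x • gg x
      = (Real.sqrt (2 * Real.pi))⁻¹ * (Real.sqrt 2 / 2) * Real.exp (-1 * x ^ 2) := by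
    intro x
    simp only [gaussianPDFReal, gg, smul_eq_mul, NNReal.coe_one, mul_one, sub_zero]
    rw [show -1 * x ^ 2 = -x ^ 2 / 2 + -x ^ 2 / 2 by ring, Real.exp_add]
    ring
  simp_rw [h1]
  rw [integral_const_mul, integral_gaussian, Real.sqrt_mul (by norm_num), div_one]
  have h2 : Real.sqrt 2 ≠ 0 := by positivity
  have h3 : Real.sqrt Real.pi ≠ 0 := by positivity
  field_simp

theorem gg_le_one (y : ℝ) : gg y ≤ 1 := by
  unfold gg
  have h1 : Real.exp (-y ^ 2 / 2) ≤ 1 := Real.exp_le_one_iff.2 (by nlinarith [sq_nonneg y])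
  have h2 : Real.sqrt 2 ≤ 2 := by
    rw [Real.sqrt_le_left (by norm_num)]; norm_num
  have h3 := Real.exp_pos (-y ^ 2 / 2)
  have h4 := Real.sqrt_nonneg 2
  nlinarith

theorem gg_int : Integrable gg (gaussianReal 0 1) := by
  refine Integrable.mono' (integrable_const 1) gg_meas.aestronglyMeasurable
    (Eventually.of_forall fun y => ?_)
  rw [Real.norm_eq_abs, abs_of_pos (gg_pos y)]
  exact gg_le_one y

theorem gg_le {a : ℝ} (ha : |a| ≤ 1 / 100) (y : ℝ) : gg y ≤ 3 / 4 * fg a y := by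
  have h1 : gg y = Real.sqrt 2 / 2 * Real.exp (a ^ 2 - (y + a) ^ 2 / 2) * fg a y := by
    unfold gg fg
    rw [mul_assoc, ← Real.exp_add]; ring_nf
  rw [h1]
  have ha2 : a ^ 2 ≤ 1 / 10000 := by
    rw [← sq_abs]; nlinarith [abs_nonneg a]
  have h2 : Real.exp (a ^ 2 - (y + a) ^ 2 / 2) ≤ Real.exp (1/100) :=
    Real.exp_le_exp.2 (by nlinarith [sq_nonneg (y + a)])
  have h3 : Real.exp (1/100) ≤ 1.03 := by
    have := Real.exp_bound_div_one_sub_of_interval (x := 1/100) (by norm_num) (by norm_num)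
    refine this.trans (by norm_num)
  have h4 : Real.sqrt 2 ≤ 1.4143 := by
    rw [Real.sqrt_le_left (by norm_num)]; norm_num
  have h5 := Real.sqrt_nonneg 2
  have h6 := fg_pos a y
  have h7 := Real.exp_pos (a ^ 2 - (y + a) ^ 2 / 2)
  gcongr
  nlinarith

theorem fg_le {a : ℝ} (ha : |a| ≤ 1 / 100) (y : ℝ) : fg a y ≤ Real.exp (|y| / 100) := by
  unfold fg
  refine Real.exp_le_exp.2 ?_
  have h1 : a * y ≤ |a| * |y| := by rw [← abs_mul]; exact le_abs_self _
  have h2 : |a| * |y| ≤ 1 / 100 * |y| := by gcongr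
  nlinarith [sq_nonneg a]

theorem le_fg {a : ℝ} (ha : |a| ≤ 1 / 100) (y : ℝ) :
    Real.exp (-|y| / 100 - 1 / 2) ≤ fg a y := by
  unfold fg
  refine Real.exp_le_exp.2 ?_
  have h1 : -(a * y) ≤ |a| * |y| := by rw [← abs_mul]; exact neg_le_abs _
  have h2 : |a| * |y| ≤ 1 / 100 * |y| := by gcongr
  have ha2 : a ^ 2 ≤ 1 / 10000 := by
    rw [← sq_abs]; nlinarith [abs_nonneg a]
  linarith

section model
variable {X : Type*} [MeasurableSpace X] {μ : Measure X} [IsProbabilityMeasure μ]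

/-- mixture density -/
def FF (μ : Measure X) (m : X → ℝ) (y : ℝ) : ℝ := ∫ x, fg (m x) y ∂μ

/-- residual mixture -/
def RR (μ : Measure X) (m : X → ℝ) (y : ℝ) : ℝ := FF μ m y - gg y

/-- residual law -/
def rho0 (μ : Measure X) (m : X → ℝ) : Measure ℝ :=
  (gaussianReal 0 1).withDensity fun y => ENNReal.ofReal (2 * RR μ m y)

/-- conditional residual density -/
def psi (μ : Measure X) (m0 m : X → ℝ) (x : X) (y : ℝ) : ℝ := (fg (m x) y - gg y) / RR μ m0 y

/-- admissible links -/
structure Adm (m : X → ℝ) : Prop where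
  meas : Measurable m
  bd : ∀ x, |m x| ≤ 1 / 100

theorem Adm.fg_meas2 {m : X → ℝ} (h : Adm m) : Measurable (fun p : X × ℝ => fg (m p.1) p.2) := by
  have h1 : Measurable (fun p : X × ℝ => (m p.1, p.2)) :=
    (h.meas.comp measurable_fst).prodMk measurable_snd
  exact fg_meas.comp h1

theorem Adm.fg_intX {m : X → ℝ} (h : Adm m) (y : ℝ) : Integrable (fun x => fg (m x) y) μ := by
  refine Integrable.mono' (integrable_const (Real.exp (|y| / 100)))
    (h.fg_meas2.comp measurable_prodMk_right).aestronglyMeasurable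
    (Eventually.of_forall fun x => ?_)
  rw [Real.norm_eq_abs, abs_of_pos (fg_pos _ _)]
  exact fg_le (h.bd x) y

theorem Adm.FF_meas {m : X → ℝ} (h : Adm m) : Measurable (FF μ m) :=
  (h.fg_meas2.stronglyMeasurable.integral_prod_left (μ := μ)).measurable

theorem Adm.FF_le {m : X → ℝ} (h : Adm m) (y : ℝ) : FF μ m y ≤ Real.exp (|y| / 100) := by
  have := integral_mono (h.fg_intX (μ := μ) y) (integrable_const (Real.exp (|y| / 100)))
    fun x => fg_le (h.bd x) y
  simpa [FF] using this

theorem Adm.FF_nonneg {m : X → ℝ} (y : ℝ) : 0 ≤ FF μ m y :=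
  integral_nonneg fun x => (fg_pos _ _).le

theorem Adm.gg_le_FF {m : X → ℝ} (h : Adm m) (y : ℝ) : gg y ≤ 3 / 4 * FF μ m y := by
  have := integral_mono (integrable_const (gg y)) ((h.fg_intX (μ := μ) y).const_mul (3/4))
    fun x => gg_le (h.bd x) y
  rw [integral_const_mul] at this
  simpa [FF] using this

theorem Adm.le_FF {m : X → ℝ} (h : Adm m) (h0 : ∫ x, m x ∂μ = 0) (y : ℝ) :
    9 / 10 ≤ FF μ m y := by
  have hi : Integrable m μ := Integrable.mono' (integrable_const (1/100))
    h.meas.aestronglyMeasurable (Eventually.of_forall fun x => h.bd x)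
  have h1 := integral_mono ((hi.mul_const y).add (integrable_const (9/10))) (h.fg_intX (μ := μ) y)
    fun x => by
      have h2 := Real.add_one_le_exp (m x * y - m x ^ 2 / 2)
      have h3 : m x ^ 2 ≤ 1 / 10000 := by
        rw [← sq_abs]; nlinarith [abs_nonneg (m x), h.bd x]
      show m x * y + 9 / 10 ≤ Real.exp (m x * y - m x ^ 2 / 2)
      linarith
  have h2 : ∫ x, (m x * y + 9 / 10) ∂μ = 9 / 10 := by
    rw [integral_add (hi.mul_const y) (integrable_const _), integral_mul_const, h0]
    simp
  exact h2 ▸ h1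

theorem Adm.RR_meas {m : X → ℝ} (h : Adm m) : Measurable (RR μ m) := h.FF_meas.sub gg_meas

theorem Adm.dens_meas {m : X → ℝ} (h : Adm m) :
    Measurable (fun y => ENNReal.ofReal (2 * RR μ m y)) :=
  ENNReal.measurable_ofReal.comp (h.RR_meas.const_mul 2)

theorem Adm.le_RR {m : X → ℝ} (h : Adm m) (h0 : ∫ x, m x ∂μ = 0) (y : ℝ) :
    1 / 5 ≤ RR μ m y := by
  unfold RR
  linarith [h.le_FF h0 y, h.gg_le_FF (μ := μ) y]

theorem Adm.RR_le {m : X → ℝ} (h : Adm m) (y : ℝ) : RR μ m y ≤ Real.exp (|y| / 100) := by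
  unfold RR
  linarith [h.FF_le (μ := μ) y, gg_pos y]

theorem Adm.prod_int {m : X → ℝ} (h : Adm m) :
    Integrable (fun p : X × ℝ => fg (m p.1) p.2) (μ.prod (gaussianReal 0 1)) := by
  refine Integrable.mono' ((int_exp_abs (1/100)).comp_snd μ) h.fg_meas2.aestronglyMeasurable
    (Eventually.of_forall fun p => ?_)
  rw [Real.norm_eq_abs, abs_of_pos (fg_pos _ _)]
  have := fg_le (h.bd p.1) p.2
  rwa [show 1 / 100 * |p.2| = |p.2| / 100 by ring]

theorem Adm.FF_int {m : X → ℝ} (h : Adm m) : Integrable (FF μ m) (gaussianReal 0 1) :=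
  h.prod_int.integral_prod_right

theorem Adm.FF_integral {m : X → ℝ} (h : Adm m) : ∫ y, FF μ m y ∂(gaussianReal 0 1) = 1 := by
  unfold FF
  rw [← integral_integral_swap h.prod_int]
  simp [fg_integral]

theorem Adm.RR_integral {m : X → ℝ} (h : Adm m) : ∫ y, RR μ m y ∂(gaussianReal 0 1) = 1 / 2 := by
  unfold RR
  rw [integral_sub h.FF_int gg_int, h.FF_integral, gg_integral]; norm_num

theorem Adm.integral_rho0 {m : X → ℝ} (h : Adm m) (h0 : ∫ x, m x ∂μ = 0) (k : ℝ → ℝ) :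
    ∫ y, k y ∂(rho0 μ m) = ∫ y, 2 * RR μ m y * k y ∂(gaussianReal 0 1) := by
  unfold rho0
  rw [integral_withDensity_eq_integral_toReal_smul h.dens_meas
    (Eventually.of_forall fun y => ENNReal.ofReal_lt_top)]
  congr 1
  ext y
  rw [ENNReal.toReal_ofReal (by linarith [h.le_RR h0 y]), smul_eq_mul]

theorem Adm.rho0_prob {m : X → ℝ} (h : Adm m) (h0 : ∫ x, m x ∂μ = 0) :
    IsProbabilityMeasure (rho0 μ m) := by
  constructor
  unfold rho0
  have hi : Integrable (fun y => 2 * RR μ m y) (gaussianReal 0 1) :=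
    (h.FF_int.sub gg_int).const_mul 2
  rw [withDensity_apply _ MeasurableSet.univ, Measure.restrict_univ,
    ← ofReal_integral_eq_lintegral_ofReal hi
      (Eventually.of_forall fun y => by
        show 0 ≤ 2 * RR μ m y
        linarith [h.le_RR h0 y])]
  rw [integral_const_mul, h.RR_integral]; simp

/-- chi-square type bound -/
theorem Adm.chi {m : X → ℝ} (h : Adm m) (h0 : ∫ x, m x ∂μ = 0) (r : ℝ → ℝ)
    (hr : Integrable r (gaussianReal 0 1)) (hr1 : ∫ y, r y ∂(gaussianReal 0 1) = 1 / 2)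
    (hd : Integrable (fun y => (r y - RR μ m y) ^ 2) (gaussianReal 0 1)) :
    ∫ y, (r y / RR μ m y) * (r y / RR μ m y) ∂(rho0 μ m)
      ≤ 1 + 10 * ∫ y, (r y - RR μ m y) ^ 2 ∂(gaussianReal 0 1) := by
  rw [h.integral_rho0 h0]
  have hR : Integrable (RR μ m) (gaussianReal 0 1) := h.FF_int.sub gg_int
  have hi1 : Integrable (fun y => 4 * r y + (-2) * RR μ m y) (gaussianReal 0 1) :=
    (hr.const_mul 4).add (hR.const_mul (-2))
  have hi : Integrable (fun y => 10 * (r y - RR μ m y) ^ 2 + (4 * r y + (-2) * RR μ m y))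
      (gaussianReal 0 1) := (hd.const_mul 10).add hi1
  have h1 : ∫ y, 2 * RR μ m y * ((r y / RR μ m y) * (r y / RR μ m y)) ∂(gaussianReal 0 1) ≤
      ∫ y, (10 * (r y - RR μ m y) ^ 2 + (4 * r y + (-2) * RR μ m y)) ∂(gaussianReal 0 1) := by
    refine integral_mono_of_nonneg (Eventually.of_forall fun y => ?_) hi
      (Eventually.of_forall fun y => ?_)
    · have := h.le_RR h0 y
      exact mul_nonneg (by linarith) (mul_self_nonneg _)
    · have h5 := h.le_RR h0 y
      have hp : 0 < RR μ m y := by linarith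
      have e : 2 * RR μ m y * ((r y / RR μ m y) * (r y / RR μ m y))
          = 2 * ((r y - RR μ m y) ^ 2 / RR μ m y) + (4 * r y + (-2) * RR μ m y) := by
        field_simp; ring
      have h6 : (r y - RR μ m y) ^ 2 / RR μ m y ≤ 5 * (r y - RR μ m y) ^ 2 := by
        rw [div_le_iff₀ hp]
        nlinarith [sq_nonneg (r y - RR μ m y)]
      simp only [e]
      linarith
  rw [integral_add (hd.const_mul 10) hi1, integral_add (hr.const_mul 4) (hR.const_mul (-2)),
    integral_const_mul, integral_const_mul, integral_const_mul, hr1, h.RR_integral] at h1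
  linarith

theorem sq_integral_le {h : X → ℝ} (h1 : Integrable h μ) (h2 : Integrable (fun x => h x ^ 2) μ) :
    (∫ x, h x ∂μ) ^ 2 ≤ ∫ x, h x ^ 2 ∂μ := by
  set c := ∫ x, h x ∂μ with hc
  have h3 : 0 ≤ ∫ x, (h x - c) ^ 2 ∂μ := integral_nonneg fun x => sq_nonneg _
  have h4 : ∀ x, (h x - c) ^ 2 = h x ^ 2 + ((-(2 * c)) * h x + c ^ 2) := fun x => by ring
  have h5 : Integrable (fun x => (-(2 * c)) * h x + c ^ 2) μ :=
    (h1.const_mul _).add (integrable_const _)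
  simp_rw [h4] at h3
  rw [integral_add h2 h5, integral_add (h1.const_mul _) (integrable_const _),
    integral_const_mul, ← hc] at h3
  simp at h3
  nlinarith

theorem exp_small {u : ℝ} (hu : |u| ≤ 1 / 10000) : |Real.exp u - 1| ≤ 2 / 10000 := by
  have := Real.abs_exp_sub_one_le (x := u) (by linarith)
  linarith

theorem fg_sub_sq (a c : ℝ) (ha : |a| ≤ 1 / 100) (hc : |c| ≤ 1 / 100) :
    Integrable (fun y => (fg a y - fg c y) ^ 2) (gaussianReal 0 1) ∧
    ∫ y, (fg a y - fg c y) ^ 2 ∂(gaussianReal 0 1) ≤ 8 / 10000 := by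
  have e : ∀ y, (fg a y - fg c y) ^ 2 = fg a y * fg a y + ((-2) * (fg a y * fg c y) +
      fg c y * fg c y) := fun y => by ring
  simp_rw [e]
  have i1 : Integrable (fun y => (-2) * (fg a y * fg c y) + fg c y * fg c y)
      (gaussianReal 0 1) := ((fg_mul_int a c).const_mul _).add (fg_mul_int c c)
  refine ⟨(fg_mul_int a a).add i1, ?_⟩
  rw [integral_add (fg_mul_int a a) i1, integral_add ((fg_mul_int a c).const_mul _)
    (fg_mul_int c c), integral_const_mul, fg_mul_integral, fg_mul_integral, fg_mul_integral]
  have hb : ∀ a c : ℝ, |a| ≤ 1 / 100 → |c| ≤ 1 / 100 → |a * c| ≤ 1 / 10000 := by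
    intro a c ha hc
    rw [abs_mul]
    nlinarith [abs_nonneg a, abs_nonneg c]
  have h1 := abs_le.1 (exp_small (hb a a ha ha))
  have h2 := abs_le.1 (exp_small (hb a c ha hc))
  have h3 := abs_le.1 (exp_small (hb c c hc hc))
  linarith [h1.2, h2.1, h3.2]

theorem Adm.fg_FF {m : X → ℝ} (h : Adm m) (a : ℝ) (ha : |a| ≤ 1 / 100) :
    Integrable (fun y => (fg a y - FF μ m y) ^ 2) (gaussianReal 0 1) ∧
    ∫ y, (fg a y - FF μ m y) ^ 2 ∂(gaussianReal 0 1) ≤ 8 / 10000 := by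
  have hpm : Measurable (fun p : X × ℝ => (fg a p.2 - fg (m p.1) p.2) ^ 2) := by
    have h1 : Measurable (fun p : X × ℝ => (a, p.2)) := by fun_prop
    exact ((fg_meas.comp h1).sub h.fg_meas2).pow_const 2
  have hdom : ∀ x y, (fg a y - fg (m x) y) ^ 2 ≤ Real.exp (1 * |y|) := by
    intro x y
    have h1 := fg_le ha y
    have h2 := fg_le (h.bd x) y
    have h3 := fg_pos a y
    have h4 := fg_pos (m x) y
    have h5 : (fg a y - fg (m x) y) ^ 2 ≤ Real.exp (|y| / 100) ^ 2 := by
      apply sq_le_sq' <;> linarith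
    refine h5.trans ?_
    rw [← Real.exp_nat_mul]
    refine Real.exp_le_exp.2 ?_
    push_cast
    have := abs_nonneg y
    linarith
  have hp : Integrable (fun p : X × ℝ => (fg a p.2 - fg (m p.1) p.2) ^ 2)
      (μ.prod (gaussianReal 0 1)) := by
    refine Integrable.mono' ((int_exp_abs 1).comp_snd μ) hpm.aestronglyMeasurable
      (Eventually.of_forall fun p => ?_)
    rw [Real.norm_eq_abs, abs_of_nonneg (sq_nonneg _)]
    exact hdom p.1 p.2
  have hx : ∀ y, Integrable (fun x => (fg a y - fg (m x) y) ^ 2) μ := by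
    intro y
    refine Integrable.mono' (integrable_const (Real.exp (1 * |y|)))
      (hpm.comp measurable_prodMk_right).aestronglyMeasurable (Eventually.of_forall fun x => ?_)
    rw [Real.norm_eq_abs, abs_of_nonneg (sq_nonneg _)]
    exact hdom x y
  have hJ : ∀ y, (fg a y - FF μ m y) ^ 2 ≤ ∫ x, (fg a y - fg (m x) y) ^ 2 ∂μ := by
    intro y
    have hd : Integrable (fun x => fg a y - fg (m x) y) μ :=
      (integrable_const _).sub (h.fg_intX y)
    have := sq_integral_le hd (hx y)
    rw [integral_sub (integrable_const _) (h.fg_intX y)] at this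
    simpa [FF] using this
  have hI : Integrable (fun y => (fg a y - FF μ m y) ^ 2) (gaussianReal 0 1) := by
    refine Integrable.mono' hp.integral_prod_right ?_ (Eventually.of_forall fun y => ?_)
    · have h1 : Measurable (fun y : ℝ => (a, y)) := by fun_prop
      exact (((fg_meas.comp h1).sub h.FF_meas).pow_const 2).aestronglyMeasurable
    · rw [Real.norm_eq_abs, abs_of_nonneg (sq_nonneg _)]
      exact hJ y
  refine ⟨hI, (integral_mono hI hp.integral_prod_right hJ).trans ?_⟩
  simp only
  rw [← integral_integral_swap hp]
  have := integral_mono (hp.integral_prod_left) (integrable_const (8/10000))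
    (fun x => (fg_sub_sq a (m x) ha (h.bd x)).2)
  simpa using this

theorem Adm.FF_FF {m0 m : X → ℝ} (h0 : Adm m0) (h : Adm m) :
    Integrable (fun y => (FF μ m y - FF μ m0 y) ^ 2) (gaussianReal 0 1) := by
  refine Integrable.mono' (int_exp_abs 1)
    ((h.FF_meas.sub h0.FF_meas).pow_const 2).aestronglyMeasurable
    (Eventually.of_forall fun y => ?_)
  rw [Real.norm_eq_abs, abs_of_nonneg (sq_nonneg _)]
  have h1 := h.FF_le (μ := μ) y
  have h2 := h0.FF_le (μ := μ) y
  have h3 := Adm.FF_nonneg (μ := μ) (m := m) y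
  have h4 := Adm.FF_nonneg (μ := μ) (m := m0) y
  have h5 : (FF μ m y - FF μ m0 y) ^ 2 ≤ Real.exp (|y| / 100) ^ 2 := by
    apply sq_le_sq' <;> linarith
  refine h5.trans ?_
  rw [← Real.exp_nat_mul]
  refine Real.exp_le_exp.2 ?_
  push_cast
  have := abs_nonneg y
  linarith

theorem exp_two_ge : (5 : ℝ) ≤ Real.exp 2 := by
  have h1 := Real.exp_one_gt_d9
  have : Real.exp 2 = Real.exp 1 * Real.exp 1 := by rw [← Real.exp_add]; norm_num
  rw [this]; nlinarith

theorem core_of_model {m0 m : X → ℝ} (h0 : Adm m0) (h : Adm m) (hm : ∫ x, m0 x ∂μ = 0) {ε : ℝ}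
    (hε0 : 0 ≤ ε)
    (hε : ∫ y, (FF μ m y - FF μ m0 y) ^ 2 ∂(gaussianReal 0 1) ≤ ε) :
    CoreHyp μ (rho0 μ m0) (psi μ m0 m) (fun y => 2 + |y|) (80 / 10000) (10 * ε) := by
  have := h0.rho0_prob hm
  have hmeas : Measurable (fun p : X × ℝ => psi μ m0 m p.1 p.2) :=
    (h.fg_meas2.sub (gg_meas.comp measurable_snd)).div (h0.RR_meas.comp measurable_snd)
  have hR : ∀ y, 0 < RR μ m0 y := fun y => by linarith [h0.le_RR hm y]
  have hlo : ∀ x y, Real.exp (-(2 + |y|)) ≤ psi μ m0 m x y := by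
    intro x y
    unfold psi
    rw [le_div_iff₀ (hR y)]
    have h1 := h0.RR_le (μ := μ) y
    have h2 := gg_le (h.bd x) y
    have h3 := le_fg (h.bd x) y
    have h4 : Real.exp (-(2 + |y|)) * RR μ m0 y ≤ Real.exp (-(2 + |y|)) * Real.exp (|y| / 100) := by
      gcongr
    have h5 : Real.exp (-(2 + |y|)) * Real.exp (|y| / 100) ≤
        Real.exp (-|y| / 100 - 1 / 2) * Real.exp (-(3/2)) := by
      rw [← Real.exp_add, ← Real.exp_add]
      refine Real.exp_le_exp.2 ?_
      have := abs_nonneg y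
      linarith
    have h6 : Real.exp (-(3/2)) ≤ 1 / 4 := by
      rw [Real.exp_neg, inv_le_comm₀ (Real.exp_pos _) (by norm_num)]
      have e1 := Real.exp_one_gt_d9
      have e2 := Real.add_one_le_exp (1/2 : ℝ)
      have e3 : Real.exp (3/2) = Real.exp 1 * Real.exp (1/2) := by
        rw [← Real.exp_add]; norm_num
      rw [e3]; nlinarith
    have h7 := Real.exp_pos (-|y| / 100 - 1 / 2)
    nlinarith
  have hhi : ∀ x y, psi μ m0 m x y ≤ Real.exp (2 + |y|) := by
    intro x y
    unfold psi
    rw [div_le_iff₀ (hR y)]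
    have h1 := h0.le_RR hm y
    have h2 := gg_pos y
    have h3 := fg_le (h.bd x) y
    have h4 : Real.exp (|y| / 100) ≤ Real.exp |y| := by
      refine Real.exp_le_exp.2 ?_
      have := abs_nonneg y
      linarith
    rw [Real.exp_add]
    have h5 := exp_two_ge
    have h6 := Real.exp_pos |y|
    have h7 : 5 * (1/5) ≤ Real.exp 2 * RR μ m0 y := by gcongr
    nlinarith
  have hint : Integrable (fun y => Real.exp (3 * (2 + |y|))) (rho0 μ m0) := by
    unfold rho0
    rw [integrable_withDensity_iff h0.dens_meas
      (Eventually.of_forall fun y => ENNReal.ofReal_lt_top)]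
    refine Integrable.mono' ((int_exp_abs 4).const_mul (2 * Real.exp 6)) ?_
      (Eventually.of_forall fun y => ?_)
    · refine Measurable.aestronglyMeasurable ?_
      exact Measurable.mul (by fun_prop) (ENNReal.measurable_toReal.comp
        (ENNReal.measurable_ofReal.comp (h0.RR_meas.const_mul 2)))
    · rw [ENNReal.toReal_ofReal (by linarith [hR y]), Real.norm_eq_abs,
        abs_of_pos (mul_pos (Real.exp_pos _) (by linarith [hR y]))]
      have h1 := h0.RR_le (μ := μ) y
      have h4 : Real.exp (|y| / 100) ≤ Real.exp |y| := by
        refine Real.exp_le_exp.2 ?_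
        have := abs_nonneg y
        linarith
      calc Real.exp (3 * (2 + |y|)) * (2 * RR μ m0 y)
          ≤ Real.exp (3 * (2 + |y|)) * (2 * Real.exp |y|) := by gcongr; linarith
        _ = 2 * (Real.exp (3 * (2 + |y|)) * Real.exp |y|) := by ring
        _ = 2 * (Real.exp 6 * Real.exp (4 * |y|)) := by
            rw [← Real.exp_add, ← Real.exp_add]; ring_nf
        _ = _ := by ring
  have hmean : ∀ x, ∫ y, psi μ m0 m x y ∂(rho0 μ m0) = 1 := by
    intro x
    rw [h0.integral_rho0 hm]
    have e : ∀ y, 2 * RR μ m0 y * psi μ m0 m x y = 2 * (fg (m x) y - gg y) := by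
      intro y
      unfold psi
      have := (hR y).ne'
      field_simp
    simp_rw [e]
    rw [integral_const_mul, integral_sub (fg_int _) gg_int, fg_integral, gg_integral]; norm_num
  have psi_nonneg : ∀ x y, 0 ≤ psi μ m0 m x y := fun x y => (Real.exp_pos _).le.trans (hlo x y)
  refine ⟨hmeas, by fun_prop, fun y => by positivity, hlo, hhi, hint, hmean, by norm_num,
    by linarith, ?_, ?_⟩
  · have hb : ∀ x, ∫ y, psi μ m0 m x y * psi μ m0 m x y ∂(rho0 μ m0) ≤ 1 + 80 / 10000 := by
      intro x
      have hd := h0.fg_FF (μ := μ) (m x) (h.bd x)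
      have e : ∀ y, (fg (m x) y - gg y) - RR μ m0 y = fg (m x) y - FF μ m0 y := by
        intro y; unfold RR; ring
      have := h0.chi hm (fun y => fg (m x) y - gg y) ((fg_int _).sub gg_int)
        (by rw [integral_sub (fg_int _) gg_int, fg_integral, gg_integral]; norm_num)
        (by simp_rw [e]; exact hd.1)
      simp_rw [e] at this
      refine le_trans this ?_
      linarith [hd.2]
    have := integral_mono_of_nonneg (μ := μ) (Eventually.of_forall fun x =>
      integral_nonneg fun y => mul_self_nonneg (psi μ m0 m x y)) (integrable_const (1 + 80/10000))
      (Eventually.of_forall hb)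
    simpa using this
  · have hPhi : ∀ y, ∫ x, psi μ m0 m x y ∂μ = (FF μ m y - gg y) / RR μ m0 y := by
      intro y
      unfold psi
      rw [integral_div, integral_sub (h.fg_intX y) (integrable_const _)]
      simp [FF]
    have hexp2 : Integrable (fun p : X × ℝ => Real.exp (3 * (2 + |p.2|)))
        (μ.prod (rho0 μ m0)) := hint.comp_snd μ
    have hsq : ∀ y : ℝ, Real.exp (2 + |y|) * Real.exp (2 + |y|) ≤ Real.exp (3 * (2 + |y|)) := by
      intro y
      rw [← Real.exp_add]
      refine Real.exp_le_exp.2 ?_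
      have := abs_nonneg y
      linarith
    have hPhi_nonneg : ∀ y, 0 ≤ ∫ x, psi μ m0 m x y ∂μ := fun y =>
      integral_nonneg fun x => psi_nonneg x y
    have hPhi_meas : Measurable (fun y => ∫ x, psi μ m0 m x y ∂μ) :=
      (hmeas.stronglyMeasurable.integral_prod_left (μ := μ)).measurable
    have hPhi_le : ∀ y, ∫ x, psi μ m0 m x y ∂μ ≤ Real.exp (2 + |y|) := by
      intro y
      have := integral_mono_of_nonneg (μ := μ) (Eventually.of_forall fun x => psi_nonneg x y)
        (integrable_const (Real.exp (2 + |y|))) (Eventually.of_forall fun x => hhi x y)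
      simpa using this
    have s1 : ∀ x, ∫ x', ∫ y, psi μ m0 m x y * psi μ m0 m x' y ∂(rho0 μ m0) ∂μ
        = ∫ y, psi μ m0 m x y * ∫ x', psi μ m0 m x' y ∂μ ∂(rho0 μ m0) := by
      intro x
      rw [integral_integral_swap]
      · simp_rw [integral_const_mul]
      · refine Integrable.mono' hexp2 ?_ (Eventually.of_forall fun p => ?_)
        · have h1 : Measurable (fun p : X × ℝ => (x, p.2)) := by fun_prop
          exact ((hmeas.comp h1).mul hmeas).aestronglyMeasurable
        · simp only [Function.uncurry]
          rw [Real.norm_eq_abs, abs_of_nonneg (mul_nonneg (psi_nonneg _ _) (psi_nonneg _ _))]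
          exact (mul_le_mul (hhi _ _) (hhi _ _) (psi_nonneg _ _) (Real.exp_pos _).le).trans
            (hsq _)
    simp_rw [s1]
    rw [integral_integral_swap]
    · simp_rw [integral_mul_const, hPhi]
      have e : ∀ y, (FF μ m y - gg y) - RR μ m0 y = FF μ m y - FF μ m0 y := by
        intro y; unfold RR; ring
      have := h0.chi hm (fun y => FF μ m y - gg y) (h.FF_int.sub gg_int)
        (h.RR_integral) (by simp_rw [e]; exact h0.FF_FF h)
      simp_rw [e] at this
      refine le_trans this ?_
      linarith
    · refine Integrable.mono' hexp2 ?_ (Eventually.of_forall fun p => ?_)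
      · exact (hmeas.mul (hPhi_meas.comp measurable_snd)).aestronglyMeasurable
      · simp only [Function.uncurry]
        rw [Real.norm_eq_abs, abs_of_nonneg (mul_nonneg (psi_nonneg _ _) (hPhi_nonneg _))]
        exact (mul_le_mul (hhi _ _) (hPhi_le _) (hPhi_nonneg _) (Real.exp_pos _).le).trans
          (hsq _)

end model

section expand
variable {n : ℕ} {X : Type*} [MeasurableSpace X] {μ : Measure X} [IsProbabilityMeasure μ]

/-- joint density of the shuffled sample -/
def pdens (n : ℕ) (m : X → ℝ) (p : (Fin n → X) × (Fin n → ℝ)) : ℝ :=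
  Lsym (fun x y => fg (m x) y) Finset.univ p

/-- weight -/
def HH (μ : Measure X) (m0 : X → ℝ) (S : Finset (Fin n)) (y : Fin n → ℝ) : ℝ :=
  (∏ i ∈ S, RR μ m0 (y i)) * ∏ i ∈ Sᶜ, gg (y i)

theorem HH_nonneg {m0 : X → ℝ} (h0 : Adm m0) (hm : ∫ x, m0 x ∂μ = 0)
    (S : Finset (Fin n)) (y : Fin n → ℝ) : 0 ≤ HH μ m0 S y :=
  mul_nonneg (Finset.prod_nonneg fun i _ => by linarith [h0.le_RR hm (y i)])
    (Finset.prod_nonneg fun i _ => (gg_pos _).le)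

theorem pdens_expand {m0 : X → ℝ} (m : X → ℝ) (h0 : Adm m0) (hm : ∫ x, m0 x ∂μ = 0)
    (p : (Fin n → X) × (Fin n → ℝ)) :
    pdens n m p = ∑ S : Finset (Fin n), HH μ m0 S p.2 * Lsym (psi μ m0 m) S p := by
  have e : ∀ x y, fg (m x) y = RR μ m0 y * psi μ m0 m x y + gg y := by
    intro x y
    have : RR μ m0 y ≠ 0 := by have := h0.le_RR hm y; linarith
    unfold psi
    field_simp
    ring
  unfold pdens Lsym
  simp_rw [e, Finset.prod_add, Finset.powerset_univ, Finset.prod_mul_distrib]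
  rw [Finset.sum_comm, Finset.mul_sum]
  refine Finset.sum_congr rfl fun S _ => ?_
  rw [Finset.mul_sum, Finset.mul_sum, Finset.mul_sum]
  refine Finset.sum_congr rfl fun π _ => ?_
  unfold HH
  rw [Finset.compl_eq_univ_sdiff]
  ring

theorem min_pdens {m0 m1 : X → ℝ} (h0 : Adm m0) (hm : ∫ x, m0 x ∂μ = 0)
    (G : Finset (Finset (Fin n))) 
    (hp0 : ∀ S p, 0 ≤ Lsym (n := n) (psi μ m0 m0) S p)
    (hp1 : ∀ S p, 0 ≤ Lsym (n := n) (psi μ m0 m1) S p) (p : (Fin n → X) × (Fin n → ℝ)) :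
    ∑ S ∈ G, HH μ m0 S p.2 * min (Lsym (psi μ m0 m0) S p) (Lsym (psi μ m0 m1) S p)
      ≤ min (pdens n m0 p) (pdens n m1 p) := by
  rw [pdens_expand m0 h0 hm, pdens_expand m1 h0 hm]
  refine le_min ?_ ?_
  · refine (Finset.sum_le_sum fun S _ => mul_le_mul_of_nonneg_left (min_le_left _ _)
      (HH_nonneg h0 hm S p.2)).trans ?_
    exact Finset.sum_le_sum_of_subset_of_nonneg (Finset.subset_univ _) fun S _ _ =>
      mul_nonneg (HH_nonneg h0 hm S p.2) (hp0 S p)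
  · refine (Finset.sum_le_sum fun S _ => mul_le_mul_of_nonneg_left (min_le_right _ _)
      (HH_nonneg h0 hm S p.2)).trans ?_
    exact Finset.sum_le_sum_of_subset_of_nonneg (Finset.subset_univ _) fun S _ _ =>
      mul_nonneg (HH_nonneg h0 hm S p.2) (hp1 S p)

theorem card_good (n : ℕ) : 2 ^ n ≤
    2 * (Finset.univ.filter fun S : Finset (Fin n) => 2 * S.card ≤ n).card := by
  have h1 := Finset.card_filter_add_card_filter_not
    (s := (Finset.univ : Finset (Finset (Fin n)))) (fun S : Finset (Fin n) => 2 * S.card ≤ n)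
  have h2 : (Finset.univ.filter fun S : Finset (Fin n) => ¬ 2 * S.card ≤ n).card ≤
      (Finset.univ.filter fun S : Finset (Fin n) => 2 * S.card ≤ n).card := by
    refine Finset.card_le_card_of_injOn (fun S => Sᶜ) ?_ (fun S _ T _ h => compl_injective h)
    intro S hS
    simp only [Finset.coe_filter, Finset.mem_univ, true_and, mem_ofPred_eq] at hS ⊢
    rw [Finset.card_compl, Fintype.card_fin]
    omega
  rw [Finset.card_univ, Fintype.card_finset, Fintype.card_fin] at h1
  omega

/-- the law used for the coordinate `i` given the pattern `S` -/
def dns (μ : Measure X) (m0 : X → ℝ) (S : Finset (Fin n)) (i : Fin n) (y : ℝ) : ℝ≥0∞ :=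
  if i ∈ S then ENNReal.ofReal (2 * RR μ m0 y) else ENNReal.ofReal (2 * gg y)

theorem dns_meas {m0 : X → ℝ} (h0 : Adm m0) (S : Finset (Fin n)) (i : Fin n) :
    Measurable (dns μ m0 S i) := by
  unfold dns
  by_cases hi : i ∈ S
  · simp only [hi, if_true]; exact h0.dens_meas
  · simp only [hi, if_false]; exact ENNReal.measurable_ofReal.comp (gg_meas.const_mul 2)

theorem gg_prob : IsProbabilityMeasure
    ((gaussianReal 0 1).withDensity fun y => ENNReal.ofReal (2 * gg y)) := by
  constructor
  rw [withDensity_apply _ MeasurableSet.univ, Measure.restrict_univ,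
    ← ofReal_integral_eq_lintegral_ofReal (gg_int.const_mul 2)
      (Eventually.of_forall fun y => by
        show 0 ≤ 2 * gg y
        linarith [gg_pos y])]
  rw [integral_const_mul, gg_integral]; simp

theorem dns_prob {m0 : X → ℝ} (h0 : Adm m0) (hm : ∫ x, m0 x ∂μ = 0) (S : Finset (Fin n))
    (i : Fin n) : IsProbabilityMeasure ((gaussianReal 0 1).withDensity (dns μ m0 S i)) := by
  by_cases hi : i ∈ S
  · have : dns μ m0 S i = fun y => ENNReal.ofReal (2 * RR μ m0 y) := by
      ext y; simp [dns, hi]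
    rw [this]; exact h0.rho0_prob hm
  · have : dns μ m0 S i = fun y => ENNReal.ofReal (2 * gg y) := by
      ext y; simp [dns, hi]
    rw [this]; exact gg_prob

theorem dns_prod {m0 : X → ℝ} (h0 : Adm m0) (hm : ∫ x, m0 x ∂μ = 0) (S : Finset (Fin n))
    (y : Fin n → ℝ) : ∏ i, dns μ m0 S i (y i) = ENNReal.ofReal (2 ^ n * HH μ m0 S y) := by
  have e : ∀ i, dns μ m0 S i (y i) =
      ENNReal.ofReal (if i ∈ S then 2 * RR μ m0 (y i) else 2 * gg (y i)) := by
    intro i; unfold dns; split_ifs <;> rfl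
  simp_rw [e]
  rw [← ENNReal.ofReal_prod_of_nonneg]
  · congr 1
    rw [Finset.prod_ite]
    have e1 : Finset.univ.filter (fun i => i ∈ S) = S := by ext; simp
    have e2 : Finset.univ.filter (fun i => i ∉ S) = Sᶜ := by ext; simp
    rw [e1, e2, Finset.prod_mul_distrib, Finset.prod_mul_distrib, Finset.prod_const,
      Finset.prod_const]
    unfold HH
    have : (2 : ℝ) ^ n = 2 ^ S.card * 2 ^ Sᶜ.card := by
      rw [← pow_add, Finset.card_add_card_compl, Fintype.card_fin]
    rw [this]; ring
  · intro i _
    split_ifs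
    · linarith [h0.le_RR hm (y i)]
    · linarith [gg_pos (y i)]

theorem term_bound {m0 m1 : X → ℝ} (h0 : Adm m0) (h1 : Adm m1) (hm : ∫ x, m0 x ∂μ = 0) {ε : ℝ}
    (hε0 : 0 ≤ ε) (hε : ∫ y, (FF μ m1 y - FF μ m0 y) ^ 2 ∂(gaussianReal 0 1) ≤ ε)
    (hn : 0 < n) (hnε : n * ε ≤ 4 / 1000) (S : Finset (Fin n)) (hS : 2 * S.card ≤ n) :
    ENNReal.ofReal (1 / 2) ≤ 2 ^ n * ∫⁻ p, ENNReal.ofReal (HH μ m0 S p.2 *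
      min (Lsym (psi μ m0 m0) S p) (Lsym (psi μ m0 m1) S p))
      ∂((Measure.pi fun _ : Fin n => μ).prod (Measure.pi fun _ : Fin n => gaussianReal 0 1)) := by
  have := h0.rho0_prob hm
  have c0 := core_of_model (μ := μ) h0 h0 hm hε0 (by simpa using hε0)
  have c1 := core_of_model (μ := μ) h0 h1 hm hε0 hε
  have := fun i => dns_prob (μ := μ) h0 hm S i
  set ρ : Fin n → Measure ℝ := fun i => (gaussianReal 0 1).withDensity (dns μ m0 S i) with hρ
  have hρS : ∀ j ∈ S, ρ j = rho0 μ m0 := by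
    intro j hj
    have : dns μ m0 S j = fun y => ENNReal.ofReal (2 * RR μ m0 y) := by
      ext y; simp [dns, hj]
    rw [hρ]; simp only [this]; rfl
  have k0 := c0.kl_bound' (ρ := ρ) S hρS hS hn
  have k1 := c1.kl_bound' (ρ := ρ) S hρS hS hn
  have hmin := min_bound (Q := (Measure.pi fun _ : Fin n => μ).prod (Measure.pi ρ))
    (c0.L_pos S) (c1.L_pos S) (c0.L_int S hρS) (c1.L_int S hρS)
    (c0.LlogL_int S S le_rfl hρS) (c1.LlogL_int S S le_rfl hρS) (c0.integral_L S hρS)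
    (c1.integral_L S hρS) (k0.trans (by linarith)) (k1.trans (by linarith))
  have hmeas : Measurable (fun p => min (Lsym (psi μ m0 m0) S p) (Lsym (psi μ m0 m1) S p)) :=
    (c0.L_meas S).min (c1.L_meas S)
  have hmn : ∀ p, 0 ≤ min (Lsym (psi μ m0 m0) S p) (Lsym (psi μ m0 m1) S p) := fun p =>
    le_min (c0.L_pos S p).le (c1.L_pos S p).le
  have hl : ENNReal.ofReal (1/2) ≤ ∫⁻ p, ENNReal.ofReal
      (min (Lsym (psi μ m0 m0) S p) (Lsym (psi μ m0 m1) S p))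
      ∂((Measure.pi fun _ : Fin n => μ).prod (Measure.pi ρ)) := by
    refine (ENNReal.ofReal_le_ofReal hmin).trans (le_of_eq ?_)
    exact ofReal_integral_eq_lintegral_ofReal ((c0.L_int S hρS).inf (c1.L_int S hρS))
      (Eventually.of_forall hmn)
  refine hl.trans (le_of_eq ?_)
  have hdm : Measurable (fun y : Fin n → ℝ => ∏ i, dns μ m0 S i (y i)) :=
    Finset.measurable_prod _ fun i _ => (dns_meas h0 S i).comp (measurable_pi_apply i)
  have hdm2 : Measurable (fun z : (Fin n → X) × (Fin n → ℝ) => ∏ i, dns μ m0 S i (z.2 i)) :=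
    hdm.comp measurable_snd
  rw [hρ, pi_withDensity' (fun _ => gaussianReal 0 1) (dns μ m0 S) (dns_meas h0 S),
    prod_withDensity_right hdm,
    lintegral_withDensity_eq_lintegral_mul _ hdm2 hmeas.ennreal_ofReal]
  rw [← lintegral_const_mul']
  · congr 1
    ext p
    simp only [Pi.mul_apply, Function.comp]
    rw [dns_prod h0 hm, ENNReal.ofReal_mul (by positivity),
      ENNReal.ofReal_mul (HH_nonneg h0 hm S p.2), mul_assoc]
    congr 1
    rw [ENNReal.ofReal_pow (by norm_num)]; simp
  · simp

theorem overlap {m0 m1 : X → ℝ} (h0 : Adm m0) (h1 : Adm m1) (hm : ∫ x, m0 x ∂μ = 0) {ε : ℝ}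
    (hε0 : 0 ≤ ε) (hε : ∫ y, (FF μ m1 y - FF μ m0 y) ^ 2 ∂(gaussianReal 0 1) ≤ ε)
    (hn : 0 < n) (hnε : n * ε ≤ 4 / 1000) :
    ENNReal.ofReal (1 / 4) ≤ ∫⁻ p, ENNReal.ofReal (min (pdens n m0 p) (pdens n m1 p))
      ∂((Measure.pi fun _ : Fin n => μ).prod (Measure.pi fun _ : Fin n => gaussianReal 0 1)) := by
  have := h0.rho0_prob hm
  have c0 := core_of_model (μ := μ) h0 h0 hm hε0 (by simpa using hε0)
  have c1 := core_of_model (μ := μ) h0 h1 hm hε0 hε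
  set G := Finset.univ.filter fun S : Finset (Fin n) => 2 * S.card ≤ n with hG
  have hHm : ∀ S : Finset (Fin n), Measurable (HH μ m0 S) := by
    intro S
    exact (Finset.measurable_prod _ fun i _ => h0.RR_meas.comp (measurable_pi_apply i)).mul
      (Finset.measurable_prod _ fun i _ => gg_meas.comp (measurable_pi_apply i))
  have hmeas : ∀ S : Finset (Fin n), Measurable (fun p => HH μ m0 S p.2 *
      min (Lsym (psi μ m0 m0) S p) (Lsym (psi μ m0 m1) S p)) := fun S =>
    ((hHm S).comp measurable_snd).mul ((c0.L_meas S).min (c1.L_meas S))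
  have hb : ∀ p : (Fin n → X) × (Fin n → ℝ),
      ∑ S ∈ G, ENNReal.ofReal (HH μ m0 S p.2 *
      min (Lsym (psi μ m0 m0) S p) (Lsym (psi μ m0 m1) S p)) ≤
      ENNReal.ofReal (min (pdens n m0 p) (pdens n m1 p)) := by
    intro p
    rw [← ENNReal.ofReal_sum_of_nonneg fun S _ => mul_nonneg (HH_nonneg h0 hm S p.2)
      (le_min (c0.L_pos S p).le (c1.L_pos S p).le)]
    exact ENNReal.ofReal_le_ofReal (min_pdens h0 hm G (fun S p => (c0.L_pos S p).le)
      (fun S p => (c1.L_pos S p).le) p)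
  refine le_trans ?_ (lintegral_mono hb)
  rw [lintegral_finsetSum _ fun S _ => (hmeas S).ennreal_ofReal]
  have h2 : ∀ S ∈ G, ENNReal.ofReal (1 / 2 * (2 ^ n)⁻¹) ≤ ∫⁻ p, ENNReal.ofReal (HH μ m0 S p.2 *
      min (Lsym (psi μ m0 m0) S p) (Lsym (psi μ m0 m1) S p))
      ∂((Measure.pi fun _ : Fin n => μ).prod (Measure.pi fun _ : Fin n => gaussianReal 0 1)) := by
    intro S hS
    have h3 := term_bound (μ := μ) h0 h1 hm hε0 hε hn hnε S (by simpa [hG] using hS)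
    rw [ENNReal.ofReal_mul (by norm_num), ENNReal.ofReal_inv_of_pos (by positivity),
      ← div_eq_mul_inv, ENNReal.ofReal_pow (by norm_num)]
    refine ENNReal.div_le_of_le_mul' ?_
    simpa using h3
  refine le_trans ?_ (Finset.sum_le_sum h2)
  rw [Finset.sum_const, nsmul_eq_mul, ← ENNReal.ofReal_natCast, ← ENNReal.ofReal_mul (by positivity)]
  refine ENNReal.ofReal_le_ofReal ?_
  have hcg : ((2 : ℝ) ^ n) ≤ 2 * G.card := by exact_mod_cast card_good n
  have hp : (0 : ℝ) < 2 ^ n := by positivity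
  have : (G.card : ℝ) * (1 / 2 * (2 ^ n)⁻¹) = (2 * G.card) * (2 ^ n)⁻¹ / 4 := by ring
  rw [this]
  have h5 : (2 : ℝ) ^ n * (2 ^ n)⁻¹ ≤ 2 * G.card * (2 ^ n)⁻¹ := by gcongr
  rw [mul_inv_cancel₀ hp.ne'] at h5
  linarith

end expand

theorem gauss_withDensity (a : ℝ) : gaussianReal a 1
    = (gaussianReal 0 1).withDensity fun y => ENNReal.ofReal (fg a y) := by
  have hm : Measurable (fun y => ENNReal.ofReal (fg a y)) := by
    unfold fg; fun_prop
  rw [gaussianReal_of_var_ne_zero _ one_ne_zero, gaussianReal_of_var_ne_zero _ one_ne_zero,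
    ← withDensity_mul _ (measurable_gaussianPDF 0 1) hm]
  congr 1
  ext y
  simp only [Pi.mul_apply, gaussianPDF]
  rw [← ENNReal.ofReal_mul (gaussianPDFReal_nonneg _ _ _)]
  congr 1
  simp only [gaussianPDFReal, fg]
  rw [mul_assoc (Real.sqrt _)⁻¹, ← Real.exp_add]
  congr 2
  simp
  ring

theorem shift_lintegral {n : ℕ} (a : Fin n → ℝ) (h : (Fin n → ℝ) → ℝ≥0∞) (hh : Measurable h) :
    ∫⁻ e, h (fun i => a i + e i) ∂(Measure.pi fun _ : Fin n => gaussianReal 0 1)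
    = ∫⁻ y, ENNReal.ofReal (∏ i, fg (a i) (y i)) * h y
      ∂(Measure.pi fun _ : Fin n => gaussianReal 0 1) := by
  have hmp : MeasurePreserving (fun (e : Fin n → ℝ) i => a i + e i)
      (Measure.pi fun _ : Fin n => gaussianReal 0 1) (Measure.pi fun i => gaussianReal (a i) 1) := by
    refine measurePreserving_pi _ _ fun i => ⟨by fun_prop, ?_⟩
    rw [gaussianReal_map_const_add, zero_add]
  rw [hmp.lintegral_comp hh]
  have hfm : ∀ i, Measurable (fun y => ENNReal.ofReal (fg (a i) y)) := by
    intro i; unfold fg; fun_prop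
  have hpr : ∀ i, IsProbabilityMeasure
      ((gaussianReal 0 1).withDensity fun y => ENNReal.ofReal (fg (a i) y)) := by
    intro i; rw [← gauss_withDensity]; infer_instance
  have h1 := pi_withDensity' (fun _ : Fin n => gaussianReal 0 1)
    (fun i y => ENNReal.ofReal (fg (a i) y)) hfm
  simp_rw [gauss_withDensity (a _)]
  have hpm : Measurable (fun y : Fin n → ℝ => ∏ i, ENNReal.ofReal (fg (a i) (y i))) :=
    Finset.measurable_prod _ fun i _ => (hfm i).comp (measurable_pi_apply i)
  rw [h1, lintegral_withDensity_eq_lintegral_mul _ hpm hh]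
  congr 1
  ext y
  simp only [Pi.mul_apply]
  rw [ENNReal.ofReal_prod_of_nonneg fun i _ => (fg_pos _ _).le]

/-- loss function -/
def DD (μX : Measure ℝ) {n : ℕ} (mhat : ((Fin n → ℝ) × (Fin n → ℝ)) → ℝ → ℝ) (m : ℝ → ℝ)
    (d : (Fin n → ℝ) × (Fin n → ℝ)) : ℝ≥0∞ := ∫⁻ x, ENNReal.ofReal |mhat d x - m x| ∂μX

/-- the observed data in terms of covariates and rescaled responses -/
def dat {n : ℕ} (σ : ℝ) (p : (Fin n → ℝ) × (Fin n → ℝ)) : (Fin n → ℝ) × (Fin n → ℝ) :=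
  (fun i => σ * p.2 i, fun j => p.1 (Tuple.sort p.1 j))

theorem dat_meas {n : ℕ} (σ : ℝ) : Measurable (dat (n := n) σ) := by
  unfold dat
  exact Measurable.prodMk (by fun_prop) (measurable_sort.comp measurable_fst)

theorem dat_perm {n : ℕ} (σ : ℝ) (x y : Fin n → ℝ) (π : Equiv.Perm (Fin n)) :
    dat σ (x ∘ π, y) = dat σ (x, y) := by
  have := Tuple.comp_perm_comp_sort_eq_comp_sort (f := x) (σ := π)
  unfold dat
  simp only
  congr 1

theorem risk_eq {n : ℕ} (μX : Measure ℝ) [IsProbabilityMeasure μX] (σ : ℝ)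
    {m : ℝ → ℝ} (hm : Adm m) (D : (Fin n → ℝ) × (Fin n → ℝ) → ℝ≥0∞) (hD : Measurable D) :
    ∫⁻ d, D d ∂(shuffledLaw μX (gaussianReal 0 1) σ (fun x => σ * m x) n)
    = ∫⁻ p, ENNReal.ofReal (pdens n m p) * D (dat σ p)
      ∂((Measure.pi fun _ : Fin n => μX).prod (Measure.pi fun _ : Fin n => gaussianReal 0 1)) := by
  have hmm := hm.meas
  set ν := gaussianReal 0 1 with hν
  -- the shift map
  have hshift : Measurable (fun p : (Fin n → ℝ) × (Fin n → ℝ) =>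
      ((p.1, fun i => m (p.1 i) + p.2 i) : (Fin n → ℝ) × (Fin n → ℝ))) := by fun_prop
  have hT' : Measurable (fun p : (Fin n → ℝ) × (Fin n → ℝ) =>
      D (dat σ (p.1, fun i => m (p.1 i) + p.2 i))) := hD.comp ((dat_meas σ).comp hshift)
  have hmp := measurePreserving_arrowProdEquivProdArrow ℝ ℝ (Fin n) (fun _ => μX) (fun _ => ν)
  have e1 : ∀ ω : Fin n → ℝ × ℝ, ((fun i => σ * m (ω i).1 + σ * (ω i).2,
     fun j => (ω (Tuple.sort (fun i => (ω i).1) j)).1) : (Fin n → ℝ) × (Fin n → ℝ))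
     = dat σ ((MeasurableEquiv.arrowProdEquivProdArrow ℝ ℝ (Fin n) ω).1, fun i =>
        m ((MeasurableEquiv.arrowProdEquivProdArrow ℝ ℝ (Fin n) ω).1 i) +
          (MeasurableEquiv.arrowProdEquivProdArrow ℝ ℝ (Fin n) ω).2 i) := by
    intro ω
    unfold dat
    simp only [mul_add]
    rfl
  have hTm : Measurable (fun ω : Fin n → ℝ × ℝ => ((fun i => σ * m (ω i).1 + σ * (ω i).2,
     fun j => (ω (Tuple.sort (fun i => (ω i).1) j)).1) : (Fin n → ℝ) × (Fin n → ℝ))) := by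
    simp_rw [e1]
    exact ((dat_meas σ).comp hshift).comp (MeasurableEquiv.measurable _)
  unfold shuffledLaw
  rw [lintegral_map hD hTm]
  simp_rw [e1]
  rw [hmp.lintegral_comp hT', lintegral_prod _ hT'.aemeasurable]
  -- change of variables in the noise
  have e2 : ∀ x : Fin n → ℝ, ∫⁻ e, D (dat σ (x, fun i => m (x i) + e i)) ∂(Measure.pi fun _ => ν)
      = ∫⁻ y, ENNReal.ofReal (∏ i, fg (m (x i)) (y i)) * D (dat σ (x, y))
        ∂(Measure.pi fun _ => ν) := by
    intro x
    exact shift_lintegral (fun i => m (x i)) (fun y => D (dat σ (x, y)))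
      (hD.comp ((dat_meas σ).comp measurable_prodMk_left))
  simp_rw [e2]
  have hw : ∀ π : Equiv.Perm (Fin n), Measurable (fun p : (Fin n → ℝ) × (Fin n → ℝ) =>
      ∏ i, fg (m (p.1 (π i))) (p.2 i)) := by
    intro π
    unfold fg
    fun_prop
  have hDd : Measurable (fun p : (Fin n → ℝ) × (Fin n → ℝ) => D (dat σ p)) :=
    hD.comp (dat_meas σ)
  have hF : ∀ π : Equiv.Perm (Fin n), Measurable (fun p : (Fin n → ℝ) × (Fin n → ℝ) =>
      ENNReal.ofReal (∏ i, fg (m (p.1 (π i))) (p.2 i)) * D (dat σ p)) := fun π =>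
    (hw π).ennreal_ofReal.mul hDd
  rw [← lintegral_prod (fun p : (Fin n → ℝ) × (Fin n → ℝ) =>
      ENNReal.ofReal (∏ i, fg (m (p.1 i)) (p.2 i)) * D (dat σ p)) (hF 1).aemeasurable]
  set I := ∫⁻ p : (Fin n → ℝ) × (Fin n → ℝ),
      ENNReal.ofReal (∏ i, fg (m (p.1 i)) (p.2 i)) * D (dat σ p)
      ∂((Measure.pi fun _ : Fin n => μX).prod (Measure.pi fun _ : Fin n => ν)) with hI
  have e3 : ∀ π : Equiv.Perm (Fin n), ∫⁻ p : (Fin n → ℝ) × (Fin n → ℝ),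
      ENNReal.ofReal (∏ i, fg (m (p.1 (π i))) (p.2 i)) * D (dat σ p)
      ∂((Measure.pi fun _ : Fin n => μX).prod (Measure.pi fun _ : Fin n => ν)) = I := by
    intro π
    have hπ := (mp_perm μX π).prod (MeasurePreserving.id (Measure.pi fun _ : Fin n => ν))
    have hF1 : Measurable (fun p : (Fin n → ℝ) × (Fin n → ℝ) =>
      ENNReal.ofReal (∏ i, fg (m (p.1 i)) (p.2 i)) * D (dat σ p)) := hF 1
    rw [hI, ← hπ.lintegral_comp hF1]
    refine lintegral_congr fun p => ?_
    simp only [Prod.map, id, Function.comp_apply]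
    congr 2
    exact (dat_perm σ p.1 p.2 π).symm
  have e4 : ∀ p : (Fin n → ℝ) × (Fin n → ℝ), ENNReal.ofReal (pdens n m p) * D (dat σ p)
      = ENNReal.ofReal (n.factorial : ℝ)⁻¹ * ∑ π : Equiv.Perm (Fin n),
        ENNReal.ofReal (∏ i, fg (m (p.1 (π i))) (p.2 i)) * D (dat σ p) := by
    intro p
    unfold pdens Lsym
    rw [ENNReal.ofReal_mul (by positivity), ENNReal.ofReal_sum_of_nonneg
      (fun π _ => Finset.prod_nonneg fun i _ => (fg_pos _ _).le), mul_assoc, Finset.sum_mul]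
  simp_rw [e4]
  rw [lintegral_const_mul _ (Finset.measurable_sum _ fun π _ => hF π),
    lintegral_finsetSum _ fun π _ => hF π]
  simp_rw [e3]
  rw [Finset.sum_const, Finset.card_univ, Fintype.card_perm, Fintype.card_fin, nsmul_eq_mul,
    ← mul_assoc, ← ENNReal.ofReal_natCast, ← ENNReal.ofReal_mul (by positivity),
    inv_mul_cancel₀ (by exact_mod_cast n.factorial_ne_zero)]
  simp

theorem two_point {n : ℕ} (hn : 0 < n) (μX : Measure ℝ) [IsProbabilityMeasure μX] (σ : ℝ)
    (hσ : 0 < σ)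
    {m0 m1 : ℝ → ℝ} (h0 : Adm m0) (h1 : Adm m1) (hm : ∫ x, m0 x ∂μX = 0) {ε : ℝ}
    (hε0 : 0 ≤ ε) (hε : ∫ y, (FF μX m1 y - FF μX m0 y) ^ 2 ∂(gaussianReal 0 1) ≤ ε)
    (hnε : n * ε ≤ 4 / 1000) {δ : ℝ} (hδ : ∀ x, δ ≤ |m0 x - m1 x|)
    (mhat : ((Fin n → ℝ) × (Fin n → ℝ)) → ℝ → ℝ)
    (hmh : Measurable (fun p : ((Fin n → ℝ) × (Fin n → ℝ)) × ℝ => mhat p.1 p.2)) :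
    ENNReal.ofReal (σ * δ) * ENNReal.ofReal (1/4) ≤
      popRisk μX (shuffledLaw μX (gaussianReal 0 1) σ (fun x => σ * m0 x) n) mhat
        (fun x => σ * m0 x) +
      popRisk μX (shuffledLaw μX (gaussianReal 0 1) σ (fun x => σ * m1 x) n) mhat
        (fun x => σ * m1 x) := by
  have hDm : ∀ m : ℝ → ℝ, Adm m → Measurable (DD μX mhat (fun x => σ * m x)) := by
    intro m h
    have : Measurable (fun p : ((Fin n → ℝ) × (Fin n → ℝ)) × ℝ =>
        ENNReal.ofReal |mhat p.1 p.2 - σ * m p.2|) := by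
      have h2 : Measurable (fun p : ((Fin n → ℝ) × (Fin n → ℝ)) × ℝ => σ * m p.2) :=
        (h.meas.comp measurable_snd).const_mul σ
      have h3 : Measurable (fun p : ((Fin n → ℝ) × (Fin n → ℝ)) × ℝ =>
        mhat p.1 p.2 - σ * m p.2) := hmh.sub h2
      fun_prop
    exact this.lintegral_prod_right'
  have r0 : popRisk μX (shuffledLaw μX (gaussianReal 0 1) σ (fun x => σ * m0 x) n) mhat
        (fun x => σ * m0 x) = ∫⁻ p, ENNReal.ofReal (pdens n m0 p) *
          DD μX mhat (fun x => σ * m0 x) (dat σ p)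
      ∂((Measure.pi fun _ : Fin n => μX).prod (Measure.pi fun _ : Fin n => gaussianReal 0 1)) :=
    risk_eq (n := n) μX σ h0 _ (hDm m0 h0)
  have r1 : popRisk μX (shuffledLaw μX (gaussianReal 0 1) σ (fun x => σ * m1 x) n) mhat
        (fun x => σ * m1 x) = ∫⁻ p, ENNReal.ofReal (pdens n m1 p) *
          DD μX mhat (fun x => σ * m1 x) (dat σ p)
      ∂((Measure.pi fun _ : Fin n => μX).prod (Measure.pi fun _ : Fin n => gaussianReal 0 1)) :=
    risk_eq (n := n) μX σ h1 _ (hDm m1 h1)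
  have hpm : ∀ m : ℝ → ℝ, Adm m → Measurable (pdens n m) := by
    intro m h
    have := h.meas
    unfold pdens Lsym fg
    fun_prop
  have hmq : Measurable (fun p : (Fin n → ℝ) × (Fin n → ℝ) => ENNReal.ofReal (pdens n m0 p) *
      DD μX mhat (fun x => σ * m0 x) (dat σ p)) :=
    (hpm m0 h0).ennreal_ofReal.mul ((hDm m0 h0).comp (dat_meas σ))
  rw [r0, r1, ← lintegral_add_left hmq]
  have hsum : ∀ d, ENNReal.ofReal (σ * δ) ≤
      DD μX mhat (fun x => σ * m0 x) d + DD μX mhat (fun x => σ * m1 x) d := by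
    intro d
    unfold DD
    have hmd : Measurable (mhat d) := hmh.comp measurable_prodMk_left
    have hm0 := h0.meas
    rw [← lintegral_add_left (by fun_prop)]
    have : ENNReal.ofReal (σ * δ) = ∫⁻ _, ENNReal.ofReal (σ * δ) ∂μX := by simp
    rw [this]
    refine lintegral_mono fun x => ?_
    simp only
    rw [← ENNReal.ofReal_add (abs_nonneg _) (abs_nonneg _)]
    refine ENNReal.ofReal_le_ofReal ?_
    calc σ * δ ≤ σ * |m0 x - m1 x| := by gcongr; exact hδ x
      _ = |(mhat d x - σ * m1 x) - (mhat d x - σ * m0 x)| := by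
          rw [← abs_of_pos hσ, ← abs_mul, abs_of_pos hσ]; congr 1; ring
      _ ≤ |mhat d x - σ * m1 x| + |mhat d x - σ * m0 x| := abs_sub _ _
      _ = _ := add_comm _ _
  calc ENNReal.ofReal (σ * δ) * ENNReal.ofReal (1/4)
      ≤ ENNReal.ofReal (σ * δ) * ∫⁻ p, ENNReal.ofReal (min (pdens n m0 p) (pdens n m1 p))
      ∂((Measure.pi fun _ : Fin n => μX).prod (Measure.pi fun _ : Fin n => gaussianReal 0 1)) := by
        gcongr
        exact overlap h0 h1 hm hε0 hε hn hnε
    _ = ∫⁻ p, ENNReal.ofReal (σ * δ) * ENNReal.ofReal (min (pdens n m0 p) (pdens n m1 p))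
      ∂((Measure.pi fun _ : Fin n => μX).prod (Measure.pi fun _ : Fin n => gaussianReal 0 1)) := by
        rw [lintegral_const_mul' _ _ ENNReal.ofReal_ne_top]
    _ ≤ _ := by
        refine lintegral_mono fun p => ?_
        have a0 : ENNReal.ofReal (min (pdens n m0 p) (pdens n m1 p))
          ≤ ENNReal.ofReal (pdens n m0 p) := ENNReal.ofReal_le_ofReal (min_le_left _ _)
        have a1 : ENNReal.ofReal (min (pdens n m0 p) (pdens n m1 p))
          ≤ ENNReal.ofReal (pdens n m1 p) := ENNReal.ofReal_le_ofReal (min_le_right _ _)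
        simp only
        calc _ ≤ (DD μX mhat (fun x => σ * m0 x) (dat σ p) +
              DD μX mhat (fun x => σ * m1 x) (dat σ p)) *
              ENNReal.ofReal (min (pdens n m0 p) (pdens n m1 p)) := by
                gcongr; exact hsum _
          _ ≤ _ := by
            rw [add_mul, mul_comm, mul_comm (DD μX mhat (fun x => σ * m1 x) (dat σ p))]
            gcongr

/-- number of thresholds strictly below `x` -/
def BB (τ : ℕ → ℝ) (K : ℕ) (x : ℝ) : ℕ := ((Finset.range K).filter (fun j => τ j < x)).card

theorem BB_mono (τ : ℕ → ℝ) (K : ℕ) : Monotone (BB τ K) := by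
  intro x y h
  refine Finset.card_le_card fun j hj => ?_
  rw [Finset.mem_filter] at hj ⊢
  exact ⟨hj.1, hj.2.trans_le h⟩

theorem BB_le (τ : ℕ → ℝ) (K : ℕ) (x : ℝ) : BB τ K x ≤ K := by
  have := Finset.card_filter_le (Finset.range K) (fun j => τ j < x)
  simpa [BB] using this

theorem BB_left (τ : ℕ → ℝ) (K : ℕ) (x : ℝ) :
    ∀ᶠ y in nhdsWithin x (Iio x), BB τ K y = BB τ K x := by
  have h : ∀ᶠ y in nhdsWithin x (Iio x), ∀ j ∈ Finset.range K, (τ j < y ↔ τ j < x) := by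
    rw [Filter.eventually_all_finset]
    intro j _
    by_cases hj : τ j < x
    · filter_upwards [Ioo_mem_nhdsLT hj] with y hy
      exact ⟨fun _ => hj, fun _ => hy.1⟩
    · filter_upwards [self_mem_nhdsWithin] with y hy
      exact ⟨fun h => h.trans hy, fun h => absurd h hj⟩
  filter_upwards [h] with y hy
  unfold BB
  rw [Finset.filter_congr hy]

theorem BB_right (τ : ℕ → ℝ) (K : ℕ) (x : ℝ) :
    ∃ L, ∀ᶠ y in nhdsWithin x (Ioi x), BB τ K y = L := by
  refine ⟨((Finset.range K).filter (fun j => τ j ≤ x)).card, ?_⟩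
  have h : ∀ᶠ y in nhdsWithin x (Ioi x), ∀ j ∈ Finset.range K, (τ j < y ↔ τ j ≤ x) := by
    rw [Filter.eventually_all_finset]
    intro j _
    by_cases hj : τ j ≤ x
    · filter_upwards [self_mem_nhdsWithin] with y hy
      exact ⟨fun _ => hj, fun _ => hj.trans_lt hy⟩
    · push Not at hj
      filter_upwards [Ioo_mem_nhdsGT hj] with y hy
      exact ⟨fun h => absurd h hy.2.not_gt, fun h => absurd h hj.not_ge⟩
  filter_upwards [h] with y hy
  unfold BB
  rw [Finset.filter_congr hy]

theorem BB_abel (τ : ℕ → ℝ) (g : ℕ → ℝ) (x : ℝ) (K : ℕ)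
    (hτ : ∀ i j, i < j → j < K → τ i < τ j) :
    g (BB τ K x) = g 0 + ∑ j ∈ Finset.range K, (g (j+1) - g j) * (Ioi (τ j)).indicator 1 x := by
  induction K with
  | zero => simp [BB]
  | succ K ih =>
    have ih' := ih fun i j h1 h2 => hτ i j h1 (by omega)
    rw [Finset.sum_range_succ]
    by_cases h : τ K < x
    · have hall : ∀ L ≤ K + 1, BB τ L x = L := by
        intro L hL
        unfold BB
        rw [Finset.filter_true_of_mem, Finset.card_range]
        intro j hj
        have hj' := Finset.mem_range.1 hj
        rcases Nat.lt_or_ge j K with h3 | h3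
        · exact (hτ j K h3 (by omega)).trans h
        · have : j = K := by omega
          rw [this]; exact h
      rw [hall K (by omega)] at ih'
      rw [hall (K+1) le_rfl, ← add_assoc, ← ih', indicator_of_mem (by exact h)]
      simp
    · have : BB τ (K+1) x = BB τ K x := by
        unfold BB
        rw [Finset.range_add_one, Finset.filter_insert, if_neg h]
      rw [this, ih', indicator_of_notMem (by exact h)]
      simp

theorem cdf_cont (μX : Measure ℝ) [IsProbabilityMeasure μX] (hc : ∀ x : ℝ, μX {x} = 0) :
    Continuous (cdf μX) := by
  rw [continuous_iff_continuousAt]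
  intro x
  rw [(monotone_cdf μX).continuousAt_iff_leftLim_eq_rightLim]
  rw [StieltjesFunction.rightLim_eq]
  have h1 := StieltjesFunction.measure_singleton (cdf μX) x
  rw [measure_cdf, hc x] at h1
  have h2 : cdf μX x - Function.leftLim (cdf μX) x ≤ 0 := ENNReal.ofReal_eq_zero.1 h1.symm
  have h3 : Function.leftLim (cdf μX) x ≤ cdf μX x := (monotone_cdf μX).leftLim_le le_rfl
  linarith

theorem exists_B (μX : Measure ℝ) [IsProbabilityMeasure μX] (hc : ∀ x : ℝ, μX {x} = 0)
    (K : ℕ) (p : ℕ → ℝ) (hp : ∀ i ≤ K, 0 < p i) (hs : ∑ i ∈ Finset.range (K+1), p i = 1) :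
    ∃ B : ℝ → ℕ, Monotone B ∧ (∀ x, B x ≤ K) ∧
      (∀ x, ∀ᶠ y in nhdsWithin x (Iio x), B y = B x) ∧
      (∀ x, ∃ L, ∀ᶠ y in nhdsWithin x (Ioi x), B y = L) ∧
      ∀ g : ℕ → ℝ, ∫ x, g (B x) ∂μX = ∑ i ∈ Finset.range (K+1), p i * g i := by
  have hcj : ∀ j : ℕ, ∃ t, j < K → cdf μX t = ∑ i ∈ Finset.range (j+1), p i := by
    intro j
    by_cases hj : j < K
    · have hpos : 0 < ∑ i ∈ Finset.range (j+1), p i :=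
        Finset.sum_pos (fun i hi => hp i (by have := Finset.mem_range.1 hi; omega)) (by simp)
      have hlt : ∑ i ∈ Finset.range (j+1), p i < 1 := by
        rw [← hs]
        refine Finset.sum_lt_sum_of_subset (i := K) (Finset.range_subset_range.2 (by omega))
          (by simp) (by simp; omega) (hp K le_rfl) ?_
        intro i hi _
        exact (hp i (by have := Finset.mem_range.1 hi; omega)).le
      obtain ⟨t, ht⟩ := mem_range_of_exists_le_of_exists_ge (cdf_cont μX hc)
        ((tendsto_cdf_atBot μX).eventually_le_const hpos).exists
        ((tendsto_cdf_atTop μX).eventually_const_le hlt).exists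
      exact ⟨t, fun _ => ht⟩
    · exact ⟨0, fun h => absurd h hj⟩
  choose τ hτ using hcj
  have hmono : ∀ i j, i < j → j < K → τ i < τ j := by
    intro i j hij hj
    by_contra hcon
    push Not at hcon
    have h1 := monotone_cdf μX hcon
    rw [hτ i (by omega), hτ j hj] at h1
    have h2 : ∑ l ∈ Finset.range (i+1), p l < ∑ l ∈ Finset.range (j+1), p l := by
      refine Finset.sum_lt_sum_of_subset (i := j) (Finset.range_subset_range.2 (by omega))
          (by simp) (by simp; omega) (hp j (by omega)) ?_
      intro l hl _
      exact (hp l (by have := Finset.mem_range.1 hl; omega)).le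
    linarith
  refine ⟨BB τ K, BB_mono τ K, BB_le τ K, BB_left τ K, BB_right τ K, fun g => ?_⟩
  simp_rw [BB_abel τ g _ K hmono]
  have hint : ∀ j, Integrable ((Ioi (τ j)).indicator (1 : ℝ → ℝ)) μX := fun j =>
    (integrable_const (1:ℝ)).indicator measurableSet_Ioi
  rw [integral_add (integrable_const _)
    (integrable_finsetSum _ fun j _ => (hint j).const_mul _),
    integral_finsetSum _ fun j _ => (hint j).const_mul _]
  have hI : ∀ j ∈ Finset.range K, ∫ x, (g (j+1) - g j) * (Ioi (τ j)).indicator (1 : ℝ → ℝ) x ∂μX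
      = ∑ i ∈ Finset.range (K+1), p i * (if j < i then g (j+1) - g j else 0) := by
    intro j hj
    have hj' := Finset.mem_range.1 hj
    rw [integral_const_mul, integral_indicator_one measurableSet_Ioi]
    have h1 : μX.real (Ioi (τ j)) = 1 - ∑ i ∈ Finset.range (j+1), p i := by
      rw [← hτ j hj', cdf_eq_real, ← compl_Iic, probReal_compl_eq_one_sub measurableSet_Iic]
    have h2 : ∑ i ∈ Finset.range (K+1), p i * (if j < i then g (j+1) - g j else 0)
        = (g (j+1) - g j) * ∑ i ∈ Finset.range (K+1), (p i - if i < j + 1 then p i else 0) := by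
      rw [Finset.mul_sum]
      refine Finset.sum_congr rfl fun i _ => ?_
      by_cases h : j < i
      · rw [if_pos h, if_neg (by omega)]; ring
      · rw [if_neg h, if_pos (by omega)]; ring
    rw [h2, Finset.sum_sub_distrib, hs, h1, ← Finset.sum_filter]
    congr 3
    ext i; simp; omega
  rw [Finset.sum_congr rfl hI, Finset.sum_comm]
  have h3 : ∀ i ∈ Finset.range (K+1), ∑ j ∈ Finset.range K,
      p i * (if j < i then g (j+1) - g j else 0) = p i * g i - p i * g 0 := by
    intro i hi
    have hi' := Finset.mem_range.1 hi
    rw [← Finset.mul_sum, ← Finset.sum_filter, ← mul_sub, ← Finset.sum_range_sub]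
    congr 2
    ext j; simp; omega
  rw [Finset.sum_congr rfl h3, Finset.sum_sub_distrib, ← Finset.sum_mul, hs]
  simp

/-- Gaussian second moment of a signed combination -/
theorem mix_sq {ι : Type*} (s : Finset ι) (q u : ι → ℝ) :
    HasSum (fun l : ℕ => (∑ i ∈ s, q i * u i ^ l) ^ 2 / l.factorial)
      (∫ y, (∑ i ∈ s, q i * fg (u i) y) ^ 2 ∂(gaussianReal 0 1)) := by
  have h1 : ∀ y, (∑ i ∈ s, q i * fg (u i) y) ^ 2
      = ∑ i ∈ s, ∑ j ∈ s, (q i * q j) * (fg (u i) y * fg (u j) y) := by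
    intro y
    rw [sq, Finset.sum_mul_sum]
    refine Finset.sum_congr rfl fun i _ => Finset.sum_congr rfl fun j _ => by ring
  simp_rw [h1]
  rw [integral_finsetSum _ fun i _ => integrable_finsetSum _ fun j _ =>
    (fg_mul_int (u i) (u j)).const_mul _]
  have h2 : ∀ i ∈ s, ∫ y, ∑ j ∈ s, (q i * q j) * (fg (u i) y * fg (u j) y) ∂(gaussianReal 0 1)
      = ∑ j ∈ s, (q i * q j) * Real.exp (u i * u j) := by
    intro i _
    rw [integral_finsetSum _ fun j _ => (fg_mul_int (u i) (u j)).const_mul _]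
    refine Finset.sum_congr rfl fun j _ => ?_
    rw [integral_const_mul, fg_mul_integral]
  rw [Finset.sum_congr rfl h2]
  have h3 : HasSum (fun l : ℕ => ∑ i ∈ s, ∑ j ∈ s, (q i * q j) * ((u i * u j) ^ l / l.factorial))
      (∑ i ∈ s, ∑ j ∈ s, (q i * q j) * Real.exp (u i * u j)) := by
    refine hasSum_sum fun i _ => hasSum_sum fun j _ => HasSum.mul_left _ ?_
    rw [Real.exp_eq_exp_ℝ]
    exact NormedSpace.expSeries_div_hasSum_exp (u i * u j)
  have h4 : (fun l : ℕ => (∑ i ∈ s, q i * u i ^ l) ^ 2 / l.factorial)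
      = fun l : ℕ => ∑ i ∈ s, ∑ j ∈ s, (q i * q j) * ((u i * u j) ^ l / l.factorial) := by
    ext l
    rw [sq, Finset.sum_mul_sum, Finset.sum_div]
    refine Finset.sum_congr rfl fun i _ => ?_
    rw [Finset.sum_div]
    refine Finset.sum_congr rfl fun j _ => ?_
    rw [mul_pow]; ring
  rw [h4]; exact h3

/-- the tail of the moment series -/
theorem tail_bound {D : ℕ → ℝ} {S : ℝ} (k : ℕ) (hS : HasSum (fun l : ℕ => D l ^ 2 / l.factorial) S)
    (h0 : ∀ l < k, D l = 0) (hD : ∀ l, |D l| ≤ 2 * (1/100) ^ l) :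
    S ≤ 8 * (1/10000) ^ k / k.factorial := by
  have h1 := (hasSum_nat_add_iff' k).2 hS
  have h2 : ∑ i ∈ Finset.range k, D i ^ 2 / i.factorial = 0 := by
    refine Finset.sum_eq_zero fun i hi => ?_
    rw [h0 i (Finset.mem_range.1 hi)]; simp
  rw [h2, sub_zero] at h1
  have h3 : HasSum (fun j : ℕ => (4 * (1/10000:ℝ) ^ k / k.factorial) * (1/10000:ℝ) ^ j)
      ((4 * (1/10000) ^ k / k.factorial) * (1 - 1/10000)⁻¹) :=
    (hasSum_geometric_of_lt_one (by norm_num) (by norm_num)).mul_left _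
  have h4 := hasSum_le (fun j => ?_) h1 h3
  · refine h4.trans ?_
    have h5 : (1 - 1/10000 : ℝ)⁻¹ ≤ 2 := by norm_num
    have h6 : (0:ℝ) ≤ 4 * (1/10000) ^ k / k.factorial := by positivity
    calc _ ≤ (4 * (1/10000 : ℝ) ^ k / k.factorial) * 2 := by gcongr
      _ = _ := by ring
  · have h5 : D (j + k) ^ 2 ≤ 4 * (1/10000) ^ (j + k) := by
      rw [← sq_abs]
      calc |D (j+k)| ^ 2 ≤ (2 * (1/100) ^ (j+k)) ^ 2 := by gcongr; exact hD _
        _ = _ := by rw [mul_pow, ← pow_mul, mul_comm (j+k) 2, pow_mul]; norm_num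
    have h6 : (k.factorial : ℝ) ≤ (j + k).factorial := by
      exact_mod_cast Nat.factorial_le (by omega)
    have h7 : (0:ℝ) < k.factorial := by exact_mod_cast k.factorial_pos
    calc D (j + k) ^ 2 / (j+k).factorial ≤ 4 * (1/10000) ^ (j + k) / k.factorial := by gcongr
      _ = _ := by rw [pow_add]; ring

/-- even and odd roundings -/
def ev (b : ℕ) : ℕ := 2 * ((b + 1) / 2)
/-- odd rounding -/
def od (b : ℕ) : ℕ := 2 * (b / 2) + 1
/-- support points -/
def vv (k : ℕ) (j : ℕ) : ℝ := (2 * (j : ℝ) / k - 1) / 100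

theorem vv_bd {k j : ℕ} (hk : 0 < k) (hj : j ≤ k) : |vv k j| ≤ 1 / 100 := by
  have h1 : (0:ℝ) < k := by exact_mod_cast hk
  have h2 : (j : ℝ) ≤ k := by exact_mod_cast hj
  have h3 : (j : ℝ) / k ≤ 1 := by rw [div_le_one h1]; exact h2
  have h4 : 0 ≤ (j : ℝ) / k := by positivity
  unfold vv
  rw [mul_div_assoc, abs_le]
  constructor <;> linarith

theorem vv_mono (k : ℕ) : Monotone (vv k) := by
  intro i j h
  unfold vv
  have : (i : ℝ) ≤ j := by exact_mod_cast h
  gcongr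

theorem ev_mono : Monotone ev := by intro a b h; unfold ev; omega
theorem od_mono : Monotone od := by intro a b h; unfold od; omega

/-- difference of the odd and even values -/
theorem od_sub_ev (w : ℕ → ℝ) (b : ℕ) : w (od b) - w (ev b) = (-1) ^ b * (w (b+1) - w b) := by
  rcases Nat.even_or_odd b with h | h
  · have h1 : od b = b + 1 := by unfold od; have := h.two_dvd; omega
    have h2 : ev b = b := by unfold ev; have := h.two_dvd; omega
    rw [h1, h2, h.neg_one_pow]; ring
  · obtain ⟨c, rfl⟩ := h
    have h1 : od (2*c+1) = 2*c+1 := by unfold od; omega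
    have h2 : ev (2*c+1) = 2*c+1+1 := by unfold ev; omega
    rw [h1, h2, Odd.neg_one_pow ⟨c, rfl⟩]; ring

theorem od_add_ev (w : ℕ → ℝ) (b : ℕ) : w (od b) + w (ev b) = w (b+1) + w b := by
  rcases Nat.even_or_odd b with h | h
  · have h1 : od b = b + 1 := by unfold od; have := h.two_dvd; omega
    have h2 : ev b = b := by unfold ev; have := h.two_dvd; omega
    rw [h1, h2]
  · obtain ⟨c, rfl⟩ := h
    have h1 : od (2*c+1) = 2*c+1 := by unfold od; omega
    have h2 : ev (2*c+1) = 2*c+1+1 := by unfold ev; omega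
    rw [h1, h2]; ring

/-- binomial weights -/
def pw (K b : ℕ) : ℝ := (K.choose b : ℝ) / 2 ^ K

theorem pw_sum (K : ℕ) : ∑ b ∈ Finset.range (K+1), pw K b = 1 := by
  unfold pw
  rw [← Finset.sum_div, ← Nat.cast_sum, Nat.sum_range_choose]
  simp

theorem pw_mean (K : ℕ) : ∑ b ∈ Finset.range (K+1), pw K b * b = K / 2 := by
  unfold pw
  have h := congrArg (Nat.cast (R := ℝ)) (Nat.sum_range_mul_choose K)
  push_cast at h
  have h1 : ∀ b ∈ Finset.range (K+1), (K.choose b : ℝ) / 2 ^ K * b = (b * K.choose b) / 2 ^ K :=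
    fun b _ => by ring
  rw [Finset.sum_congr rfl h1, ← Finset.sum_div, h]
  cases K with
  | zero => simp
  | succ K => simp only [Nat.add_sub_cancel]; rw [pow_succ]; field_simp

theorem moment_zero (K l : ℕ) (hl : l < K + 1) : ∑ b ∈ Finset.range (K+1),
    pw K b * ((vv (K+1) (od b)) ^ l - (vv (K+1) (ev b)) ^ l) = 0 := by
  let P : Polynomial ℝ := (Polynomial.C (2 / ((K+1 : ℕ) : ℝ) / 100) * Polynomial.X
    - Polynomial.C (1/100)) ^ l
  have hev : ∀ j : ℕ, P.eval (j : ℝ) = vv (K+1) j ^ l := by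
    intro j
    simp only [P, Polynomial.eval_pow, Polynomial.eval_sub, Polynomial.eval_mul,
      Polynomial.eval_C, Polynomial.eval_X, vv]
    congr 1; ring
  have hdeg : P.natDegree < K + 1 := by
    have h1 : (Polynomial.C (2 / ((K+1 : ℕ) : ℝ) / 100) * Polynomial.X
      - Polynomial.C (1/100)).natDegree ≤ 1 := by
      compute_degree
    have h2 := Polynomial.natDegree_pow_le_of_le l h1
    show ((Polynomial.C (2 / ((K+1 : ℕ) : ℝ) / 100) * Polynomial.X
    - Polynomial.C (1/100)) ^ l).natDegree < _
    omega
  have hz := congrFun (Polynomial.fwdDiff_iter_eq_zero_of_degree_lt hdeg) 0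
  rw [Function.iterate_succ_apply, fwdDiff_iter_eq_sum_shift] at hz
  have h2 : ∀ b ∈ Finset.range (K+1),
      pw K b * ((vv (K+1) (od b)) ^ l - (vv (K+1) (ev b)) ^ l)
      = ((-1) ^ K / 2 ^ K) * (((-1 : ℤ) ^ (K - b) * K.choose b) •
        (fwdDiff 1 P.eval) (0 + b • 1)) := by
    intro b hb
    have hb' := Finset.mem_range.1 hb
    rw [od_sub_ev (fun j => vv (K+1) j ^ l)]
    have h3 : (fwdDiff 1 P.eval) (0 + b • 1) = vv (K+1) (b+1) ^ l - vv (K+1) b ^ l := by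
      rw [fwdDiff, ← hev, ← hev]; simp
    rw [h3, zsmul_eq_mul]
    push_cast
    have h4 : (-1 : ℝ) ^ b = (-1) ^ K * (-1) ^ (K - b) := by
      obtain ⟨c, rfl⟩ := Nat.exists_eq_add_of_le (show b ≤ K by omega)
      rw [Nat.add_sub_cancel_left, pow_add, mul_assoc, ← pow_add, ← two_mul c, pow_mul]; simp
    rw [h4, pw]; ring
  rw [Finset.sum_congr rfl h2, ← Finset.mul_sum, hz]
  simp

theorem moment_bd (K l : ℕ) : |∑ b ∈ Finset.range (K+1),
    pw K b * ((vv (K+1) (od b)) ^ l - (vv (K+1) (ev b)) ^ l)| ≤ 2 * (1/100) ^ l := by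
  refine (Finset.abs_sum_le_sum_abs _ _).trans ?_
  calc _ ≤ ∑ b ∈ Finset.range (K+1), pw K b * (2 * (1/100) ^ l) := by
        refine Finset.sum_le_sum fun b hb => ?_
        have hb' := Finset.mem_range.1 hb
        have hp : 0 ≤ pw K b := by unfold pw; positivity
        rw [abs_mul, abs_of_nonneg hp]
        gcongr
        have h1 := vv_bd (k := K+1) (j := od b) (by omega) (by unfold od; omega)
        have h2 := vv_bd (k := K+1) (j := ev b) (by omega) (by unfold ev; omega)
        have h3 : |vv (K+1) (od b)| ^ l ≤ (1/100) ^ l := by gcongr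
        have h4 : |vv (K+1) (ev b)| ^ l ≤ (1/100) ^ l := by gcongr
        refine (abs_sub _ _).trans ?_
        rw [abs_pow, abs_pow]; linarith
    _ = _ := by rw [← Finset.sum_mul, pw_sum, one_mul]

theorem step_LCRR {B : ℝ → ℕ} (hB : Monotone B)
    (hl : ∀ x, ∀ᶠ y in nhdsWithin x (Iio x), B y = B x)
    (hr : ∀ x, ∃ L, ∀ᶠ y in nhdsWithin x (Ioi x), B y = L) {w : ℕ → ℝ} (hw : Monotone w) :
    (fun x => w (B x)) ∈ LCRR := by
  refine ⟨(hw.comp hB).monotoneOn _, fun x _ => ?_, fun x _ => ?_⟩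
  · refine tendsto_const_nhds.congr' ?_
    filter_upwards [hl x] with y hy
    rw [hy]
  · obtain ⟨L, hL⟩ := hr x
    refine ⟨w L, tendsto_const_nhds.congr' ?_⟩
    filter_upwards [hL] with y hy
    rw [hy]

theorem construct (μX : Measure ℝ) [IsProbabilityMeasure μX] (hc : ∀ x : ℝ, μX {x} = 0)
    (K : ℕ) (hK : 1 ≤ K) : ∃ m0 m1 : ℝ → ℝ, Adm m0 ∧ Adm m1 ∧
      (∀ σ : ℝ, 0 < σ → (fun x => σ * m0 x) ∈ LCRR) ∧
      (∀ σ : ℝ, 0 < σ → (fun x => σ * m1 x) ∈ LCRR) ∧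
      ∫ x, m0 x ∂μX = 0 ∧
      ∫ y, (FF μX m1 y - FF μX m0 y) ^ 2 ∂(gaussianReal 0 1)
        ≤ 8 * (1/10000) ^ (K+1) / (K+1).factorial ∧
      ∀ x, 2 / ((K+1 : ℕ) : ℝ) / 100 ≤ |m0 x - m1 x| := by
  obtain ⟨B, hB, hBK, hl, hr, hI⟩ := exists_B μX hc K (pw K)
    (fun i hi => by
      unfold pw
      have : 0 < K.choose i := Nat.choose_pos hi
      positivity) (pw_sum K)
  have hBm : Measurable B := hB.measurable
  have hwm : ∀ w : ℕ → ℝ, Measurable (fun x => w (B x)) := fun w =>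
    (measurable_from_top (f := w)).comp hBm
  refine ⟨fun x => vv (K+1) (ev (B x)), fun x => vv (K+1) (od (B x)),
    ⟨hwm (fun b => vv (K+1) (ev b)), fun x => vv_bd (by omega) ?_⟩,
    ⟨hwm (fun b => vv (K+1) (od b)), fun x => vv_bd (by omega) ?_⟩, ?_, ?_, ?_, ?_, ?_⟩
  · have := hBK x; unfold ev; omega
  · have := hBK x; unfold od; omega
  · intro σ hσ
    exact step_LCRR hB hl hr (w := fun b => σ * vv (K+1) (ev b))
      (((vv_mono _).comp ev_mono).const_mul hσ.le)
  · intro σ hσ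
    exact step_LCRR hB hl hr (w := fun b => σ * vv (K+1) (od b))
      (((vv_mono _).comp od_mono).const_mul hσ.le)
  · rw [hI fun b => vv (K+1) (ev b)]
    have h1 := moment_zero K 1 (by omega)
    simp only [pow_one, mul_sub] at h1
    rw [Finset.sum_sub_distrib] at h1
    have h2 : ∑ b ∈ Finset.range (K+1), pw K b * vv (K+1) (od b)
        + ∑ b ∈ Finset.range (K+1), pw K b * vv (K+1) (ev b) = 0 := by
      rw [← Finset.sum_add_distrib]
      have h3 : ∀ b ∈ Finset.range (K+1), pw K b * vv (K+1) (od b) + pw K b * vv (K+1) (ev b)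
          = (4 / ((K+1 : ℕ) : ℝ) / 100) * (pw K b * b)
            + (2 / ((K+1 : ℕ) : ℝ) / 100 - 2 / 100) * pw K b := by
        intro b _
        rw [← mul_add, od_add_ev, vv, vv]
        push_cast
        ring
      rw [Finset.sum_congr rfl h3, Finset.sum_add_distrib, ← Finset.mul_sum, ← Finset.mul_sum,
        pw_sum, pw_mean]
      push_cast
      field_simp
      ring
    linarith
  · have hF : ∀ y, FF μX (fun x => vv (K+1) (od (B x))) y - FF μX (fun x => vv (K+1) (ev (B x))) y
        = ∑ i ∈ Finset.range (K+1) ×ˢ (Finset.univ : Finset Bool),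
          (if i.2 then pw K i.1 else - pw K i.1) *
            fg (if i.2 then vv (K+1) (od i.1) else vv (K+1) (ev i.1)) y := by
      intro y
      unfold FF
      rw [hI fun b => fg (vv (K+1) (od b)) y, hI fun b => fg (vv (K+1) (ev b)) y,
        Finset.sum_product, ← Finset.sum_sub_distrib]
      refine Finset.sum_congr rfl fun b _ => ?_
      rw [Fintype.sum_bool]
      simp
      ring
    simp_rw [hF]
    have hs := mix_sq (Finset.range (K+1) ×ˢ (Finset.univ : Finset Bool))
      (fun i => if i.2 then pw K i.1 else - pw K i.1)
      (fun i => if i.2 then vv (K+1) (od i.1) else vv (K+1) (ev i.1))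
    have hD : ∀ l : ℕ, ∑ i ∈ Finset.range (K+1) ×ˢ (Finset.univ : Finset Bool),
          (if i.2 then pw K i.1 else - pw K i.1) *
            (if i.2 then vv (K+1) (od i.1) else vv (K+1) (ev i.1)) ^ l
        = ∑ b ∈ Finset.range (K+1),
    pw K b * ((vv (K+1) (od b)) ^ l - (vv (K+1) (ev b)) ^ l) := by
      intro l
      rw [Finset.sum_product]
      refine Finset.sum_congr rfl fun b _ => ?_
      rw [Fintype.sum_bool]
      simp
      ring
    simp_rw [hD] at hs
    exact tail_bound (K+1) hs (fun l hl => moment_zero K l hl) (fun l => moment_bd K l)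
  · intro x
    simp only
    rw [abs_sub_comm, od_sub_ev (fun j => vv (K+1) j), abs_mul, abs_pow, abs_neg, abs_one, one_pow,
      one_mul]
    have : vv (K+1) (B x + 1) - vv (K+1) (B x) = 2 / ((K+1 : ℕ) : ℝ) / 100 := by
      unfold vv; push_cast; ring
    rw [this]
    exact le_abs_self _

theorem choose_k {n : ℕ} (hn : 16 ≤ n) : ∃ K : ℕ, 1 ≤ K ∧ 0 < Real.log n ∧
    0 ≤ Real.log (Real.log n) ∧
    ((K+1 : ℕ) : ℝ) * Real.sqrt (Real.log (Real.log n)) ≤ 3 * Real.log n ∧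
    (n : ℝ) * (8 * (1/10000) ^ (K+1) / (K+1).factorial) ≤ 4 / 1000 := by
  have hn' : (16 : ℝ) ≤ n := by exact_mod_cast hn
  set L := Real.log n with hL
  have hL1 : 2.77 ≤ L := by
    have h1 : Real.log 16 ≤ L := Real.log_le_log (by norm_num) hn'
    have h2 : Real.log 16 = 4 * Real.log 2 := by
      rw [show (16:ℝ) = 2 ^ 4 by norm_num, Real.log_pow]; norm_num
    have := Real.log_two_gt_d9
    linarith
  have hLL : 1 ≤ Real.log L := by
    rw [Real.le_log_iff_exp_le (by linarith)]
    have := Real.exp_one_lt_d9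
    linarith
  set s := Real.sqrt (Real.log L) with hs
  have hs1 : 1 ≤ s := by rw [hs]; exact Real.one_le_sqrt.2 hLL
  have hs2 : s ^ 2 = Real.log L := Real.sq_sqrt (by linarith)
  have hlogle : Real.log L ≤ L - 1 := Real.log_le_sub_one_of_pos (by linarith)
  have hsL : s ≤ Real.sqrt L := Real.sqrt_le_sqrt (by linarith)
  have hrL : Real.sqrt L ^ 2 = L := Real.sq_sqrt (by linarith)
  have hr0 : 0 < Real.sqrt L := Real.sqrt_pos.2 (by linarith)
  have hLs : Real.sqrt L ≤ L / s := by
    rw [le_div_iff₀ (by linarith)]; nlinarith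
  have hLs1 : 1 < L / s := by
    refine lt_of_lt_of_le ?_ hLs
    rw [Real.lt_sqrt (by norm_num)]; linarith
  set k := ⌈2 * (L / s)⌉₊ with hk
  have hk1 : 2 * (L / s) ≤ k := by
    exact Nat.le_ceil (2 * (L / s))
  have hk2 : (k : ℝ) < 2 * (L / s) + 1 := by
    exact Nat.ceil_lt_add_one (a := 2 * (L / s)) (by positivity)
  have hk3 : 2 < k := by
    have : (2 : ℝ) < k := by linarith
    exact_mod_cast this
  have hkK : k - 1 + 1 = k := by omega
  refine ⟨k - 1, by omega, by linarith, by linarith, ?_, ?_⟩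
  · rw [hkK]
    have h1 : (k : ℝ) ≤ 3 * (L / s) := by linarith
    calc (k : ℝ) * s ≤ 3 * (L / s) * s := by gcongr
      _ = 3 * L := by field_simp
  · rw [hkK]
    have hkpos : (0:ℝ) < k := by linarith
    have hlogk : s / 2 ≤ Real.log k := by
      have h1 : Real.log (Real.sqrt L) ≤ Real.log k := Real.log_le_log hr0 (by linarith)
      rw [Real.log_sqrt (by linarith)] at h1
      nlinarith
    have h2 : L ≤ k * Real.log k := by
      calc L = 2 * (L / s) * (s / 2) := by field_simp
        _ ≤ k * Real.log k := by gcongr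
    have h3 : (n : ℝ) ≤ (k : ℝ) ^ k := by
      rw [← Real.log_pow] at h2
      exact (Real.log_le_log_iff (by linarith) (by positivity)).1 h2
    have h4 : (k : ℝ) ^ k ≤ k.factorial * 3 ^ k := by
      have h5 := Real.pow_div_factorial_le_exp (x := (k:ℝ)) hkpos.le k
      have h6 : (0:ℝ) < k.factorial := by exact_mod_cast k.factorial_pos
      rw [div_le_iff₀ h6] at h5
      refine h5.trans ?_
      rw [mul_comm]
      gcongr
      rw [← Real.exp_one_pow]
      have := Real.exp_one_lt_d9
      gcongr
      linarith
    have h6 : (0:ℝ) < k.factorial := by exact_mod_cast k.factorial_pos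
    calc (n : ℝ) * (8 * (1/10000) ^ k / k.factorial)
        ≤ (k.factorial * 3 ^ k) * (8 * (1/10000) ^ k / k.factorial) := by
          gcongr; exact h3.trans h4
      _ = 8 * (3/10000) ^ k := by
          rw [show (3/10000 : ℝ) = 3 * (1/10000) by norm_num, mul_pow]; field_simp
      _ ≤ 8 * (3/10000) ^ 1 := by
          have := pow_le_pow_of_le_one (a := (3/10000:ℝ)) (by norm_num) (by norm_num)
            (show 1 ≤ k by omega)
          linarith
      _ ≤ _ := by norm_num

theorem mem_MM {μX : Measure ℝ} [IsProbabilityMeasure μX] {M a A σ : ℝ} (ha : 0 < a)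
    (hσ : 0 < σ) (hA : σ ≤ A) (hM : (A / 100) ^ (a + 2) ≤ M) {m : ℝ → ℝ} (hm : Adm m)
    (hl : (fun x => σ * m x) ∈ LCRR) : (fun x => σ * m x) ∈ MM μX M a := by
  refine ⟨hl, ?_⟩
  calc ∫⁻ x, ENNReal.ofReal (|σ * m x| ^ (a + 2)) ∂μX ≤ ∫⁻ x, ENNReal.ofReal M ∂μX := by
        refine lintegral_mono fun x => ENNReal.ofReal_le_ofReal (le_trans ?_ hM)
        have h1 : |σ * m x| ≤ A / 100 := by
          rw [abs_mul, abs_of_pos hσ]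
          calc σ * |m x| ≤ A * (1/100) := by
                have := hm.bd x
                gcongr
                exact hσ.le.trans hA
            _ = _ := by ring
        exact Real.rpow_le_rpow (abs_nonneg _) h1 (by linarith)
    _ = _ := by simp

/-- **Minimax lower bound for shuffled regression with Gaussian noise** (Theorem 4.3).
With standard Gaussian errors and a continuous covariate distribution, for every
`a > 0` and all sufficiently large `M`, there are constants `c, C > 0` such that for
all `n ≥ 16` with `σ_n ≥ C n^{-1/2} (log n) (log log n)^{-1/2}`, every monotone LCRR
estimator has maximal population risk over `m ∈ M(M,a)` at least
`c σ_n (log log n)^{1/2} / log n`. -/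
theorem shuffled_gaussian_minimax_lower_bound
    (σ : ℕ → ℝ) (A : ℝ) (hσpos : ∀ n, 0 < σ n) (hσbdd : ∀ n, σ n ≤ A)
    (μX : Measure ℝ) (hXprob : IsProbabilityMeasure μX)
    (hXsupp : μX (Icc 0 1) = 1) (hXcont : ∀ x : ℝ, μX {x} = 0)
    (a : ℝ) (ha : 0 < a) :
    ∃ M₀ : ℝ, ∀ M ≥ M₀, ∃ c > 0, ∃ C > 0, ∀ n : ℕ, n ≥ 16 →
      C * (n : ℝ) ^ (-(1 : ℝ) / 2) * Real.log n *
          Real.log (Real.log n) ^ (-(1 : ℝ) / 2) ≤ σ n →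
      ∀ mhat : ((Fin n → ℝ) × (Fin n → ℝ)) → ℝ → ℝ,
        (∀ d, mhat d ∈ LCRR) →
        Measurable (fun p : ((Fin n → ℝ) × (Fin n → ℝ)) × ℝ => mhat p.1 p.2) →
        ENNReal.ofReal
            (c * σ n * Real.log (Real.log n) ^ ((1 : ℝ) / 2) / Real.log n) ≤
          ⨆ m ∈ MM μX M a,
            popRisk μX (shuffledLaw μX (gaussianReal 0 1) (σ n) m n) mhat m := by
  refine ⟨(A / 100) ^ (a + 2), fun M hM => ⟨1 / 1200, by norm_num, 1, one_pos, ?_⟩⟩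
  intro n hn _ mhat _ hmh
  obtain ⟨K, hK, hL, hLL, hk, hnε⟩ := choose_k hn
  obtain ⟨m0, m1, h0, h1, hl0, hl1, hmean, hε, hδ⟩ := construct μX hXcont K hK
  have hσ := hσpos n
  have key := two_point (by omega) μX (σ n) hσ h0 h1 hmean (by positivity) hε hnε hδ mhat hmh
  have M0 := mem_MM (μX := μX) ha hσ (hσbdd n) hM h0 (hl0 _ hσ)
  have M1 := mem_MM (μX := μX) ha hσ (hσbdd n) hM h1 (hl1 _ hσ)
  set S := ⨆ m ∈ MM μX M a,
            popRisk μX (shuffledLaw μX (gaussianReal 0 1) (σ n) m n) mhat m with hS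
  have s0 : popRisk μX (shuffledLaw μX (gaussianReal 0 1) (σ n) (fun x => σ n * m0 x) n) mhat
        (fun x => σ n * m0 x) ≤ S := le_iSup₂_of_le _ M0 le_rfl
  have s1 : popRisk μX (shuffledLaw μX (gaussianReal 0 1) (σ n) (fun x => σ n * m1 x) n) mhat
        (fun x => σ n * m1 x) ≤ S := le_iSup₂_of_le _ M1 le_rfl
  have h2 := key.trans (add_le_add s0 s1)
  rw [← two_mul, ← ENNReal.ofReal_mul (by positivity)] at h2
  have hkpos : (0:ℝ) < ((K+1 : ℕ) : ℝ) := by positivity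
  have h3 : 1 / 1200 * σ n * Real.log (Real.log n) ^ ((1 : ℝ) / 2) / Real.log n
      ≤ (σ n * (2 / ((K+1 : ℕ) : ℝ) / 100) * (1/4)) / 2 := by
    rw [← Real.sqrt_eq_rpow]
    rw [div_le_iff₀ hL]
    have e : σ n * (2 / ((K+1 : ℕ) : ℝ) / 100) * (1/4) / 2 * Real.log n
      = σ n * (1/1200) * (3 * Real.log n / ((K+1 : ℕ) : ℝ)) := by
      field_simp; ring
    have h4 : Real.sqrt (Real.log (Real.log n)) ≤ 3 * Real.log n / ((K+1 : ℕ) : ℝ) := by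
      rw [le_div_iff₀ hkpos]; linarith
    rw [e]
    calc _ = σ n * (1/1200) * Real.sqrt (Real.log (Real.log n)) := by ring
      _ ≤ _ := by gcongr
  refine (ENNReal.ofReal_le_ofReal h3).trans ?_
  rw [ENNReal.ofReal_div_of_pos (by norm_num)]
  refine ENNReal.div_le_of_le_mul ?_
  rw [ENNReal.ofReal_ofNat, mul_comm S]
  exact h2
end
end

section
/- Let μ_X be a continuous (atomless) probability distribution on [0,1] and let μ̂_X be the empirical distribution of an i.i.d. n-sample X₁,…,X_n from μ_X. Then for all positive a and M there exists C > 0 such that for every n ≥ 1 and every fixed m ∈ M(M,a): E[ sup over f ∈ M(M,a) of | ∫ |f − m| dμ_X − (1/n)·Σ_{i=1}^n |f(X_i) − m(X_i)| | ] ≤ C·n^{−1/2}. -/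
open MeasureTheory Filter Set
open scoped ENNReal NNReal Classical

noncomputable section

namespace EDB

lemma orth {α : Type*} [MeasurableSpace α] (P : Measure α) [IsProbabilityMeasure P] {n : ℕ}
    (i : Fin n) (V : Set α) (y : α) (hy : y ∉ V) (b : (Fin n → α) → ℝ)
    (hb : ∀ X z, X i ∉ V → z ∉ V → b (Function.update X i z) = b X)
    (h : α → ℝ) (hV : ∀ x ∈ V, h x = 0) (h0 : ∫ x, h x ∂P = 0) :
    ∫ X, b X * h (X i) ∂(Measure.pi fun _ : Fin n => P) = 0 := by
  cases n with
  | zero => exact i.elim0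
  | succ n =>
    have e : ∀ X : Fin (n+1) → α, b X * h (X i)
        = (fun p : α × (Fin n → α) => h p.1 * b (i.insertNth y p.2))
          (MeasurableEquiv.piFinSuccAbove (fun _ => α) i X) := by
      intro X
      simp only [MeasurableEquiv.piFinSuccAbove_apply, Fin.insertNthEquiv_symm_apply]
      by_cases hX : X i ∈ V
      · simp [hV _ hX]
      · rw [mul_comm, ← hb X y hX hy]
        congr 2
        rw [Fin.insertNth_removeNth]
    simp_rw [e]
    have mp := measurePreserving_piFinSuccAbove (fun _ : Fin (n+1) => P) i
    rw [mp.integral_comp' (g := (fun p : α × (Fin n → α) => h p.1 * b (i.insertNth y p.2)))]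
    rw [integral_prod_mul (fun x => h x) (fun p : Fin n → α => b (i.insertNth y p)), h0, zero_mul]

/-- normalised centred indicator -/
def hh {α : Type*} [MeasurableSpace α] (P : Measure α) (V : Set α) (x : α) : ℝ :=
  (V.indicator 1 x - P.real V) / (1 - P.real V)

/-- martingale -/
def MG {α : Type*} [MeasurableSpace α] (P : Measure α) (V : Set α) {n : ℕ} (X : Fin n → α) : ℝ :=
  ∑ i, hh P V (X i)

lemma hh_meas {α : Type*} [MeasurableSpace α] (P : Measure α) {V : Set α} (hV : MeasurableSet V) :
    Measurable (hh P V) := by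
  unfold hh
  exact ((measurable_one.indicator hV).sub_const _).div_const _

lemma hh_bdd {α : Type*} [MeasurableSpace α] (P : Measure α) [IsProbabilityMeasure P] {V : Set α}
    (h : P.real V ≤ 1/2) (x : α) : |hh P V x| ≤ 2 := by
  unfold hh
  have h0 : 0 ≤ P.real V := measureReal_nonneg
  rw [abs_div, abs_of_pos (by linarith : 0 < 1 - P.real V), div_le_iff₀ (by linarith)]
  by_cases hx : x ∈ V
  · simp only [indicator_of_mem hx, Pi.one_apply]; rw [abs_le]; constructor <;> linarith
  · simp only [indicator_of_notMem hx]; rw [abs_le]; constructor <;> linarith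

lemma hh_integrable {α : Type*} [MeasurableSpace α] (P : Measure α) [IsProbabilityMeasure P]
    {V : Set α} (hV : MeasurableSet V) (h : P.real V ≤ 1/2) : Integrable (hh P V) P :=
  Integrable.of_bound (hh_meas P hV).aestronglyMeasurable 2
    (Eventually.of_forall fun x => hh_bdd P h x)

lemma hh_int {α : Type*} [MeasurableSpace α] (P : Measure α) [IsProbabilityMeasure P] {V : Set α}
    (hV : MeasurableSet V) : ∫ x, hh P V x ∂P = 0 := by
  unfold hh
  rw [integral_div, integral_sub, integral_indicator_one hV]
  · simp
  · exact (integrable_const (1:ℝ)).indicator hV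
  · exact integrable_const _

lemma hh_sq_int {α : Type*} [MeasurableSpace α] (P : Measure α) [IsProbabilityMeasure P] {V : Set α}
    (hV : MeasurableSet V) (h : P.real V ≤ 1/2) : ∫ x, hh P V x ^ 2 ∂P ≤ 2 * P.real V := by
  have h0 : 0 ≤ P.real V := measureReal_nonneg
  have e : ∀ x, hh P V x ^ 2 =
      (V.indicator 1 x * (1 - 2 * P.real V) + P.real V ^ 2) / (1 - P.real V) ^ 2 := by
    intro x
    unfold hh
    rw [div_pow]
    congr 1
    by_cases hx : x ∈ V
    · simp only [indicator_of_mem hx, Pi.one_apply]; ring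
    · simp only [indicator_of_notMem hx]; ring
  simp_rw [e]
  rw [integral_div, integral_add, integral_mul_const, integral_indicator_one hV]
  · simp only [integral_const, probReal_univ, one_smul]
    rw [div_le_iff₀ (by nlinarith)]
    nlinarith [mul_nonneg h0 (by linarith : 0 ≤ 1 - P.real V), mul_nonneg (mul_nonneg h0 (by linarith : 0 ≤ 1 - P.real V)) (by linarith : 0 ≤ 1/2 - P.real V)]
  · exact ((integrable_const (1:ℝ)).indicator hV).mul_const _
  · exact integrable_const _

lemma MG_meas {α : Type*} [MeasurableSpace α] (P : Measure α) {V : Set α} (hV : MeasurableSet V)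
    (n : ℕ) : Measurable (MG P V : (Fin n → α) → ℝ) := by
  unfold MG
  exact Finset.measurable_sum _ fun i _ => (hh_meas P hV).comp (measurable_pi_apply i)

lemma MG_bdd {α : Type*} [MeasurableSpace α] (P : Measure α) [IsProbabilityMeasure P] {V : Set α}
    (h : P.real V ≤ 1/2) {n : ℕ} (X : Fin n → α) : |MG P V X| ≤ 2 * n := by
  unfold MG
  refine (Finset.abs_sum_le_sum_abs _ _).trans ?_
  refine (Finset.sum_le_sum fun i _ => hh_bdd P h (X i)).trans ?_
  simp [mul_comm]

lemma MG_sq {α : Type*} [MeasurableSpace α] (P : Measure α) [IsProbabilityMeasure P] {V : Set α}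
    (hV : MeasurableSet V) (h : P.real V ≤ 1/2) (n : ℕ) :
    ∫ X : Fin n → α, MG P V X ^ 2 ∂(Measure.pi fun _ => P) ≤ 2 * n * P.real V := by
  have key := ProbabilityTheory.variance_sum_pi (μ := fun _ : Fin n => P)
    (X := fun _ => hh P V) (fun i => by
      exact MemLp.of_bound (hh_meas P hV).aestronglyMeasurable 2
        (Eventually.of_forall fun x => hh_bdd P h x))
  rw [ProbabilityTheory.variance_of_integral_eq_zero, ] at key
  rotate_left
  · have := MG_meas P hV n
    unfold MG at this
    convert this.aemeasurable using 1
    ext X; simp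
  · simp only [Finset.sum_apply]
    rw [integral_finsetSum]
    · refine Finset.sum_eq_zero fun i _ => ?_
      have := orth P i ∅ (nonempty_of_isProbabilityMeasure P).some (by simp) (fun _ => 1) (by simp) 
        (hh P V) (by simp) (hh_int P hV)
      simpa using this
    · intro i _
      exact Integrable.of_bound ((hh_meas P hV).comp (measurable_pi_apply i)).aestronglyMeasurable 2
        (Eventually.of_forall fun x => hh_bdd P h _)
  have e2 : ProbabilityTheory.variance (hh P V) P = ∫ x, hh P V x ^ 2 ∂P :=
    ProbabilityTheory.variance_of_integral_eq_zero (hh_meas P hV).aemeasurable (hh_int P hV)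
  simp only [e2, Finset.sum_apply, Finset.sum_const, Finset.card_univ, Fintype.card_fin, nsmul_eq_mul] at key
  unfold MG
  rw [key]
  have := hh_sq_int P hV h
  have hn : (0:ℝ) ≤ n := Nat.cast_nonneg n
  nlinarith

end EDB

namespace EDB

lemma MG_diff_int {α : Type*} [MeasurableSpace α] (P : Measure α) [IsProbabilityMeasure P]
    {V W : Set α} (hV : MeasurableSet V) (hW : MeasurableSet W) (hVW : V ⊆ W)
    (h : P.real V ≤ 1/2) (h' : P.real W ≤ 1/2) {n : ℕ}
    (b : (Fin n → α) → ℝ) (bm : Measurable b) (B : ℝ) (bB : ∀ X, |b X| ≤ B)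
    (hb : ∀ i X z, X i ∉ V → z ∉ V → b (Function.update X i z) = b X) :
    ∫ X, b X * (MG P W X - MG P V X) ∂(Measure.pi fun _ : Fin n => P) = 0 := by
  have hy : ∃ y, y ∉ V := by
    by_contra! hc
    have : V = univ := eq_univ_of_forall hc
    rw [this] at h
    simp at h
    norm_num at h
  obtain ⟨y, hy⟩ := hy
  have e : ∀ X : Fin n → α, b X * (MG P W X - MG P V X)
      = ∑ i, b X * ((hh P W - hh P V) (X i)) := by
    intro X
    unfold MG
    rw [← Finset.sum_sub_distrib, Finset.mul_sum]
    rfl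
  simp_rw [e]
  rw [integral_finsetSum]
  · refine Finset.sum_eq_zero fun i _ => ?_
    refine orth P i V y hy b (hb i) _ ?_ ?_
    · intro x hx
      have h0 : 0 ≤ P.real V := measureReal_nonneg
      have h1 : 0 ≤ P.real W := measureReal_nonneg
      simp only [Pi.sub_apply, hh, indicator_of_mem hx, indicator_of_mem (hVW hx), Pi.one_apply]
      rw [div_self (by linarith), div_self (by linarith), sub_self]
    · simp only [Pi.sub_apply]
      rw [integral_sub (hh_integrable P hW h') (hh_integrable P hV h), hh_int P hW, hh_int P hV,
        sub_zero]
  · intro i _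
    refine Integrable.of_bound (C := B * (2 + 2)) ?_ (Eventually.of_forall fun X => ?_)
    · exact (bm.mul (((hh_meas P hW).sub (hh_meas P hV)).comp
        (measurable_pi_apply i))).aestronglyMeasurable
    · rw [Real.norm_eq_abs, abs_mul]
      refine mul_le_mul (bB X) ((abs_sub _ _).trans
        (add_le_add (hh_bdd P h' _) (hh_bdd P h _))) (abs_nonneg _) ((abs_nonneg _).trans (bB X))

lemma maxi {α ι : Type*} [MeasurableSpace α] [LinearOrder ι] (P : Measure α)
    [IsProbabilityMeasure P] (V : ι → Set α) (hm : Monotone V) (hV : ∀ k, MeasurableSet (V k))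
    (h : ∀ k, P.real (V k) ≤ 1/2) (n : ℕ) (σ : ℝ) (F : Finset ι) :
    ∃ b : (Fin n → α) → ℝ, Measurable b ∧ (∃ B, ∀ X, |b X| ≤ B) ∧ (∀ X, 0 ≤ b X) ∧
      (∀ k ∈ F, ∀ X, σ * MG P (V k) X ≤ b X) ∧
      (∀ j, (∀ k ∈ F, k ≤ j) → ∀ i X z, X i ∉ V j → z ∉ V j →
        b (Function.update X i z) = b X) ∧
      (∀ j, (∀ k ∈ F, k ≤ j) →
        ∫ X, (b X ^ 2 - 2 * b X * (σ * MG P (V j) X)) ∂(Measure.pi fun _ : Fin n => P) ≤ 0) := by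
  induction F using Finset.induction_on_max with
  | empty => exact ⟨fun _ => 0, measurable_const, ⟨0, by simp⟩, by simp, by simp, by simp, by simp⟩
  | insert k F hk ih =>
    obtain ⟨b, bm, ⟨B, bB⟩, b0, bF, binv, bint⟩ := ih
    have Mm : ∀ j, Measurable (fun X : Fin n → α => σ * MG P (V j) X) :=
      fun j => (MG_meas P (hV j) n).const_mul σ
    have Mb : ∀ j (X : Fin n → α), |σ * MG P (V j) X| ≤ |σ| * (2 * n) := by
      intro j X
      rw [abs_mul]
      exact mul_le_mul_of_nonneg_left (MG_bdd P (h j) X) (abs_nonneg _)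
    have c0 : ∀ X : Fin n → α, 0 ≤ max (b X) (σ * MG P (V k) X) := fun X => (b0 X).trans (le_max_left _ _)
    have cB : ∀ X : Fin n → α, |max (b X) (σ * MG P (V k) X)| ≤ max B (|σ| * (2 * n)) := by
      intro X
      rw [abs_of_nonneg (c0 X)]
      exact max_le_max ((le_abs_self _).trans (bB X)) ((le_abs_self _).trans (Mb k X))
    have cm : Measurable (fun X : Fin n → α => max (b X) (σ * MG P (V k) X)) := bm.max (Mm k)
    have cinv : ∀ j, k ≤ j → ∀ i (X : Fin n → α) z, X i ∉ V j → z ∉ V j →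
        max (b (Function.update X i z)) (σ * MG P (V k) (Function.update X i z))
          = max (b X) (σ * MG P (V k) X) := by
      intro j hj i X z hX hz
      rw [binv j (fun l hl => (hk l hl).le.trans hj) i X z hX hz]
      congr 2
      unfold MG
      refine Finset.sum_congr rfl fun l _ => ?_
      by_cases hl : l = i
      · subst hl
        simp only [Function.update_self, hh]
        rw [indicator_of_notMem (fun h => hX (hm hj h)), indicator_of_notMem (fun h => hz (hm hj h))]
      · rw [Function.update_of_ne hl]
    have intg : ∀ (g : (Fin n → α) → ℝ) (G : ℝ), Measurable g → (∀ X, |g X| ≤ G) → ∀ j,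
        Integrable (fun X => g X ^ 2 - 2 * g X * (σ * MG P (V j) X))
          (Measure.pi fun _ : Fin n => P) := by
      intro g G gm gG j
      refine Integrable.of_bound (C := G ^ 2 + 2 * G * (|σ| * (2 * n))) ?_
        (Eventually.of_forall fun X => ?_)
      · exact ((gm.pow_const 2).sub ((gm.const_mul 2).mul (Mm j))).aestronglyMeasurable
      · rw [Real.norm_eq_abs]
        refine (abs_sub _ _).trans (add_le_add ?_ ?_)
        · rw [abs_pow]; exact pow_le_pow_left₀ (abs_nonneg _) (gG X) 2
        · rw [abs_mul, abs_mul, abs_two]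
          have hG := (abs_nonneg _).trans (gG X)
          exact mul_le_mul (mul_le_mul_of_nonneg_left (gG X) (by norm_num)) (Mb j X) (abs_nonneg _)
            (by positivity)
    refine ⟨fun X => max (b X) (σ * MG P (V k) X), cm, ⟨_, cB⟩, c0, ?_, ?_, ?_⟩
    · intro l hl X
      rcases Finset.mem_insert.1 hl with rfl | hl
      · exact le_max_right _ _
      · exact (bF l hl X).trans (le_max_left _ _)
    · intro j hj
      exact cinv j (hj k (Finset.mem_insert_self _ _))
    · intro j hj
      have hkj := hj k (Finset.mem_insert_self _ _)
      have z := MG_diff_int P (hV k) (hV j) (hm hkj) (h k) (h j) _ cm _ cB (cinv k le_rfl)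
      have I1 : ∫ X, (max (b X) (σ * MG P (V k) X) ^ 2
            - 2 * max (b X) (σ * MG P (V k) X) * (σ * MG P (V k) X))
            ∂(Measure.pi fun _ : Fin n => P) ≤ 0 := by
        refine le_trans (integral_mono (intg _ _ cm cB k) (intg _ _ bm bB k) fun X => ?_)
          (bint k fun l hl => (hk l hl).le)
        simp only
        rcases le_total (b X) (σ * MG P (V k) X) with hh | hh
        · rw [max_eq_right hh]; nlinarith [sq_nonneg (b X - σ * MG P (V k) X)]
        · rw [max_eq_left hh]
      have e : ∀ X : Fin n → α, (max (b X) (σ * MG P (V k) X) ^ 2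
            - 2 * max (b X) (σ * MG P (V k) X) * (σ * MG P (V j) X))
          = (max (b X) (σ * MG P (V k) X) ^ 2
            - 2 * max (b X) (σ * MG P (V k) X) * (σ * MG P (V k) X))
            - 2 * σ * (max (b X) (σ * MG P (V k) X) * (MG P (V j) X - MG P (V k) X)) := by
        intro X; ring
      simp_rw [e]
      rw [integral_sub (intg _ _ cm cB k), integral_const_mul, z]
      · simpa using I1
      · refine Integrable.const_mul ?_ _
        refine Integrable.of_bound (C := max B (|σ| * (2 * n)) * (2 * n + 2 * n)) ?_
          (Eventually.of_forall fun X => ?_)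
        · exact (cm.mul ((MG_meas P (hV j) n).sub (MG_meas P (hV k) n))).aestronglyMeasurable
        · rw [Real.norm_eq_abs, abs_mul]
          exact mul_le_mul (cB X) ((abs_sub _ _).trans (add_le_add (MG_bdd P (h j) X) (MG_bdd P (h k) X)))
            (abs_nonneg _) ((abs_nonneg _).trans (cB X))

/-- first moment bound for the one-sided maximum -/
lemma maxi_first {α ι : Type*} [MeasurableSpace α] [LinearOrder ι] (P : Measure α)
    [IsProbabilityMeasure P] (V : ι → Set α) (hm : Monotone V) (hV : ∀ k, MeasurableSet (V k))
    (δ : ℝ) (hδ : 0 < δ) (hδ2 : δ ≤ 1 / 2)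
    (h : ∀ k, P.real (V k) ≤ δ) (n : ℕ) (hn : 1 ≤ n) (σ : ℝ) (hσ : σ ^ 2 = 1) (F : Finset ι) :
    ∃ b : (Fin n → α) → ℝ, Measurable b ∧ (∀ X, 0 ≤ b X) ∧
      (∀ k ∈ F, ∀ X, σ * MG P (V k) X ≤ b X) ∧
      ∫⁻ X, ENNReal.ofReal (b X) ∂(Measure.pi fun _ : Fin n => P)
        ≤ ENNReal.ofReal (9 / 2 * Real.sqrt (n * δ)) := by
  rcases F.eq_empty_or_nonempty with rfl | hF
  · exact ⟨fun _ => 0, measurable_const, by simp, by simp, by simp⟩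
  obtain ⟨b, bm, ⟨B, bB⟩, b0, bF, -, bint⟩ := maxi P V hm hV (fun k => (h k).trans hδ2) n σ F
  refine ⟨b, bm, b0, bF, ?_⟩
  set j := F.max' hF
  have hj : ∀ k ∈ F, k ≤ j := fun k hk => F.le_max' k hk
  have hb1 : Integrable b (Measure.pi fun _ : Fin n => P) :=
    Integrable.of_bound bm.aestronglyMeasurable B (Eventually.of_forall bB)
  rw [← ofReal_integral_eq_lintegral_ofReal hb1 (Eventually.of_forall b0)]
  apply ENNReal.ofReal_le_ofReal
  have hn' : (0:ℝ) < n := by exact_mod_cast hn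
  set l := Real.sqrt (n * δ) with hl
  have hl0 : 0 < l := Real.sqrt_pos.2 (by positivity)
  have hl2 : l ^ 2 = n * δ := Real.sq_sqrt (by positivity)
  have i1 : Integrable (fun X => b X ^ 2 - 2 * b X * (σ * MG P (V j) X))
          (Measure.pi fun _ : Fin n => P) := by
    refine Integrable.of_bound (C := B ^ 2 + 2 * B * (|σ| * (2 * n))) ?_
        (Eventually.of_forall fun X => ?_)
    · exact ((bm.pow_const 2).sub ((bm.const_mul 2).mul ((MG_meas P (hV j) n).const_mul σ))).aestronglyMeasurable
    · rw [Real.norm_eq_abs]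
      refine (abs_sub _ _).trans (add_le_add ?_ ?_)
      · rw [abs_pow]; exact pow_le_pow_left₀ (abs_nonneg _) (bB X) 2
      · rw [abs_mul, abs_mul, abs_two, abs_mul]
        have hG := (abs_nonneg _).trans (bB X)
        exact mul_le_mul (mul_le_mul_of_nonneg_left (bB X) (by norm_num))
          (mul_le_mul_of_nonneg_left (MG_bdd P ((h j).trans hδ2) X) (abs_nonneg _)) (by positivity)
          (by positivity)
  have i2 : Integrable (fun X => MG P (V j) X ^ 2) (Measure.pi fun _ : Fin n => P) := by
    refine Integrable.of_bound (C := (2 * n) ^ 2) ?_ (Eventually.of_forall fun X => ?_)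
    · exact ((MG_meas P (hV j) n).pow_const 2).aestronglyMeasurable
    · rw [Real.norm_eq_abs, abs_pow]
      exact pow_le_pow_left₀ (abs_nonneg _) (MG_bdd P ((h j).trans hδ2) X) 2
  have pt : ∀ X, b X ≤ (1 / l) * (b X ^ 2 - 2 * b X * (σ * MG P (V j) X))
      + ((2 / l) * MG P (V j) X ^ 2 + l / 2) := by
    intro X
    have : b X * l ≤ (b X ^ 2 - 2 * b X * (σ * MG P (V j) X)) + 2 * MG P (V j) X ^ 2 + l ^ 2 / 2 := by
      have : MG P (V j) X ^ 2 = (σ * MG P (V j) X) ^ 2 := by rw [mul_pow, hσ, one_mul]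
      rw [this]
      nlinarith [sq_nonneg (b X - l), sq_nonneg (b X - 2 * (σ * MG P (V j) X))]
    have e : (1 / l) * (b X ^ 2 - 2 * b X * (σ * MG P (V j) X))
      + ((2 / l) * MG P (V j) X ^ 2 + l / 2) = ((b X ^ 2 - 2 * b X * (σ * MG P (V j) X)) + 2 * MG P (V j) X ^ 2 + l ^ 2 / 2) / l := by
      field_simp
      ring
    rw [e, le_div_iff₀ hl0]
    exact this
  have i3 : Integrable (fun X => (2 / l) * MG P (V j) X ^ 2 + l / 2)
      (Measure.pi fun _ : Fin n => P) := (i2.const_mul (2 / l)).add (integrable_const (l / 2))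
  have := integral_mono hb1 ((i1.const_mul (1 / l)).add i3) pt
  refine this.trans ?_
  simp only [Pi.add_apply]
  rw [integral_add (i1.const_mul (1 / l)) i3, integral_const_mul]
  rw [integral_add (i2.const_mul (2 / l)) (integrable_const (l / 2)),
    integral_const_mul]
  simp only [integral_const, probReal_univ, one_smul]
  have a1 := bint j hj
  have a2 := MG_sq P (hV j) ((h j).trans hδ2) n
  have a3 : (1 / l) * ∫ X, (b X ^ 2 - 2 * b X * (σ * MG P (V j) X)) ∂(Measure.pi fun _ : Fin n => P) ≤ 0 :=
    mul_nonpos_of_nonneg_of_nonpos (by positivity) a1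
  have a4 : (2 / l) * ∫ X, MG P (V j) X ^ 2 ∂(Measure.pi fun _ : Fin n => P) ≤ 4 * l := by
    calc _ ≤ (2 / l) * (2 * l ^ 2) := by
            refine mul_le_mul_of_nonneg_left ?_ (by positivity)
            rw [hl2]
            refine a2.trans ?_
            have := h j
            nlinarith
      _ = 4 * l := by field_simp; ring
  linarith

/-- deviation -/
def dev {α : Type*} [MeasurableSpace α] (P : Measure α) (V : Set α) {n : ℕ} (X : Fin n → α) : ℝ :=
  P.real V - (1 / n : ℝ) * ∑ i, V.indicator 1 (X i)

lemma dev_meas {α : Type*} [MeasurableSpace α] (P : Measure α) {V : Set α} (hV : MeasurableSet V)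
    (n : ℕ) : Measurable (dev P V : (Fin n → α) → ℝ) := by
  unfold dev
  refine measurable_const.sub (measurable_const.mul (Finset.measurable_sum _ fun i _ => ?_))
  exact (measurable_one.indicator hV).comp (measurable_pi_apply i)

lemma dev_le {α : Type*} [MeasurableSpace α] (P : Measure α) [IsProbabilityMeasure P] {V : Set α}
    (h : P.real V ≤ 1 / 2) {n : ℕ} (hn : 1 ≤ n) (X : Fin n → α) :
    |dev P V X| ≤ (1 / n : ℝ) * |MG P V X| := by
  have hn' : (0:ℝ) < n := by exact_mod_cast hn
  have h0 : 0 ≤ P.real V := measureReal_nonneg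
  have e : dev P V X = - ((1 / n : ℝ) * ((1 - P.real V) * MG P V X)) := by
    unfold dev MG hh
    rw [← Finset.sum_div, Finset.sum_sub_distrib]
    simp only [Finset.sum_const, Finset.card_univ, Fintype.card_fin, nsmul_eq_mul]
    have : 1 - P.real V ≠ 0 := by linarith
    field_simp
    ring
  rw [e, abs_neg, abs_mul, abs_mul, abs_of_pos (by positivity : (0:ℝ) < 1 / n),
    abs_of_nonneg (by linarith : 0 ≤ 1 - P.real V)]
  refine mul_le_mul_of_nonneg_left ?_ (by positivity)
  nlinarith [abs_nonneg (MG P V X)]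

lemma sup_chain {α ι : Type*} [MeasurableSpace α] [LinearOrder ι] [Countable ι] (P : Measure α)
    [IsProbabilityMeasure P] (V : ι → Set α) (hm : Monotone V) (hV : ∀ k, MeasurableSet (V k))
    (δ : ℝ) (hδ : 0 < δ) (hδ2 : δ ≤ 1 / 2)
    (h : ∀ k, P.real (V k) ≤ δ) (n : ℕ) (hn : 1 ≤ n) :
    ∫⁻ X, ⨆ k, ENNReal.ofReal |dev P (V k) X| ∂(Measure.pi fun _ : Fin n => P)
        ≤ ENNReal.ofReal (9 * Real.sqrt (δ / n)) := by
  have hn' : (0:ℝ) < n := by exact_mod_cast hn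
  simp_rw [fun X : Fin n → α => iSup_eq_iSup_finset (fun k => ENNReal.ofReal |dev P (V k) X|)]
  have mm : ∀ F : Finset ι, Measurable (fun X : Fin n → α => ⨆ k ∈ F, ENNReal.ofReal |dev P (V k) X|) := by
    intro F
    refine Measurable.iSup fun k => Measurable.iSup_Prop _ ?_
    exact ((dev_meas P (hV k) n).abs).ennreal_ofReal
  rw [lintegral_iSup_directed (fun F => (mm F).aemeasurable)]
  · refine iSup_le fun F => ?_
    obtain ⟨b, bm, b0, bF, bi⟩ := maxi_first P V hm hV δ hδ hδ2 h n hn 1 (by norm_num) F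
    obtain ⟨c, cm, c0, cF, ci⟩ := maxi_first P V hm hV δ hδ hδ2 h n hn (-1) (by norm_num) F
    calc ∫⁻ X, ⨆ k ∈ F, ENNReal.ofReal |dev P (V k) X| ∂(Measure.pi fun _ : Fin n => P)
        ≤ ∫⁻ X, ENNReal.ofReal (1 / n) * (ENNReal.ofReal (b X) + ENNReal.ofReal (c X))
            ∂(Measure.pi fun _ : Fin n => P) := by
          refine lintegral_mono fun X => iSup₂_le fun k hk => ?_
          rw [← ENNReal.ofReal_add (b0 X) (c0 X), ← ENNReal.ofReal_mul (by positivity)]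
          apply ENNReal.ofReal_le_ofReal
          refine (dev_le P ((h k).trans hδ2) hn X).trans ?_
          refine mul_le_mul_of_nonneg_left ?_ (by positivity)
          have := bF k hk X
          have := cF k hk X
          have := b0 X
          have := c0 X
          rw [abs_le]; constructor <;> linarith
      _ ≤ ENNReal.ofReal (1 / n) * (ENNReal.ofReal (9 / 2 * Real.sqrt (n * δ)) + ENNReal.ofReal (9 / 2 * Real.sqrt (n * δ))) := by
          rw [lintegral_const_mul _ (by fun_prop),
            lintegral_add_left bm.ennreal_ofReal]
          gcongr
      _ = ENNReal.ofReal (9 * Real.sqrt (δ / n)) := by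
          rw [← ENNReal.ofReal_add (by positivity) (by positivity), ← ENNReal.ofReal_mul (by positivity)]
          congr 1
          have : Real.sqrt (n * δ) = n * Real.sqrt (δ / n) := by
            rw [show (n * δ : ℝ) = n ^ 2 * (δ / n) by field_simp, Real.sqrt_mul (by positivity),
              Real.sqrt_sq hn'.le]
          rw [this]
          field_simp
          ring
  · intro F G
    refine ⟨F ∪ G, fun X => ?_, fun X => ?_⟩
    · exact biSup_mono fun k hk => Finset.mem_union_left _ hk
    · exact biSup_mono fun k hk => Finset.mem_union_right _ hk

end EDB

namespace EDB

/-- supremum of the deviation over rational rays with small (co)measure -/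
def DD (P : Measure ℝ) {n : ℕ} (δ : ℝ) (X : Fin n → ℝ) : ℝ≥0∞ :=
  ⨆ q : ℚ, if min (P.real (Ioi (q : ℝ))) (P.real (Iic (q : ℝ))) ≤ δ then
    ENNReal.ofReal |dev P (Ioi (q : ℝ)) X| else 0

lemma dev_compl (P : Measure ℝ) [IsProbabilityMeasure P] {n : ℕ} (hn : 1 ≤ n) (q : ℝ)
    (X : Fin n → ℝ) : dev P (Iic q) X = - dev P (Ioi q) X := by
  have hn' : (0:ℝ) < n := by exact_mod_cast hn
  unfold dev
  rw [← compl_Ioi, probReal_compl_eq_one_sub measurableSet_Ioi]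
  have : ∀ x : ℝ, (Ioi q)ᶜ.indicator (1 : ℝ → ℝ) x = 1 - (Ioi q).indicator 1 x := by
    intro x
    rw [indicator_compl]; rfl
  simp_rw [this]
  rw [Finset.sum_sub_distrib]
  simp only [Finset.sum_const, Finset.card_univ, Fintype.card_fin, nsmul_eq_mul]
  field_simp
  ring

lemma DD_int (P : Measure ℝ) [IsProbabilityMeasure P] {n : ℕ} (hn : 1 ≤ n) (δ : ℝ) (hδ : 0 < δ) :
    ∫⁻ X, DD P δ X ∂(Measure.pi fun _ : Fin n => P) ≤ ENNReal.ofReal (18 * Real.sqrt (δ / n)) := by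
  have hn' : (0:ℝ) < n := by exact_mod_cast hn
  set d := min δ (1 / 2) with hd
  have hd0 : 0 < d := lt_min hδ (by norm_num)
  have hd2 : d ≤ 1 / 2 := min_le_right _ _
  have hs : Real.sqrt (d / n) ≤ Real.sqrt (δ / n) :=
    Real.sqrt_le_sqrt (div_le_div_of_nonneg_right (min_le_left _ _) hn'.le)
  have : Countable ℚᵒᵈ := inferInstanceAs (Countable ℚ)
  have hA := sup_chain (ι := {q : ℚᵒᵈ // P.real (Ioi ((OrderDual.ofDual q : ℚ) : ℝ)) ≤ d}) P
    (fun q => Ioi ((OrderDual.ofDual q.1 : ℚ) : ℝ))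
    (fun p q hpq => Ioi_subset_Ioi (by exact_mod_cast hpq)) (fun _ => measurableSet_Ioi) d hd0 hd2
    (fun q => q.2) n hn
  have hB := sup_chain (ι := {q : ℚ // P.real (Iic (q : ℝ)) ≤ d}) P
    (fun q => Iic (q.1 : ℝ))
    (fun p q hpq => Iic_subset_Iic.2 (by exact_mod_cast hpq)) (fun _ => measurableSet_Iic) d hd0 hd2
    (fun q => q.2) n hn
  calc ∫⁻ X, DD P δ X ∂(Measure.pi fun _ : Fin n => P)
      ≤ ∫⁻ X, ((⨆ k : {q : ℚᵒᵈ // P.real (Ioi ((OrderDual.ofDual q : ℚ) : ℝ)) ≤ d},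
            ENNReal.ofReal |dev P (Ioi ((OrderDual.ofDual k.1 : ℚ) : ℝ)) X|)
          + ⨆ k : {q : ℚ // P.real (Iic (q : ℝ)) ≤ d}, ENNReal.ofReal |dev P (Iic (k.1 : ℝ)) X|)
          ∂(Measure.pi fun _ : Fin n => P) := by
        refine lintegral_mono fun X => iSup_le fun q => ?_
        split_ifs with h
        · have hc : P.real (Iic (q : ℝ)) = 1 - P.real (Ioi (q : ℝ)) := by
            rw [← compl_Ioi, probReal_compl_eq_one_sub measurableSet_Ioi]
          rcases le_total (P.real (Ioi (q : ℝ))) (P.real (Iic (q : ℝ))) with hle | hle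
          · rw [min_eq_left hle] at h
            refine le_trans ?_ le_self_add
            exact le_iSup (fun k : {q : ℚᵒᵈ // P.real (Ioi ((OrderDual.ofDual q : ℚ) : ℝ)) ≤ d} =>
              ENNReal.ofReal |dev P (Ioi ((OrderDual.ofDual k.1 : ℚ) : ℝ)) X|)
              ⟨OrderDual.toDual q, le_min h (by rw [OrderDual.ofDual_toDual]; linarith)⟩
          · rw [min_eq_right hle] at h
            refine le_trans ?_ le_add_self
            rw [← abs_neg, ← dev_compl P hn]
            exact le_iSup (fun k : {q : ℚ // P.real (Iic (q : ℝ)) ≤ d} =>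
              ENNReal.ofReal |dev P (Iic (k.1 : ℝ)) X|)
              ⟨q, le_min h (by linarith)⟩
        · exact zero_le
    _ ≤ ENNReal.ofReal (9 * Real.sqrt (d / n)) + ENNReal.ofReal (9 * Real.sqrt (d / n)) := by
        rw [lintegral_add_left]
        · exact add_le_add hA hB
        · exact Measurable.iSup fun k => ((dev_meas P measurableSet_Ioi n).abs).ennreal_ofReal
    _ ≤ _ := by
        rw [← ENNReal.ofReal_add (by positivity) (by positivity)]
        apply ENNReal.ofReal_le_ofReal
        linarith

lemma upper_approx {U : Set ℝ} (hU : IsUpperSet U) :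
    ∃ q : ℕ → ℚ, ∀ x, ∀ᶠ k in atTop, (x ∈ Ioi ((q k : ℚ) : ℝ) ↔ x ∈ U) := by
  rcases U.eq_empty_or_nonempty with rfl | hne
  · refine ⟨fun k => k, fun x => ?_⟩
    obtain ⟨N, hN⟩ := exists_nat_gt x
    filter_upwards [eventually_ge_atTop N] with k hk
    have : (N : ℝ) ≤ k := by exact_mod_cast hk
    simp; linarith
  by_cases hb : BddBelow U
  · set c := sInf U with hc
    have h1 : ∀ x, c < x → x ∈ U := by
      intro x hx
      obtain ⟨y, hy, hyx⟩ := exists_lt_of_csInf_lt hne hx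
      exact hU hyx.le hy
    have h2 : ∀ x ∈ U, c ≤ x := fun x hx => csInf_le hb hx
    have htend := tendsto_one_div_add_atTop_nhds_zero_nat (𝕜 := ℝ)
    by_cases hcU : c ∈ U
    · have : ∀ k : ℕ, ∃ q : ℚ, c - 1 / ((k : ℝ) + 1) < q ∧ (q : ℝ) < c := fun k =>
        exists_rat_btwn (by have : (0:ℝ) < 1 / ((k : ℝ) + 1) := by positivity
                            linarith)
      choose q hq1 hq2 using this
      refine ⟨q, fun x => ?_⟩
      rcases lt_or_ge x c with hx | hx
      · have : ∀ᶠ k : ℕ in atTop, 1 / ((k : ℝ) + 1) < c - x :=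
          htend.eventually_lt_const (by linarith)
        filter_upwards [this] with k hk
        have := hq1 k
        have hn : x ∉ U := fun h => absurd (h2 x h) (not_le.2 hx)
        simp only [hn, iff_false, mem_Ioi, not_lt]
        linarith
      · refine Eventually.of_forall fun k => ?_
        have : x ∈ U := hU hx hcU
        simp only [this, iff_true, mem_Ioi]
        exact (hq2 k).trans_le hx
    · have : ∀ k : ℕ, ∃ q : ℚ, c < q ∧ (q : ℝ) < c + 1 / ((k : ℝ) + 1) := fun k =>
        exists_rat_btwn (by have : (0:ℝ) < 1 / ((k : ℝ) + 1) := by positivity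
                            linarith)
      choose q hq1 hq2 using this
      refine ⟨q, fun x => ?_⟩
      rcases lt_or_ge c x with hx | hx
      · have : ∀ᶠ k : ℕ in atTop, 1 / ((k : ℝ) + 1) < x - c :=
          htend.eventually_lt_const (by linarith)
        filter_upwards [this] with k hk
        have := hq2 k
        simp only [h1 x hx, iff_true, mem_Ioi]
        linarith
      · refine Eventually.of_forall fun k => ?_
        have hn : x ∉ U := fun h => hcU (by rwa [le_antisymm (h2 x h) hx])
        simp only [hn, iff_false, mem_Ioi, not_lt]
        exact hx.trans (hq1 k).le
  · refine ⟨fun k => -k, fun x => ?_⟩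
    have hxU : x ∈ U := by
      rw [not_bddBelow_iff] at hb
      obtain ⟨y, hy, hyx⟩ := hb x
      exact hU hyx.le hy
    obtain ⟨N, hN⟩ := exists_nat_gt (-x)
    filter_upwards [eventually_ge_atTop N] with k hk
    have : (N : ℝ) ≤ k := by exact_mod_cast hk
    simp only [hxU, iff_true, mem_Ioi]
    push_cast
    linarith

lemma dev_le_DD (P : Measure ℝ) [IsProbabilityMeasure P] {n : ℕ} {U : Set ℝ} (hU : IsUpperSet U)
    (δ : ℝ) (h : min (P.real U) (1 - P.real U) < δ) (X : Fin n → ℝ) :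
    ENNReal.ofReal |dev P U X| ≤ DD P δ X := by
  obtain ⟨q, hq⟩ := upper_approx hU
  have t1 : Tendsto (fun k => P.real (Ioi ((q k : ℚ) : ℝ))) atTop (nhds (P.real U)) := by
    have := tendsto_measure_of_tendsto_indicator_of_isFiniteMeasure (A := U) atTop P
      (As := fun k => Ioi ((q k : ℚ) : ℝ)) (fun k => measurableSet_Ioi) hq
    exact (ENNReal.tendsto_toReal (measure_ne_top P U)).comp this
  have t2 : Tendsto (fun k => dev P (Ioi ((q k : ℚ) : ℝ)) X) atTop (nhds (dev P U X)) := by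
    unfold dev
    refine t1.sub (Tendsto.const_mul _ (tendsto_finsetSum _ fun i _ => ?_))
    refine tendsto_const_nhds.congr' ?_
    filter_upwards [hq (X i)] with k hk
    by_cases hx : X i ∈ U
    · rw [indicator_of_mem hx, indicator_of_mem (hk.2 hx)]
    · rw [indicator_of_notMem hx, indicator_of_notMem (fun h => hx (hk.1 h))]
  have t3 : ∀ᶠ k in atTop, min (P.real (Ioi ((q k : ℚ) : ℝ))) (1 - P.real (Ioi ((q k : ℚ) : ℝ))) < δ :=
    (t1.min (tendsto_const_nhds.sub t1)).eventually_lt_const h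
  refine le_of_tendsto (ENNReal.tendsto_ofReal t2.abs) ?_
  filter_upwards [t3] with k hk
  refine le_trans ?_ (le_iSup _ (q k))
  rw [if_pos]
  rw [← compl_Ioi, probReal_compl_eq_one_sub measurableSet_Ioi]
  exact hk.le

lemma DD_meas (P : Measure ℝ) (n : ℕ) (δ : ℝ → ℝ) (hδ : Measurable δ) :
    Measurable (fun p : (Fin n → ℝ) × ℝ => DD P (δ p.2) p.1) := by
  unfold DD
  refine Measurable.iSup fun q => Measurable.ite ?_ ?_ measurable_const
  · exact measurableSet_le measurable_const (hδ.comp measurable_snd)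
  · exact (((dev_meas P measurableSet_Ioi n).comp measurable_fst).abs).ennreal_ofReal

lemma DD_meas1 (P : Measure ℝ) (n : ℕ) (δ : ℝ) :
    Measurable (fun X : Fin n → ℝ => DD P δ X) := by
  unfold DD
  refine Measurable.iSup fun q => Measurable.ite (MeasurableSet.const _) ?_ measurable_const
  exact ((dev_meas P measurableSet_Ioi n).abs).ennreal_ofReal

/-- layer cake kernel -/
def JJ (u v t : ℝ) : ℝ := |(Iio u).indicator 1 t - (Iio v).indicator 1 t|

lemma JJ_eq (u v t : ℝ) : JJ u v t = (Ico (min u v) (max u v)).indicator 1 t := by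
  unfold JJ
  simp only [indicator, mem_Iio, mem_Ico, Pi.one_apply]
  rcases le_total u v with h | h
  · rw [min_eq_left h, max_eq_right h]
    split_ifs <;> first | (exfalso; grind) | simp
  · rw [min_eq_right h, max_eq_left h]
    split_ifs <;> first | (exfalso; grind) | simp

lemma JJ_integral (u v : ℝ) : ∫ t, JJ u v t = |u - v| := by
  simp_rw [JJ_eq]
  rw [integral_indicator_one measurableSet_Ico, Real.volume_real_Ico_of_le min_le_max,
    max_sub_min_eq_abs, abs_sub_comm]

lemma JJ_integrable (u v : ℝ) : Integrable (JJ u v) := by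
  have : JJ u v = (Ico (min u v) (max u v)).indicator 1 := funext (JJ_eq u v)
  rw [this]
  exact (integrableOn_const (by simp) (by simp)).integrable_indicator measurableSet_Ico

lemma JJ_meas : Measurable (fun p : (ℝ × ℝ) × ℝ => JJ p.1.1 p.1.2 p.2) := by
  have : ∀ g : (ℝ × ℝ) × ℝ → ℝ, Measurable g →
      Measurable (fun p : (ℝ × ℝ) × ℝ => (Iio (g p)).indicator (1 : ℝ → ℝ) p.2) := by
    intro g hg
    simp only [indicator, mem_Iio, Pi.one_apply]
    exact Measurable.ite (measurableSet_lt measurable_snd hg) measurable_const measurable_const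
  unfold JJ
  exact ((this _ (measurable_fst.comp measurable_fst)).sub
    (this _ (measurable_snd.comp measurable_fst))).abs

lemma pointwise (P : Measure ℝ) [IsProbabilityMeasure P] {n : ℕ} (f m : ℝ → ℝ)
    (hf : Monotone f) (hm : Monotone m) (fi : Integrable f P) (mi : Integrable m P)
    (δ : ℝ → ℝ) (hfδ : ∀ t, min (P.real {x | t < f x}) (1 - P.real {x | t < f x}) < δ t)
    (hmδ : ∀ t, min (P.real {x | t < m x}) (1 - P.real {x | t < m x}) < δ t) (X : Fin n → ℝ) :
    ENNReal.ofReal (abs ((∫ x, |f x - m x| ∂P) - (1 / n : ℝ) * ∑ i : Fin n, |f (X i) - m (X i)|))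
      ≤ ∫⁻ t, 2 * DD P (δ t) X := by
  have Jm : Measurable (fun p : ℝ × ℝ => JJ (f p.1) (m p.1) p.2) :=
    JJ_meas.comp (((hf.measurable.comp measurable_fst).prodMk
      (hm.measurable.comp measurable_fst)).prodMk measurable_snd)
  have Jn : ∀ u v t, ‖JJ u v t‖ = JJ u v t := fun u v t => by
    rw [Real.norm_eq_abs]; exact abs_of_nonneg (abs_nonneg _)
  have Ji : Integrable (fun p : ℝ × ℝ => JJ (f p.1) (m p.1) p.2) (P.prod volume) := by
    rw [integrable_prod_iff Jm.aestronglyMeasurable]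
    refine ⟨Eventually.of_forall fun x => JJ_integrable (f x) (m x), ?_⟩
    simp only [Jn, JJ_integral]
    exact (fi.sub mi).abs
  have e1 : ∫ x, |f x - m x| ∂P = ∫ t, ∫ x, JJ (f x) (m x) t ∂P := by
    rw [← integral_integral_swap (f := fun x t => JJ (f x) (m x) t) Ji]
    simp only [JJ_integral]
  have e2 : (1 / n : ℝ) * ∑ i : Fin n, |f (X i) - m (X i)|
      = ∫ t, (1 / n : ℝ) * ∑ i : Fin n, JJ (f (X i)) (m (X i)) t := by
    rw [integral_const_mul, integral_finsetSum _ fun i _ => JJ_integrable (f (X i)) (m (X i))]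
    simp only [JJ_integral]
  have i1 : Integrable (fun t => ∫ x, JJ (f x) (m x) t ∂P) := Ji.integral_prod_right
  have i2 : Integrable (fun t => (1 / n : ℝ) * ∑ i : Fin n, JJ (f (X i)) (m (X i)) t) :=
    (integrable_finsetSum _ fun i _ => JJ_integrable (f (X i)) (m (X i))).const_mul _
  rw [e1, e2, ← integral_sub i1 i2, ← Real.enorm_eq_ofReal_abs]
  refine (enorm_integral_le_lintegral_enorm _).trans (lintegral_mono fun t => ?_)
  have uf : IsUpperSet {x | t < f x} := fun x y hxy (hx : t < f x) => hx.trans_le (hf hxy)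
  have um : IsUpperSet {x | t < m x} := fun x y hxy (hx : t < m x) => hx.trans_le (hm hxy)
  have msf : MeasurableSet {x | t < f x} := measurableSet_lt measurable_const hf.measurable
  have msm : MeasurableSet {x | t < m x} := measurableSet_lt measurable_const hm.measurable
  have key : ∀ A B : Set ℝ, MeasurableSet A → MeasurableSet B → A ⊆ B →
      (∀ x, JJ (f x) (m x) t = B.indicator 1 x - A.indicator 1 x) →
      (∫ x, JJ (f x) (m x) t ∂P) - (1 / n : ℝ) * ∑ i : Fin n, JJ (f (X i)) (m (X i)) t
        = dev P B X - dev P A X := by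
    intro A B hA hB hAB h
    simp_rw [h]
    rw [integral_sub, integral_indicator_one hA, integral_indicator_one hB,
      Finset.sum_sub_distrib]
    · unfold dev; ring
    · exact (integrable_const (1:ℝ)).indicator hB
    · exact (integrable_const (1:ℝ)).indicator hA
  have fin : ∀ a b : ℝ, ENNReal.ofReal |a| ≤ DD P (δ t) X → ENNReal.ofReal |b| ≤ DD P (δ t) X →
      ‖a - b‖ₑ ≤ 2 * DD P (δ t) X := by
    intro a b h1 h2
    rw [Real.enorm_eq_ofReal_abs, two_mul]
    refine (ENNReal.ofReal_le_ofReal (abs_sub a b)).trans ?_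
    rw [ENNReal.ofReal_add (abs_nonneg _) (abs_nonneg _)]
    exact add_le_add h1 h2
  have kf := dev_le_DD P uf (δ t) (hfδ t) X
  have km := dev_le_DD P um (δ t) (hmδ t) X
  rcases uf.total um with h | h
  · rw [key _ _ msf msm h]
    · exact fin _ _ km kf
    · intro x
      have := @h x
      simp only [mem_ofPred_eq] at this
      simp only [JJ, indicator, mem_Iio, mem_ofPred_eq, Pi.one_apply]
      split_ifs <;> simp_all
  · rw [key _ _ msm msf h]
    · exact fin _ _ kf km
    · intro x
      have := @h x
      simp only [mem_ofPred_eq] at this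
      simp only [JJ, indicator, mem_Iio, mem_ofPred_eq, Pi.one_apply]
      split_ifs <;> simp_all

end EDB

namespace EDB

lemma moment (P : Measure ℝ) [IsProbabilityMeasure P] (f : ℝ → ℝ) (hf : Measurable f)
    (p M : ℝ) (hp : 1 ≤ p) (hM : 0 ≤ M)
    (h : ∫⁻ x, ENNReal.ofReal (|f x| ^ p) ∂P ≤ ENNReal.ofReal M) :
    Integrable f P ∧ ∀ t, min (P.real {x | t < f x}) (1 - P.real {x | t < f x})
      < 2 * (2 ^ p * (1 + M)) * (1 + |t|) ^ (-p) := by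
  have hp0 : 0 ≤ p := by linarith
  have m1 : Measurable (fun x => |f x| ^ p) := hf.abs.pow_const p
  have i1 : Integrable (fun x => |f x| ^ p) P := by
    refine ⟨m1.aestronglyMeasurable, ?_⟩
    rw [hasFiniteIntegral_iff_ofReal (Eventually.of_forall fun x => by positivity)]
    exact h.trans_lt ENNReal.ofReal_lt_top
  have b1 : ∫ x, |f x| ^ p ∂P ≤ M := by
    rw [← ofReal_integral_eq_lintegral_ofReal i1 (Eventually.of_forall fun x => by positivity)] at h
    exact (ENNReal.ofReal_le_ofReal_iff hM).1 h
  have i2 : Integrable (fun x => 2 ^ p * (1 + |f x| ^ p)) P :=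
    ((integrable_const 1).add i1).const_mul _
  have le2 : ∀ x, (1 + |f x|) ^ p ≤ 2 ^ p * (1 + |f x| ^ p) := by
    intro x
    have h0 := abs_nonneg (f x)
    rcases le_total |f x| 1 with h1 | h1
    · calc (1 + |f x|) ^ p ≤ 2 ^ p := Real.rpow_le_rpow (by positivity) (by linarith) hp0
        _ ≤ _ := le_mul_of_one_le_right (by positivity) (by
            have : 0 ≤ |f x| ^ p := by positivity
            linarith)
    · calc (1 + |f x|) ^ p ≤ (2 * |f x|) ^ p :=
            Real.rpow_le_rpow (by positivity) (by linarith) hp0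
        _ = 2 ^ p * |f x| ^ p := Real.mul_rpow (by norm_num) h0
        _ ≤ _ := by gcongr; linarith
  have m3 : Measurable (fun x => (1 + |f x|) ^ p) := (hf.abs.const_add 1).pow_const p
  have i3 : Integrable (fun x => (1 + |f x|) ^ p) P := by
    refine i2.mono' m3.aestronglyMeasurable (Eventually.of_forall fun x => ?_)
    rw [Real.norm_eq_abs, abs_of_nonneg (by positivity)]
    exact le2 x
  have b3 : ∫ x, (1 + |f x|) ^ p ∂P ≤ 2 ^ p * (1 + M) := by
    refine (integral_mono i3 i2 le2).trans ?_
    rw [integral_const_mul, integral_add (integrable_const 1) i1]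
    simp only [integral_const, probReal_univ, one_smul]
    gcongr
  refine ⟨?_, fun t => ?_⟩
  · refine i3.mono' hf.aestronglyMeasurable (Eventually.of_forall fun x => ?_)
    rw [Real.norm_eq_abs]
    have h0 := abs_nonneg (f x)
    calc |f x| ≤ 1 + |f x| := by linarith
      _ = (1 + |f x|) ^ (1 : ℝ) := (Real.rpow_one _).symm
      _ ≤ _ := Real.rpow_le_rpow_of_exponent_le (by linarith) hp
  · have mk := mul_meas_ge_le_integral_of_nonneg (μ := P)
      (Eventually.of_forall fun x => by positivity : 0 ≤ᵐ[P] fun x => (1 + |f x|) ^ p) i3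
      ((1 + |t|) ^ p)
    have ht : 0 < (1 + |t|) ^ p := by positivity
    have hK : 0 < 2 ^ p * (1 + M) := by positivity
    have q1 : P.real {x | (1 + |t|) ^ p ≤ (1 + |f x|) ^ p} ≤ (2 ^ p * (1 + M)) * (1 + |t|) ^ (-p) := by
      rw [Real.rpow_neg (by positivity), ← div_eq_mul_inv, le_div_iff₀ ht, mul_comm]
      exact mk.trans b3
    have q2 : min (P.real {x | t < f x}) (1 - P.real {x | t < f x})
        ≤ P.real {x | (1 + |t|) ^ p ≤ (1 + |f x|) ^ p} := by
      rcases le_total 0 t with h0 | h0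
      · refine (min_le_left _ _).trans (measureReal_mono ?_)
        intro x (hx : t < f x)
        refine Real.rpow_le_rpow (by positivity) ?_ hp0
        rw [abs_of_nonneg h0]
        have := le_abs_self (f x)
        linarith
      · refine (min_le_right _ _).trans ?_
        rw [← probReal_compl_eq_one_sub (measurableSet_lt measurable_const hf)]
        refine measureReal_mono ?_
        intro x hx
        have hx : f x ≤ t := not_lt.1 hx
        refine Real.rpow_le_rpow (by positivity) ?_ hp0
        rw [abs_of_nonpos h0]
        have := neg_abs_le (f x)
        linarith
    have q3 : 0 < (2 ^ p * (1 + M)) * (1 + |t|) ^ (-p) := by positivity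
    linarith

/-- extension of a function on the unit interval to the line by clamping -/
def clampF (f : ℝ → ℝ) (x : ℝ) : ℝ := f (max 0 (min x 1))

lemma clampF_eq (f : ℝ → ℝ) {x : ℝ} (hx : x ∈ Icc (0:ℝ) 1) : clampF f x = f x := by
  unfold clampF
  rw [min_eq_left hx.2, max_eq_right hx.1]

lemma clampF_mono {f : ℝ → ℝ} (hf : MonotoneOn f (Icc 0 1)) : Monotone (clampF f) := by
  intro x y hxy
  refine hf ⟨le_max_left _ _, max_le zero_le_one (min_le_right _ _)⟩
    ⟨le_max_left _ _, max_le zero_le_one (min_le_right _ _)⟩ ?_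
  exact max_le_max le_rfl (min_le_min hxy le_rfl)

end EDB

/-- **Uniform empirical-vs-population deviation bound over `M(M,a)`** (Lemma A.2).
For a continuous distribution `μ_X` and any fixed `m ∈ M(M,a)`, the expected supremum
over `f ∈ M(M,a)` of the absolute difference between `∫ |f - m| dμ_X` and its
empirical counterpart `(1/n) Σᵢ |f(Xᵢ) - m(Xᵢ)|` is at most `C n^{-1/2}`. (The outer
expectation is taken as a lower Lebesgue integral, avoiding measurability issues of
the supremum.) -/
theorem empirical_deviation_bound_MM
    (μX : Measure ℝ) (hXprob : IsProbabilityMeasure μX)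
    (hXsupp : μX (Icc 0 1) = 1) (hXcont : ∀ x : ℝ, μX {x} = 0)
    (a M : ℝ) (ha : 0 < a) (hM : 0 < M) :
    ∃ C > 0, ∀ n : ℕ, 1 ≤ n → ∀ m ∈ MM μX M a,
      ∫⁻ X : Fin n → ℝ,
          (⨆ f ∈ MM μX M a, ENNReal.ofReal
            (abs ((∫ x, |f x - m x| ∂μX) -
              (1 / n : ℝ) * ∑ i : Fin n, |f (X i) - m (X i)|)))
          ∂(Measure.pi fun _ : Fin n => μX) ≤
        ENNReal.ofReal (C * (n : ℝ) ^ (-(1 : ℝ) / 2)) := by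
  have hp : 1 < (a + 2) / 2 := by linarith
  have hI : Integrable (fun t : ℝ => (1 + ‖t‖) ^ (-((a + 2) / 2))) volume :=
    integrable_one_add_norm (by simpa using hp)
  set I := ∫ t : ℝ, (1 + ‖t‖) ^ (-((a + 2) / 2)) with hIdef
  have hI0 : 0 ≤ I := integral_nonneg fun t => by positivity
  set K : ℝ := 2 * (2 ^ (a + 2) * (1 + M)) with hK
  have hK0 : 0 < K := by positivity
  refine ⟨36 * Real.sqrt K * I + 1, by positivity, ?_⟩
  intro n hn m hm
  have hn' : (0:ℝ) < n := by exact_mod_cast hn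
  have hae : ∀ᵐ x ∂μX, x ∈ Icc (0:ℝ) 1 := by
    rw [ae_iff_prob_eq_one measurableSet_Icc.mem]
    exact hXsupp
  have hae' : ∀ᵐ X : Fin n → ℝ ∂(Measure.pi fun _ : Fin n => μX), ∀ i, X i ∈ Icc (0:ℝ) 1 := by
    rw [ae_all_iff]
    intro i
    exact (measurePreserving_eval (fun _ : Fin n => μX) i).quasiMeasurePreserving.ae hae
  have cl : ∀ f ∈ MM μX M a, Monotone (EDB.clampF f) ∧
      (∫⁻ x, ENNReal.ofReal (|EDB.clampF f x| ^ (a + 2)) ∂μX ≤ ENNReal.ofReal M) := by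
    intro f hf
    refine ⟨EDB.clampF_mono hf.1.1, le_of_eq_of_le (lintegral_congr_ae ?_) hf.2⟩
    filter_upwards [hae] with x hx
    rw [EDB.clampF_eq f hx]
  set δ : ℝ → ℝ := fun t => K * (1 + |t|) ^ (-(a + 2)) with hδ
  have δm : Measurable δ := by
    exact ((measurable_id.abs.const_add 1).pow_const _).const_mul K
  have δ0 : ∀ t, 0 < δ t := fun t => by positivity
  have step1 : ∀ᵐ X : Fin n → ℝ ∂(Measure.pi fun _ : Fin n => μX),
      (⨆ f ∈ MM μX M a, ENNReal.ofReal
            (abs ((∫ x, |f x - m x| ∂μX) -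
              (1 / n : ℝ) * ∑ i : Fin n, |f (X i) - m (X i)|)))
        ≤ ∫⁻ t, 2 * EDB.DD μX (δ t) X := by
    filter_upwards [hae'] with X hX
    refine iSup₂_le fun f hf => ?_
    obtain ⟨cf1, cf2⟩ := cl f hf
    obtain ⟨cm1, cm2⟩ := cl m hm
    obtain ⟨fi, fd⟩ := EDB.moment μX _ cf1.measurable (a + 2) M (by linarith) hM.le cf2
    obtain ⟨mi, md⟩ := EDB.moment μX _ cm1.measurable (a + 2) M (by linarith) hM.le cm2
    have := EDB.pointwise μX _ _ cf1 cm1 fi mi δ fd md X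
    refine le_of_eq_of_le ?_ this
    congr 3
    · refine integral_congr_ae ?_
      filter_upwards [hae] with x hx
      rw [EDB.clampF_eq f hx, EDB.clampF_eq m hx]
    · congr 1
      refine Finset.sum_congr rfl fun i _ => ?_
      rw [EDB.clampF_eq f (hX i), EDB.clampF_eq m (hX i)]
  have dm := EDB.DD_meas μX n δ δm
  refine (lintegral_mono_ae step1).trans ?_
  have sw : ∫⁻ X : Fin n → ℝ, ∫⁻ t : ℝ, 2 * EDB.DD μX (δ t) X ∂volume
        ∂(Measure.pi fun _ : Fin n => μX)
      = ∫⁻ t : ℝ, ∫⁻ X : Fin n → ℝ, 2 * EDB.DD μX (δ t) X ∂(Measure.pi fun _ : Fin n => μX)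
        ∂volume :=
    lintegral_lintegral_swap (f := fun (X : Fin n → ℝ) (t : ℝ) => 2 * EDB.DD μX (δ t) X)
      ((dm.const_mul 2).aemeasurable)
  rw [sw]
  have step2 : ∀ t, ∫⁻ X, 2 * EDB.DD μX (δ t) X ∂(Measure.pi fun _ : Fin n => μX)
      ≤ ENNReal.ofReal (36 * Real.sqrt K * (n : ℝ) ^ (-(1 : ℝ) / 2)
          * (1 + ‖t‖) ^ (-((a + 2) / 2))) := by
    intro t
    have mt : Measurable (fun X : Fin n → ℝ => EDB.DD μX (δ t) X) :=
      EDB.DD_meas1 μX n (δ t)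
    rw [lintegral_const_mul _ mt]
    refine (mul_le_mul_right (EDB.DD_int μX hn (δ t) (δ0 t)) 2).trans ?_
    rw [show (2 : ℝ≥0∞) = ENNReal.ofReal 2 by simp, ← ENNReal.ofReal_mul (by norm_num)]
    apply ENNReal.ofReal_le_ofReal
    apply le_of_eq
    have e1 : Real.sqrt (δ t / n)
        = Real.sqrt K * (n : ℝ) ^ (-(1 : ℝ) / 2) * (1 + ‖t‖) ^ (-((a + 2) / 2)) := by
      have e2 : Real.sqrt ((1 + |t|) ^ (-(a + 2))) = (1 + ‖t‖) ^ (-((a + 2) / 2)) := by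
        rw [Real.sqrt_eq_rpow, ← Real.rpow_mul (by positivity), Real.norm_eq_abs]
        congr 1; ring
      have e3 : Real.sqrt ((n : ℝ)⁻¹) = (n : ℝ) ^ (-(1 : ℝ) / 2) := by
        rw [Real.sqrt_eq_rpow, ← Real.rpow_neg_one, ← Real.rpow_mul (by positivity)]
        congr 1; ring
      rw [← e2, ← e3, ← Real.sqrt_mul hK0.le, ← Real.sqrt_mul (by positivity)]
      congr 1
      simp only [hδ]
      field_simp
    rw [e1]; ring
  refine (lintegral_mono step2).trans ?_
  have c0 : 0 ≤ 36 * Real.sqrt K * (n : ℝ) ^ (-(1 : ℝ) / 2) := by positivity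
  rw [← ofReal_integral_eq_lintegral_ofReal
    (hI.const_mul (36 * Real.sqrt K * (n : ℝ) ^ (-(1 : ℝ) / 2)))
    (Eventually.of_forall fun t => mul_nonneg c0 (by positivity)), integral_const_mul]
  apply ENNReal.ofReal_le_ofReal
  rw [← hIdef]
  have : 0 ≤ (n : ℝ) ^ (-(1 : ℝ) / 2) := by positivity
  nlinarith
end
end
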